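/- arXiv:1301.1993 — 2 statements merged into one kernel-verified Lean document; each statement's English description precedes it below -/
import Mathlib

section
/- Assume the standing hypotheses on μ. For every δ > 0 there exists r₀ > 0 such that for all 0 < r ≤ r₀ there is an orthonormal basis (x₁,x₂,x₃,x₄) of ℝ⁴ diagonalizing the second moment as Q_{0,r} = Σ_{i=1}^{4} λᵢ xᵢ², with |λᵢ − 1/2| < δ for i = 1,2,3 and |λ₄ − 3/2| < δ. -/
open Metric Set MeasureTheory Filter Module
open scoped RealInnerProductSpace Topology Pointwise ENNReal

noncomputable section

/-- `ℝⁿ` as a Euclidean space. -/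
abbrev E (n : ℕ) : Type := EuclideanSpace ℝ (Fin n)

/-- `d(A,B) = sup_{a ∈ A} inf_{b ∈ B} |a - b|`. -/
def setD {n : ℕ} (A B : Set (E n)) : ℝ := ⨆ a ∈ A, Metric.infDist a B

/-- `d^{x,r}(A,B) = (1/r) d(A ∩ B(x,r), B ∩ B(x,r))`. -/
def dxr {n : ℕ} (x : E n) (r : ℝ) (A B : Set (E n)) : ℝ :=
  (1 / r) * setD (A ∩ closedBall x r) (B ∩ closedBall x r)

/-- `D^{x,r}(A,B) = max(d^{x,r}(A,B), d^{x,r}(B,A))`. -/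
def Dxr {n : ℕ} (x : E n) (r : ℝ) (A B : Set (E n)) : ℝ :=
  max (dxr x r A B) (dxr x r B A)

/-- `d̃^{x,r}(A,B) = (1/r) d(A ∩ B(x,r), B)`. -/
def dtxr {n : ℕ} (x : E n) (r : ℝ) (A B : Set (E n)) : ℝ :=
  (1 / r) * setD (A ∩ closedBall x r) B

/-- `D̃^{x,r}(A,B) = max(d̃^{x,r}(A,B), d̃^{x,r}(B,A))`. -/
def Dtxr {n : ℕ} (x : E n) (r : ℝ) (A B : Set (E n)) : ℝ :=
  max (dtxr x r A B) (dtxr x r B A)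

/-- `C` is a cone based at `y`: `y ∈ C` and `s • (C − y) = C − y` for all `s > 0`. -/
def IsConeAt {n : ℕ} (y : E n) (C : Set (E n)) : Prop :=
  y ∈ C ∧ ∀ s : ℝ, 0 < s → s • {z : E n | y + z ∈ C} = {z : E n | y + z ∈ C}

/-- The standard KP cone `{x₄² = x₁² + x₂² + x₃²}` in `ℝⁿ`, `n ≥ 4`. -/
def stdKP (n : ℕ) (hn : 4 ≤ n) : Set (E n) :=
  {x : E n | (x ⟨3, by omega⟩) ^ 2 =
    (x ⟨0, by omega⟩) ^ 2 + (x ⟨1, by omega⟩) ^ 2 + (x ⟨2, by omega⟩) ^ 2}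

/-- `C` is a KP cone based at `y`: in some orthonormal coordinates centered at the origin,
`C − y` is the standard KP cone. -/
def IsKPCone {n : ℕ} (hn : 4 ≤ n) (y : E n) (C : Set (E n)) : Prop :=
  ∃ f : E n ≃ₗᵢ[ℝ] E n, {z : E n | y + z ∈ C} = f ⁻¹' stdKP n hn

/-- `θ^P_Σ(x,r)` : best approximation of `S` in `B(x,r)` by affine `m`-planes through `x`. -/
def thetaP {n : ℕ} (m : ℕ) (S : Set (E n)) (x : E n) (r : ℝ) : ℝ :=
  ⨅ L : {L : AffineSubspace ℝ (E n) // x ∈ L ∧ Module.finrank ℝ L.direction = m},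
    Dxr x r S (L.1 : Set (E n))

/-- `θ^C_Σ(x,r)` : best approximation of `S` in `B(x,r)` by KP cones based at `x`. -/
def thetaC {n : ℕ} (hn : 4 ≤ n) (S : Set (E n)) (x : E n) (r : ℝ) : ℝ :=
  ⨅ C : {C : Set (E n) // IsKPCone hn x C}, Dxr x r S C.1

/-- `ϑ^C_Σ(x,r)` : best approximation of `S` in `B(x,r)` by KP cones containing `x`. -/
def varthetaC {n : ℕ} (hn : 4 ≤ n) (S : Set (E n)) (x : E n) (r : ℝ) : ℝ :=
  ⨅ C : {C : Set (E n) // (∃ y, IsKPCone hn y C) ∧ x ∈ C}, Dxr x r S C.1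

/-- The angle `∠(P₁,P₂) = arcsin Γ(P₁,P₂)` between two affine planes. -/
def planeAngle {n : ℕ} (P₁ P₂ : AffineSubspace ℝ (E n)) : ℝ :=
  Real.arcsin (dxr (0 : E n) 1 (P₁.direction : Set (E n)) (P₂.direction : Set (E n)))

/-- The support of a measure. -/
def msupp {n : ℕ} (μ : Measure (E n)) : Set (E n) :=
  {x : E n | ∀ r : ℝ, 0 < r → 0 < μ (closedBall x r)}

/-- Weak convergence of a sequence of measures in the sense of Radon measures. -/
def VagueTendsto {n : ℕ} (μs : ℕ → Measure (E n)) (ν : Measure (E n)) : Prop :=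
  ∀ f : E n → ℝ, Continuous f → HasCompactSupport f →
    Tendsto (fun i => ∫ y, f y ∂(μs i)) atTop (nhds (∫ y, f y ∂ν))

/-- `ν` is a tangent measure of `μ` at `x`: `ν ≠ 0` and for some `rᵢ ↓ 0`, `cᵢ > 0`,
`cᵢ (T_{x,rᵢ})₊μ → ν` weakly. -/
def IsTangentMeasure {n : ℕ} (μ ν : Measure (E n)) (x : E n) : Prop :=
  ν ≠ 0 ∧ ∃ r c : ℕ → ℝ, (∀ i, 0 < r i) ∧ Tendsto r atTop (nhds 0) ∧ (∀ i, 0 < c i) ∧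
    VagueTendsto (fun i => ENNReal.ofReal (c i) • Measure.map (fun y => (r i)⁻¹ • (y - x)) μ) ν

/-- `μ` is `m`-asymptotically optimally doubling. -/
def AOD {n : ℕ} (m : ℕ) (μ : Measure (E n)) : Prop :=
  ∀ K : Set (E n), K ⊆ msupp μ → IsCompact K → ∀ δ : ℝ, 0 < δ →
    ∃ r₀ : ℝ, 0 < r₀ ∧ ∀ x ∈ K, ∀ r : ℝ, 0 < r → r ≤ r₀ →
      ∀ τ : ℝ, τ ∈ Set.Icc (1/2 : ℝ) 1 →
        |(μ (closedBall x (τ * r))).toReal / (μ (closedBall x r)).toReal - τ ^ m| < δ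

/-- `ν` is `m`-flat: `m`-dimensional Hausdorff measure restricted to an affine `m`-plane. -/
def IsFlatMeasure {n : ℕ} (m : ℕ) (ν : Measure (E n)) : Prop :=
  ∃ L : AffineSubspace ℝ (E n), (L : Set (E n)).Nonempty ∧
    Module.finrank ℝ L.direction = m ∧
    ν = (Measure.hausdorffMeasure (m : ℝ)).restrict (L : Set (E n))

/-- Volume of the unit ball in `ℝᵐ`. -/
def unitBallVol (m : ℕ) : ℝ := (volume (Metric.ball (0 : EuclideanSpace ℝ (Fin m)) 1)).toReal

/-- `ω₃`, the volume of the unit `3`-ball. -/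
def omega3 : ℝ := unitBallVol 3

/-- The second moment `Q_{0,r}` of a measure on `ℝ⁴`. -/
def Qmom (μ : Measure (E 4)) (r : ℝ) (z : E 4) : ℝ :=
  (5 / (omega3 * r ^ 5)) * ∫ w in closedBall (0 : E 4) r, ⟪z, w⟫ ^ 2 ∂μ

/-- Entries `q_{ij}` of the second moment matrix in given directions. -/
def qmom (μ : Measure (E 4)) (r : ℝ) (u v : E 4) : ℝ :=
  (5 / (omega3 * r ^ 5)) * ∫ w in closedBall (0 : E 4) r, ⟪u, w⟫ * ⟪v, w⟫ ∂μ

/-- `μ` is `(α,m)`-Hölder asymptotically uniform. -/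
def HolderAsympUniform {n : ℕ} (α : ℝ) (m : ℕ) (μ : Measure (E n)) : Prop :=
  ∀ K : Set (E n), K ⊆ msupp μ → IsCompact K →
    ∃ C r₀ : ℝ, 0 < r₀ ∧ ∀ x ∈ K, ∀ r : ℝ, 0 < r → r ≤ r₀ →
      |(μ (closedBall x r)).toReal / (unitBallVol m * r ^ m) - 1| ≤ C * r ^ α

/-- `φ` is a `C^{1,β}` diffeomorphism from `U` onto `U'`: a continuously differentiable bijection
with `β`-Hölder derivative whose inverse is also `C^{1,β}`. -/
def IsC1HolderDiffeoOn (β : ℝ) (U U' : Set (E 4)) (φ : E 4 → E 4) : Prop :=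
  Set.BijOn φ U U' ∧
  (∀ x ∈ U, HasFDerivAt φ (fderiv ℝ φ x) x) ∧
  (∃ M : ℝ, ∀ x ∈ U, ∀ y ∈ U, ‖fderiv ℝ φ x - fderiv ℝ φ y‖ ≤ M * ‖x - y‖ ^ β) ∧
  ∃ ψ : E 4 → E 4, Set.BijOn ψ U' U ∧
    (∀ x ∈ U, ψ (φ x) = x) ∧ (∀ y ∈ U', φ (ψ y) = y) ∧
    (∀ y ∈ U', HasFDerivAt ψ (fderiv ℝ ψ y) y) ∧
    (∃ M : ℝ, ∀ x ∈ U', ∀ y ∈ U', ‖fderiv ℝ ψ x - fderiv ℝ ψ y‖ ≤ M * ‖x - y‖ ^ β)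

lemma msupp_eq {n : ℕ} (μ : Measure (E n)) : msupp μ = μ.support := by
  ext x
  rw [(nhds_basis_closedBall (x := x)).mem_measureSupport]; rfl

lemma msupp_closed {n : ℕ} (μ : Measure (E n)) : IsClosed (msupp μ) := by
  rw [msupp_eq]; exact Measure.isClosed_support

lemma ae_msupp {n : ℕ} (μ : Measure (E n)) : ∀ᵐ x ∂μ, x ∈ msupp μ := by
  rw [msupp_eq]; exact Measure.support_mem_ae

lemma msupp_null {n : ℕ} (μ : Measure (E n)) : μ (msupp μ)ᶜ = 0 := ae_msupp μ

lemma msupp_hit {n : ℕ} {μ : Measure (E n)} {s : Set (E n)} (h : 0 < μ s) :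
    (s ∩ msupp μ).Nonempty := by
  rw [msupp_eq]; exact Measure.nonempty_inter_support_of_pos h

lemma msupp_pos {n : ℕ} {μ : Measure (E n)} {x : E n} (hx : x ∈ msupp μ) {s : Set (E n)}
    (hs : s ∈ 𝓝 x) : 0 < μ s := by
  rw [msupp_eq] at hx; exact (Measure.mem_support_iff_forall x).1 hx s hs

lemma msupp_sub {n : ℕ} {μ : Measure (E n)} {t : Set (E n)} (ht : IsClosed t) (h : μ tᶜ = 0) :
    msupp μ ⊆ t := by
  rw [msupp_eq]; exact Measure.support_subset_of_isClosed ht h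

lemma omega3_pos : 0 < omega3 := by
  unfold omega3 unitBallVol
  exact ENNReal.toReal_pos (measure_ball_pos _ _ one_pos).ne' measure_ball_lt_top.ne

lemma vol_ball3 (x : E 3) (r : ℝ) (hr : 0 ≤ r) :
    volume (closedBall x r) = ENNReal.ofReal (omega3 * r ^ 3) := by
  rw [Measure.addHaar_closedBall _ _ hr, mul_comm, ENNReal.ofReal_mul omega3_pos.le]
  congr 1
  · unfold omega3 unitBallVol
    rw [ENNReal.ofReal_toReal measure_ball_lt_top.ne]
  · simp

/-- uniform measures -/
structure UM (ν : Measure (E 4)) : Prop where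
  lf : IsLocallyFiniteMeasure ν
  z : (0 : E 4) ∈ msupp ν
  u : ∀ x ∈ msupp ν, ∀ r : ℝ, 0 < r → ν (closedBall x r) = ENNReal.ofReal (omega3 * r ^ 3)

/-- asymptotically uniform families -/
structure AU {ι : Type} (l : Filter ι) (m : ι → Measure (E 4)) : Prop where
  lf : ∀ i, IsLocallyFiniteMeasure (m i)
  z : ∀ᶠ i in l, (0 : E 4) ∈ msupp (m i)
  u : ∀ R r ε : ℝ, 0 < r → 0 < ε → ∀ᶠ i in l, ∀ x ∈ msupp (m i), ‖x‖ ≤ R →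
    |(m i).real (closedBall x r) - omega3 * r ^ 3| ≤ ε

def Conv {ι : Type} (l : Filter ι) (m : ι → Measure (E 4)) (ν : Measure (E 4)) : Prop :=
  ∀ f : E 4 → ℝ, Continuous f → HasCompactSupport f →
    Tendsto (fun i => ∫ y, f y ∂(m i)) l (𝓝 (∫ y, f y ∂ν))

lemma UM.real {ν : Measure (E 4)} (h : UM ν) {x : E 4} (hx : x ∈ msupp ν) {r : ℝ} (hr : 0 < r) :
    ν.real (closedBall x r) = omega3 * r ^ 3 := by
  rw [Measure.real, h.u x hx r hr, ENNReal.toReal_ofReal]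
  have := omega3_pos; positivity

/-- bump function -/
def bmp (c : E 4) (a b : ℝ) (z : E 4) : ℝ := max 0 (min 1 ((b - dist z c) / (b - a)))

lemma bmp_cont (c : E 4) (a b : ℝ) : Continuous (bmp c a b) := by
  unfold bmp; fun_prop

lemma bmp_nonneg (c : E 4) (a b : ℝ) (z : E 4) : 0 ≤ bmp c a b z := le_max_left _ _
lemma bmp_le_one (c : E 4) (a b : ℝ) (z : E 4) : bmp c a b z ≤ 1 :=
  max_le zero_le_one (min_le_left _ _)

lemma bmp_one {c : E 4} {a b : ℝ} (hab : a < b) {z : E 4} (hz : z ∈ closedBall c a) :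
    bmp c a b z = 1 := by
  unfold bmp
  rw [mem_closedBall] at hz
  have : 1 ≤ (b - dist z c) / (b - a) := by
    rw [le_div_iff₀ (by linarith)]; linarith
  rw [min_eq_left this]; simp

lemma bmp_zero {c : E 4} {a b : ℝ} (hab : a < b) {z : E 4} (hz : z ∉ ball c b) :
    bmp c a b z = 0 := by
  unfold bmp
  rw [mem_ball, not_lt] at hz
  have : (b - dist z c) / (b - a) ≤ 0 :=
    div_nonpos_of_nonpos_of_nonneg (by linarith) (by linarith)
  exact max_eq_left ((min_le_right _ _).trans this)

lemma bmp_cs {c : E 4} {a b : ℝ} (hab : a < b) : HasCompactSupport (bmp c a b) := by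
  apply HasCompactSupport.intro (isCompact_closedBall c b)
  intro x hx
  exact bmp_zero hab (fun h => hx (ball_subset_closedBall h))

lemma bmp_lower (m : Measure (E 4)) [IsLocallyFiniteMeasure m] {c : E 4} {a b : ℝ} (hab : a < b) :
    m.real (closedBall c a) ≤ ∫ z, bmp c a b z ∂m := by
  rw [← integral_indicator_one measurableSet_closedBall]
  apply integral_mono
  · exact (integrable_indicator_iff measurableSet_closedBall).2
      (integrableOn_const measure_closedBall_lt_top.ne)
  · exact (bmp_cont c a b).integrable_of_hasCompactSupport (bmp_cs hab)
  · intro z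
    by_cases hz : z ∈ closedBall c a
    · simp [hz, bmp_one hab hz]
    · simp only [hz, not_false_eq_true, indicator_of_notMem]; exact bmp_nonneg _ _ _ _

lemma bmp_upper (m : Measure (E 4)) [IsLocallyFiniteMeasure m] {c : E 4} {a b : ℝ} (hab : a < b) :
    ∫ z, bmp c a b z ∂m ≤ m.real (closedBall c b) := by
  rw [← integral_indicator_one measurableSet_closedBall]
  apply integral_mono
  · exact (bmp_cont c a b).integrable_of_hasCompactSupport (bmp_cs hab)
  · exact (integrable_indicator_iff measurableSet_closedBall).2
      (integrableOn_const measure_closedBall_lt_top.ne)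
  · intro z
    by_cases hz : z ∈ closedBall c b
    · simp [hz, bmp_le_one]
    · simp only [hz, not_false_eq_true, indicator_of_notMem]
      exact (bmp_zero hab (fun h => hz (ball_subset_closedBall h))).le

lemma sup1 {ι : Type} {l : Filter ι} {m : ι → Measure (E 4)} {ν : Measure (E 4)}
    [IsLocallyFiniteMeasure ν]
    (hA : AU l m) (hC : Conv l m ν) {x : E 4} (hx : x ∈ msupp ν) {ε : ℝ} (hε : 0 < ε) :
    ∀ᶠ i in l, ∃ y ∈ msupp (m i), dist y x < ε := by
  have hab : ε / 3 < ε / 2 := by linarith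
  have hp : 0 < ∫ z, bmp x (ε / 3) (ε / 2) z ∂ν := by
    refine lt_of_lt_of_le ?_ (bmp_lower ν hab)
    exact ENNReal.toReal_pos (hx _ (by positivity)).ne' measure_closedBall_lt_top.ne
  filter_upwards [(hC _ (bmp_cont x (ε / 3) (ε / 2)) (bmp_cs hab)).eventually (lt_mem_nhds hp)]
    with i hi
  have := hA.lf i
  have h2 := hi.trans_le (bmp_upper (m i) hab)
  have h3 : 0 < m i (closedBall x (ε / 2)) := by
    by_contra h
    have : m i (closedBall x (ε / 2)) = 0 := by simpa using h
    simp [Measure.real, this] at h2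
  obtain ⟨y, hy1, hy2⟩ := msupp_hit h3
  exact ⟨y, hy2, by rw [mem_closedBall] at hy1; linarith⟩

lemma sup2 {ι : Type} {l : Filter ι} [l.NeBot] {m : ι → Measure (E 4)} {ν : Measure (E 4)}
    [IsLocallyFiniteMeasure ν]
    (hA : AU l m) (hC : Conv l m ν) {x : E 4} {y : ι → E 4} (hy : ∀ᶠ i in l, y i ∈ msupp (m i))
    (hyx : Tendsto y l (𝓝 x)) : x ∈ msupp ν := by
  intro r hr
  have hab : r / 2 < r := by linarith
  have hw := omega3_pos
  have hp : omega3 * (r / 4) ^ 3 / 2 ≤ ∫ z, bmp x (r / 2) r z ∂ν := by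
    refine ge_of_tendsto (hC _ (bmp_cont x (r / 2) r) (bmp_cs hab)) ?_
    filter_upwards [hy, hyx.eventually (ball_mem_nhds x (show 0 < r / 4 by positivity)),
      hyx.eventually (ball_mem_nhds x (show (0:ℝ) < 1 by positivity)),
      hA.u (‖x‖ + 1) (r / 4) (omega3 * (r / 4) ^ 3 / 2) (by positivity) (by positivity)]
      with i h1 h2 h3 h4
    have := hA.lf i
    have h5 := h4 (y i) h1 (by
      have := norm_le_norm_add_norm_sub' (y i) x
      rw [dist_eq_norm] at h3; linarith)
    have h6 := (abs_le.1 h5).1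
    refine le_trans ?_ (bmp_lower (m i) hab)
    refine le_trans ?_ (measureReal_mono (closedBall_subset_closedBall' (x := y i) (ε₁ := r / 4)
      (by linarith)) measure_closedBall_lt_top.ne)
    linarith
  have h2 := hp.trans (bmp_upper ν hab)
  have h3 : 0 < omega3 * (r / 4) ^ 3 / 2 := by positivity
  by_contra h
  have : ν (closedBall x r) = 0 := by simpa using h
  simp [Measure.real, this] at h2
  linarith

lemma ultra_lim {ι : Type} (l : Ultrafilter ι) (f : ι → ℝ) (M : ℝ) (h : ∀ᶠ i in l, |f i| ≤ M) :
    ∃ a, Tendsto f l (𝓝 a) := by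
  have := (isCompact_Icc (a := -M) (b := M)).ultrafilter_le_nhds' (l.map f)
    (by
      rw [Ultrafilter.mem_map]
      filter_upwards [h] with i hi
      exact abs_le.1 hi)
  obtain ⟨a, -, ha⟩ := this
  exact ⟨a, ha⟩

lemma AU.mass {ι : Type} {l : Filter ι} {m : ι → Measure (E 4)} (hA : AU l m) {R : ℝ}
    (hR : 0 < R) : ∀ᶠ i in l, (m i).real (closedBall 0 R) ≤ omega3 * R ^ 3 + 1 := by
  filter_upwards [hA.z, hA.u 0 R 1 hR one_pos] with i h1 h2
  have := (abs_le.1 (h2 0 h1 (by simp))).2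
  linarith

lemma cs_bound {f : E 4 → ℝ} (hf : Continuous f) (hc : HasCompactSupport f) :
    ∃ R M : ℝ, 0 < R ∧ 0 ≤ M ∧ ∀ m : Measure (E 4), IsLocallyFiniteMeasure m →
      |∫ y, f y ∂m| ≤ M * m.real (closedBall 0 R) := by
  obtain ⟨M, hM⟩ := hc.exists_bound_of_continuous hf
  obtain ⟨R, hR0, hR⟩ := hc.isBounded.subset_closedBall_lt 0 0
  refine ⟨R, M, hR0, (norm_nonneg _).trans (hM 0), fun m hm => ?_⟩
  have h1 : ∫ y, f y ∂m = ∫ y in closedBall 0 R, f y ∂m := by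
    rw [setIntegral_eq_integral_of_forall_compl_eq_zero]
    intro x hx
    exact image_eq_zero_of_notMem_tsupport (fun h => hx (hR h))
  rw [h1, ← Real.norm_eq_abs]
  exact norm_setIntegral_le_of_norm_le_const measure_closedBall_lt_top (fun x _ => hM x)

theorem lim_exists {ι : Type} (l : Ultrafilter ι) {m : ι → Measure (E 4)} (hA : AU l m) :
    ∃ ν, UM ν ∧ Conv l m ν := by
  have hlf := hA.lf
  have hex : ∀ f : CompactlySupportedContinuousMap (E 4) ℝ,
      ∃ a, Tendsto (fun i => ∫ y, f y ∂(m i)) l (𝓝 a) := by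
    intro f
    obtain ⟨R, M, hR, hM0, hM⟩ := cs_bound f.continuous f.hasCompactSupport
    apply ultra_lim l _ (M * (omega3 * R ^ 3 + 1))
    filter_upwards [hA.mass hR] with i hi
    exact (hM _ (hlf i)).trans (mul_le_mul_of_nonneg_left hi hM0)
  choose L hL using hex
  have hint : ∀ (f : CompactlySupportedContinuousMap (E 4) ℝ) i, Integrable f (m i) :=
    fun f i => f.continuous.integrable_of_hasCompactSupport f.hasCompactSupport
  let Λ0 : CompactlySupportedContinuousMap (E 4) ℝ →ₗ[ℝ] ℝ :=
    { toFun := L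
      map_add' := fun f g => tendsto_nhds_unique (hL (f + g)) (by
        refine ((hL f).add (hL g)).congr fun i => ?_
        rw [← integral_add (hint f i) (hint g i)]; rfl)
      map_smul' := fun c f => tendsto_nhds_unique (hL (c • f)) (by
        refine ((hL f).const_mul c).congr fun i => ?_
        rw [← integral_const_mul]; rfl) }
  let Λ : CompactlySupportedContinuousMap (E 4) ℝ →ₚ[ℝ] ℝ := PositiveLinearMap.mk₀ Λ0 (by
    intro f hf
    refine ge_of_tendsto' (hL f) fun i => integral_nonneg fun x => hf x)
  have hν := RealRMK.integral_rieszMeasure Λ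
  set ν := RealRMK.rieszMeasure Λ with hνdef
  have : IsLocallyFiniteMeasure ν := inferInstance
  have hC : Conv l m ν := by
    intro f hf hc
    have := hν ⟨⟨f, hf⟩, hc⟩
    have h2 := hL ⟨⟨f, hf⟩, hc⟩
    have h3 : (∫ y, f y ∂ν) = L ⟨⟨f, hf⟩, hc⟩ := this
    rw [h3]
    exact h2
  refine ⟨ν, ⟨inferInstance, sup2 hA hC hA.z tendsto_const_nhds, ?_⟩, hC⟩
  intro x hx r hr
  have hw := omega3_pos
  have key : ν.real (closedBall x r) = omega3 * r ^ 3 := by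
    apply le_antisymm
    · -- upper
      have : ∀ ε : ℝ, 0 < ε → ν.real (closedBall x r) ≤ omega3 * (r + 2 * ε) ^ 3 + ε := by
        intro ε hε
        have hab : r < r + ε := by linarith
        refine (bmp_lower ν hab).trans ?_
        refine le_of_tendsto (hC _ (bmp_cont x r (r + ε)) (bmp_cs hab)) ?_
        filter_upwards [sup1 hA hC hx (show 0 < min ε 1 by positivity),
          hA.u (‖x‖ + 1) (r + 2 * ε) ε (by positivity) hε] with i h1 h2
        obtain ⟨y, hy, hyx⟩ := h1
        have h3 := (abs_le.1 (h2 y hy (by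
          have := norm_le_norm_add_norm_sub' y x
          have h4 := min_le_right ε 1
          rw [dist_eq_norm] at hyx; linarith))).2
        refine (bmp_upper (m i) hab).trans ?_
        refine (measureReal_mono (closedBall_subset_closedBall' (y := y) (ε₂ := r + 2 * ε) ?_)
          measure_closedBall_lt_top.ne).trans ?_
        · have h4 := min_le_left ε 1
          rw [dist_comm] at hyx; linarith
        · linarith
      have ht : Tendsto (fun ε : ℝ => omega3 * (r + 2 * ε) ^ 3 + ε) (𝓝[>] 0)
          (𝓝 (omega3 * (r + 2 * 0) ^ 3 + 0)) := by
        apply Tendsto.mono_left _ nhdsWithin_le_nhds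
        exact Continuous.tendsto (by fun_prop) 0
      simp only [mul_zero, add_zero] at ht
      exact ge_of_tendsto ht (by filter_upwards [self_mem_nhdsWithin] with ε hε using this ε hε)
    · have : ∀ ε : ℝ, 0 < ε → ε < r / 3 → omega3 * (r - 2 * ε) ^ 3 - ε ≤ ν.real (closedBall x r) := by
        intro ε hε hεr
        have hab : r - ε < r := by linarith
        refine le_trans ?_ (bmp_upper ν hab)
        refine ge_of_tendsto (hC _ (bmp_cont x (r - ε) r) (bmp_cs hab)) ?_
        filter_upwards [sup1 hA hC hx (show 0 < min ε 1 by positivity),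
          hA.u (‖x‖ + 1) (r - 2 * ε) ε (by linarith) hε] with i h1 h2
        obtain ⟨y, hy, hyx⟩ := h1
        have h3 := (abs_le.1 (h2 y hy (by
          have := norm_le_norm_add_norm_sub' y x
          have h4 := min_le_right ε 1
          rw [dist_eq_norm] at hyx; linarith))).1
        refine le_trans ?_ (bmp_lower (m i) hab)
        refine le_trans ?_ (measureReal_mono (closedBall_subset_closedBall' (x := y)
          (ε₁ := r - 2 * ε) ?_) measure_closedBall_lt_top.ne)
        · linarith
        · have h4 := min_le_left ε 1
          linarith
      have ht : Tendsto (fun ε : ℝ => omega3 * (r - 2 * ε) ^ 3 - ε) (𝓝[>] 0)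
          (𝓝 (omega3 * (r - 2 * 0) ^ 3 - 0)) := by
        apply Tendsto.mono_left _ nhdsWithin_le_nhds
        exact Continuous.tendsto (by fun_prop) 0
      simp only [mul_zero, sub_zero] at ht
      refine le_of_tendsto ht ?_
      filter_upwards [self_mem_nhdsWithin, nhdsWithin_le_nhds (gt_mem_nhds (show 0 < r / 3 by positivity))]
        with ε hε h2 using this ε hε h2
  rw [← key, ofReal_measureReal measure_closedBall_lt_top.ne]

lemma shell_bound (m : Measure (E 4)) [IsLocallyFiniteMeasure m] {g : E 4 → ℝ} (hg : Continuous g)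
    {G a b s t : ℝ} (hab : a < b) (hbs : b ≤ s) (hst : s ≤ t)
    (hG : ∀ z ∈ closedBall (0 : E 4) t, |g z| ≤ G) :
    |∫ z in closedBall 0 s, g z ∂m - ∫ z, g z * bmp 0 a b z ∂m| ≤
      G * (m.real (closedBall 0 t) - m.real (closedBall 0 a)) := by
  have hi1 : Integrable ((closedBall (0 : E 4) s).indicator g) m :=
    (integrable_indicator_iff measurableSet_closedBall).2
      (hg.continuousOn.integrableOn_compact (isCompact_closedBall _ _))
  have hi2 : Integrable (fun z => g z * bmp 0 a b z) m :=
    (hg.mul (bmp_cont _ _ _)).integrable_of_hasCompactSupport ((bmp_cs hab).mul_left)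
  rw [← integral_indicator measurableSet_closedBall, ← integral_sub hi1 hi2]
  have hsub : closedBall (0 : E 4) a ⊆ closedBall 0 t := closedBall_subset_closedBall (by linarith)
  have hmeas : MeasurableSet (closedBall (0 : E 4) t \ closedBall 0 a) :=
    measurableSet_closedBall.diff measurableSet_closedBall
  have hfin : m (closedBall (0 : E 4) t \ closedBall 0 a) ≠ ⊤ :=
    ((measure_mono diff_subset).trans_lt measure_closedBall_lt_top).ne
  have h1 : m.real (closedBall 0 t) - m.real (closedBall 0 a)
      = m.real (closedBall (0 : E 4) t \ closedBall 0 a) := by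
    rw [measureReal_diff hsub measurableSet_closedBall measure_closedBall_lt_top.ne]
  rw [h1, ← Real.norm_eq_abs]
  have h2 : ∀ z, (closedBall (0 : E 4) s).indicator g z - g z * bmp 0 a b z =
      (closedBall (0 : E 4) t \ closedBall 0 a).indicator
        (fun z => (closedBall (0 : E 4) s).indicator g z - g z * bmp 0 a b z) z := by
    intro z
    by_cases hz : z ∈ closedBall (0 : E 4) t \ closedBall 0 a
    · rw [indicator_of_mem hz]
    · rw [indicator_of_notMem hz]
      by_cases hza : z ∈ closedBall (0 : E 4) a
      · rw [bmp_one hab hza, indicator_of_mem (closedBall_subset_closedBall (by linarith) hza)]; ring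
      · have hzt : z ∉ closedBall (0 : E 4) t := fun h => hz ⟨h, hza⟩
        rw [bmp_zero hab (fun h => hzt (closedBall_subset_closedBall (by linarith)
          (ball_subset_closedBall h))), indicator_of_notMem
          (fun h => hzt (closedBall_subset_closedBall hst h))]; ring
  rw [integral_congr_ae (Eventually.of_forall h2), integral_indicator hmeas]
  refine norm_setIntegral_le_of_norm_le_const hfin.lt_top fun z hz => ?_
  have h3 := hG z hz.1
  rw [Real.norm_eq_abs]
  have h4 := bmp_nonneg 0 a b z
  have h5 := bmp_le_one 0 a b z
  have h6 : |g z * bmp 0 a b z| ≤ G := by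
    rw [abs_mul, abs_of_nonneg h4]; nlinarith [abs_nonneg (g z)]
  by_cases hzs : z ∈ closedBall (0 : E 4) s
  · rw [indicator_of_mem hzs]
    have : g z - g z * bmp 0 a b z = g z * (1 - bmp 0 a b z) := by ring
    rw [this, abs_mul, abs_of_nonneg (by linarith : 0 ≤ 1 - bmp 0 a b z)]
    nlinarith [abs_nonneg (g z)]
  · rw [indicator_of_notMem hzs, zero_sub, abs_neg]; exact h6

theorem ball_moment {ι : Type} {l : Filter ι} {m : ι → Measure (E 4)} {ν : Measure (E 4)}
    (hA : AU l m) (hC : Conv l m ν) (hν : UM ν) {g : E 4 → ℝ} (hg : Continuous g)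
    {c : ι → ℝ} {c0 : ℝ} (hc0 : 0 < c0) (hc : Tendsto c l (𝓝 c0)) :
    Tendsto (fun i => ∫ z in closedBall 0 (c i), g z ∂(m i)) l
      (𝓝 (∫ z in closedBall 0 c0, g z ∂ν)) := by
  have := hν.lf
  obtain ⟨G0, hG0⟩ := (isCompact_closedBall (0 : E 4) (2 * c0)).exists_bound_of_continuousOn
    hg.continuousOn
  obtain ⟨G, hG1, hG⟩ : ∃ G : ℝ, 1 ≤ G ∧ ∀ z ∈ closedBall (0 : E 4) (2 * c0), |g z| ≤ G :=
    ⟨max 1 G0, le_max_left _ _, fun z hz => (hG0 z hz).trans (le_max_right _ _)⟩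
  rw [Metric.tendsto_nhds]
  intro ε hε
  have ht : Tendsto (fun η : ℝ => G * (omega3 * (c0 + η) ^ 3 - omega3 * (c0 - 2 * η) ^ 3)) (𝓝[>] 0)
      (𝓝 (G * (omega3 * (c0 + 0) ^ 3 - omega3 * (c0 - 2 * 0) ^ 3))) := by
    apply Tendsto.mono_left _ nhdsWithin_le_nhds
    exact Continuous.tendsto (by fun_prop) 0
  simp only [mul_zero, sub_zero, add_zero, sub_self] at ht
  have hh1 : ∀ᶠ η : ℝ in 𝓝[>] 0, η < c0 / 3 :=
    nhdsWithin_le_nhds (gt_mem_nhds (show 0 < c0 / 3 by positivity))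
  have hh2 : ∀ᶠ η : ℝ in 𝓝[>] 0, 0 < η := self_mem_nhdsWithin
  obtain ⟨η, h1, h2, h3⟩ := ((ht.eventually (gt_mem_nhds (show 0 < ε / 5 by positivity))).and
    (hh1.and hh2)).exists
  have h3 : 0 < η := h3
  have h2 : η < c0 / 3 := h2
  have hab : c0 - 2 * η < c0 - η := by linarith
  have hGt : ∀ z ∈ closedBall (0 : E 4) (c0 + η), |g z| ≤ G :=
    fun z hz => hG z (closedBall_subset_closedBall (by linarith) hz)
  have hX := shell_bound ν hg hab (show c0 - η ≤ c0 by linarith) (show c0 ≤ c0 + η by linarith) hGt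
  rw [hν.real hν.z (by linarith), hν.real hν.z (by linarith)] at hX
  have hY := hC (fun z => g z * bmp 0 (c0 - 2 * η) (c0 - η) z) (hg.mul (bmp_cont _ _ _))
    ((bmp_cs hab).mul_left)
  have hε' : 0 < ε / (10 * G) := by positivity
  filter_upwards [hA.z, hA.u 0 (c0 + η) _ (by linarith) hε',
    hA.u 0 (c0 - 2 * η) _ (by linarith) hε', Metric.tendsto_nhds.1 hY (ε / 5) (by positivity),
    Metric.tendsto_nhds.1 hc η h3] with i k1 k2 k3 k4 k5
  have := hA.lf i
  rw [Real.dist_eq] at k4 k5 ⊢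
  have hXi := shell_bound (m i) hg hab (show c0 - η ≤ c i by linarith [(abs_lt.1 k5).1])
    (show c i ≤ c0 + η by linarith [(abs_lt.1 k5).2]) hGt
  have e1 := (abs_le.1 (k2 0 k1 (by simp))).2
  have e2 := (abs_le.1 (k3 0 k1 (by simp))).1
  have e3 : G * ((m i).real (closedBall 0 (c0 + η)) - (m i).real (closedBall 0 (c0 - 2 * η))) ≤
      G * (omega3 * (c0 + η) ^ 3 - omega3 * (c0 - 2 * η) ^ 3) + ε / 5 := by
    have : G * (2 * (ε / (10 * G))) = ε / 5 := by field_simp; norm_num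
    rw [← this, ← mul_add]
    apply mul_le_mul_of_nonneg_left _ (by linarith)
    linarith
  rw [abs_le] at hX hXi
  rw [abs_lt] at k4 ⊢
  constructor <;> linarith [hX.1, hX.2, hXi.1, hXi.2, k4.1, k4.2]

def sc (ν : Measure (E 4)) (x : E 4) (r : ℝ) : Measure (E 4) :=
  ENNReal.ofReal (r⁻¹ ^ 3) • Measure.map (fun y => r⁻¹ • (y - x)) ν

lemma sc_meas (x : E 4) (r : ℝ) : Measurable (fun y : E 4 => r⁻¹ • (y - x)) := by fun_prop

lemma sc_apply (ν : Measure (E 4)) (x : E 4) {r : ℝ} (hr : 0 < r) (y : E 4) (s : ℝ) :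
    sc ν x r (closedBall y s) = ENNReal.ofReal (r⁻¹ ^ 3) * ν (closedBall (x + r • y) (r * s)) := by
  rw [sc, Measure.smul_apply, Measure.map_apply (sc_meas x r) measurableSet_closedBall, smul_eq_mul]
  congr 2
  ext z
  simp only [mem_preimage, mem_closedBall, dist_eq_norm]
  have : r⁻¹ • (z - x) - y = r⁻¹ • (z - (x + r • y)) := by
    rw [← sub_sub, smul_sub _ (z - x), smul_smul, inv_mul_cancel₀ hr.ne', one_smul]
  rw [this, norm_smul, Real.norm_eq_abs, abs_of_pos (inv_pos.2 hr), inv_mul_le_iff₀ hr]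

lemma sc_supp (ν : Measure (E 4)) (x : E 4) {r : ℝ} (hr : 0 < r) (y : E 4) :
    y ∈ msupp (sc ν x r) ↔ x + r • y ∈ msupp ν := by
  have hc : ENNReal.ofReal (r⁻¹ ^ 3) ≠ 0 := by
    have : 0 < r⁻¹ ^ 3 := by positivity
    simpa using this
  constructor
  · intro h s hs
    have := h (r⁻¹ * s) (by positivity)
    rw [sc_apply ν x hr, mul_inv_cancel_left₀ hr.ne'] at this
    exact pos_of_ne_zero fun h0 => by simp [h0] at this
  · intro h s hs
    rw [sc_apply ν x hr]
    exact pos_of_ne_zero (mul_ne_zero hc (h _ (by positivity)).ne')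

lemma sc_lf (ν : Measure (E 4)) [IsLocallyFiniteMeasure ν] (x : E 4) {r : ℝ} (hr : 0 < r) :
    IsLocallyFiniteMeasure (sc ν x r) := by
  constructor
  intro y
  refine ⟨closedBall y 1, closedBall_mem_nhds _ one_pos, ?_⟩
  rw [sc_apply ν x hr]
  exact ENNReal.mul_lt_top ENNReal.ofReal_lt_top measure_closedBall_lt_top

lemma sc_um {ν : Measure (E 4)} (h : UM ν) {x : E 4} (hx : x ∈ msupp ν) {r : ℝ} (hr : 0 < r) :
    UM (sc ν x r) := by
  have := h.lf
  refine ⟨sc_lf ν x hr, (sc_supp ν x hr 0).2 (by simpa using hx), ?_⟩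
  intro y hy s hs
  rw [sc_apply ν x hr, h.u _ ((sc_supp ν x hr y).1 hy) _ (by positivity),
    ← ENNReal.ofReal_mul (by positivity)]
  congr 1
  field_simp

lemma um_au {ι : Type} {l : Filter ι} {m : ι → Measure (E 4)} (h : ∀ i, UM (m i)) : AU l m := by
  refine ⟨fun i => (h i).lf, Eventually.of_forall fun i => (h i).z, ?_⟩
  intro R r ε hr hε
  refine Eventually.of_forall fun i x hx _ => ?_
  rw [(h i).real hx hr]; simpa using hε.le

lemma sc_int (ν : Measure (E 4)) (x : E 4) {r : ℝ} (hr : 0 < r) (g : E 4 → ℝ) (hg : Continuous g)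
    (s : ℝ) : ∫ z in closedBall 0 s, g z ∂(sc ν x r) =
      r⁻¹ ^ 3 * ∫ z in closedBall x (r * s), g (r⁻¹ • (z - x)) ∂ν := by
  rw [sc, Measure.restrict_smul, integral_smul_measure,
    ENNReal.toReal_ofReal (by positivity), smul_eq_mul,
    setIntegral_map measurableSet_closedBall hg.aestronglyMeasurable (sc_meas x r).aemeasurable]
  congr 3
  ext z
  simp only [mem_preimage, mem_closedBall, dist_eq_norm, sub_zero]
  rw [norm_smul, Real.norm_eq_abs, abs_of_pos (inv_pos.2 hr), inv_mul_le_iff₀ hr]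

lemma sc_sc (ν : Measure (E 4)) (x : E 4) {r s : ℝ} (hr : 0 < r) (hs : 0 < s) :
    sc (sc ν x r) 0 s = sc ν x (r * s) := by
  rw [sc, sc, sc, Measure.map_smul, smul_smul, Measure.map_map (sc_meas 0 s) (sc_meas x r),
    ← ENNReal.ofReal_mul (by positivity)]
  congr 2
  · field_simp
  · ext1 z
    simp [smul_smul, mul_comm]

lemma qmom_sc (ν : Measure (E 4)) {r c : ℝ} (hr : 0 < r) (hc : 0 < c) (u v : E 4) :
    qmom (sc ν 0 r) c u v = qmom ν (r * c) u v := by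
  have hw := omega3_pos
  rw [qmom, qmom, sc_int ν 0 hr _ (by fun_prop)]
  have : ∀ z : E 4, ⟪u, r⁻¹ • (z - 0)⟫ * ⟪v, r⁻¹ • (z - 0)⟫ = r⁻¹ ^ 2 * (⟪u, z⟫ * ⟪v, z⟫) := by
    intro z; rw [sub_zero, inner_smul_right, inner_smul_right]; ring
  simp only [this]
  rw [integral_const_mul]
  field_simp

/-! radial -/

lemma um_pt {ν : Measure (E 4)} (h : UM ν) {x : E 4} (hx : x ∈ msupp ν) :
    ν (closedBall x 0) = 0 := by
  have hw := omega3_pos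
  refine le_antisymm ?_ zero_le
  have : Tendsto (fun r : ℝ => ENNReal.ofReal (omega3 * r ^ 3)) (𝓝[>] 0) (𝓝 (ENNReal.ofReal (omega3 * 0 ^ 3))) := by
    apply Tendsto.mono_left _ nhdsWithin_le_nhds
    exact Continuous.tendsto (ENNReal.continuous_ofReal.comp (by fun_prop)) 0
  simp only [ne_eq, OfNat.ofNat_ne_zero, not_false_eq_true, zero_pow, mul_zero, ENNReal.ofReal_zero] at this
  refine ge_of_tendsto this ?_
  filter_upwards [self_mem_nhdsWithin] with r hr
  rw [← h.u x hx r hr]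
  exact measure_mono (closedBall_subset_closedBall (le_of_lt hr))

lemma radial {ν : Measure (E 4)} (h : UM ν) {x : E 4} (hx : x ∈ msupp ν) (R : ℝ)
    (f : ℝ → ℝ) (hf : Measurable f) :
    ∫ z in closedBall x R, f (dist z x) ∂ν = ∫ u in closedBall (0 : E 3) R, f ‖u‖ := by
  have := h.lf
  have hm : Measurable (fun z : E 4 => dist z x) := by fun_prop
  have hm3 : Measurable (fun z : E 3 => ‖z‖) := by fun_prop
  have key : Measure.map (fun z : E 4 => dist z x) (ν.restrict (closedBall x R)) =
      Measure.map (fun u : E 3 => ‖u‖) (volume.restrict (closedBall (0 : E 3) R)) := by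
    have f1 : IsFiniteMeasure (ν.restrict (closedBall x R)) :=
      ⟨by rw [Measure.restrict_apply_univ]; exact measure_closedBall_lt_top⟩
    have f2 : IsFiniteMeasure ((volume : Measure (E 3)).restrict (closedBall (0 : E 3) R)) :=
      ⟨by rw [Measure.restrict_apply_univ]; exact measure_closedBall_lt_top⟩
    apply Measure.ext_of_Iic
    intro t
    rw [Measure.map_apply hm measurableSet_Iic, Measure.map_apply hm3 measurableSet_Iic,
      Measure.restrict_apply (hm measurableSet_Iic), Measure.restrict_apply (hm3 measurableSet_Iic)]
    have e1 : (fun z : E 4 => dist z x) ⁻¹' Iic t ∩ closedBall x R = closedBall x (min t R) := by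
      ext z; simp
    have e2 : (fun z : E 3 => ‖z‖) ⁻¹' Iic t ∩ closedBall 0 R = closedBall 0 (min t R) := by
      ext z; simp
    rw [e1, e2]
    rcases lt_trichotomy (min t R) 0 with h1 | h1 | h1
    · rw [closedBall_eq_empty.2 h1, closedBall_eq_empty.2 h1]; simp
    · rw [h1, um_pt h hx, vol_ball3 _ _ le_rfl]; simp
    · rw [h.u x hx _ h1, vol_ball3 _ _ h1.le]
  rw [← integral_map (φ := fun z : E 4 => dist z x) hm.aemeasurable hf.aestronglyMeasurable, key,
    integral_map hm3.aemeasurable hf.aestronglyMeasurable]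

lemma e3_pow (k : ℕ) : ∫ u in closedBall (0 : E 3) 1, ‖u‖ ^ k = 3 * omega3 / (k + 3) := by
  have h1 := integral_fun_norm_addHaar (volume : Measure (E 3)) (fun t : ℝ => (Iic (1:ℝ)).indicator (fun t => t ^ k) t)
  have h2 : ∫ u in closedBall (0 : E 3) 1, ‖u‖ ^ k =
      ∫ u : E 3, (Iic (1:ℝ)).indicator (fun t => t ^ k) ‖u‖ := by
    rw [← integral_indicator measurableSet_closedBall]
    congr 1; ext u
    by_cases hu : ‖u‖ ≤ 1
    · rw [indicator_of_mem (by simpa using hu), indicator_of_mem (by simpa using hu)]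
    · rw [indicator_of_notMem (by simpa using hu), indicator_of_notMem (by simpa using hu)]
  rw [h2, h1]
  have h3 : ∫ y in Ioi (0:ℝ), y ^ (finrank ℝ (E 3) - 1) • (Iic (1:ℝ)).indicator (fun t => t ^ k) y
      = 1 / (k + 3) := by
    have : ∀ y : ℝ, y ^ (finrank ℝ (E 3) - 1) • (Iic (1:ℝ)).indicator (fun t => t ^ k) y =
        (Iic (1:ℝ)).indicator (fun t => t ^ (k + 2)) y := by
      intro y
      by_cases hy : y ∈ Iic (1:ℝ)
      · simp [hy]; ring
      · simp [hy]
    simp only [this]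
    rw [setIntegral_indicator measurableSet_Iic, Ioi_inter_Iic,
      ← intervalIntegral.integral_of_le zero_le_one, integral_pow]
    push_cast; simp; ring
  rw [h3]
  have h4 : (volume : Measure (E 3)).real (ball 0 1) = omega3 := rfl
  rw [h4]; simp; ring

lemma um_pow {ν : Measure (E 4)} (h : UM ν) (k : ℕ) :
    ∫ z in closedBall 0 1, ‖z‖ ^ k ∂ν = 3 * omega3 / (k + 3) := by
  rw [← e3_pow k, ← radial h h.z 1 (fun t => t ^ k) (by fun_prop)]
  simp

lemma intOn {n : ℕ} (ν : Measure (E n)) [IsLocallyFiniteMeasure ν] {F : Type} [NormedAddCommGroup F]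
    {g : E n → F} (hg : Continuous g) (x : E n) (R : ℝ) : IntegrableOn g (closedBall x R) ν :=
  hg.continuousOn.integrableOn_compact (isCompact_closedBall x R)

def bv (ν : Measure (E 4)) : E 4 :=
  (5 / omega3) • ∫ z in closedBall (0 : E 4) 1, (1 - ‖z‖ ^ 2) • z ∂ν

lemma bv_inner (ν : Measure (E 4)) [IsLocallyFiniteMeasure ν] (y : E 4) :
    ⟪bv ν, y⟫ = (5 / omega3) * ∫ z in closedBall (0 : E 4) 1, (1 - ‖z‖ ^ 2) * ⟪z, y⟫ ∂ν := by
  rw [bv, inner_smul_left, real_inner_comm, ← integral_inner (intOn ν (by fun_prop) _ _)]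
  simp [inner_smul_right, real_inner_comm]

lemma pt_bound (p e : ℝ) (h : 0 ≤ p) : |(max 0 (p + e)) ^ 2 - p ^ 2 - (2 * p * e + e ^ 2)| ≤ e ^ 2 ∧
    ((max 0 (p + e)) ^ 2 - p ^ 2 - (2 * p * e + e ^ 2) ≠ 0 → |p| ≤ |e|) := by
  rcases le_total 0 (p + e) with h1 | h1
  · rw [max_eq_right h1]
    have : (p + e) ^ 2 - p ^ 2 - (2 * p * e + e ^ 2) = 0 := by ring
    rw [this]; simp; positivity
  · rw [max_eq_left h1]
    constructor
    · rw [abs_le]; constructor <;> nlinarith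
    · intro _
      rw [abs_of_nonneg h, abs_of_nonpos (by linarith)]; linarith

lemma pt_bound' (p e : ℝ) (h : p < 0) : |(max 0 (p + e)) ^ 2| ≤ e ^ 2 ∧
    ((max 0 (p + e)) ^ 2 ≠ 0 → |p| ≤ |e|) := by
  rcases le_total 0 (p + e) with h1 | h1
  · rw [max_eq_right h1]
    constructor
    · rw [abs_le]; constructor <;> nlinarith
    · intro _
      rw [abs_of_neg h, abs_of_nonneg (by linarith)]; linarith
  · rw [max_eq_left h1]; simp; positivity

lemma bump_int {ν : Measure (E 4)} (h : UM ν) {y : E 4} (hy : y ∈ msupp ν) (hy1 : ‖y‖ ≤ 1) :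
    ∫ z in closedBall 0 2, (max 0 (1 - ‖z - y‖ ^ 2)) ^ 2 ∂ν =
      ∫ u in closedBall (0 : E 3) 1, (max 0 (1 - ‖u‖ ^ 2)) ^ 2 := by
  rw [← radial h hy 1 (fun t => (max 0 (1 - t ^ 2)) ^ 2) (by fun_prop)]
  simp only [dist_eq_norm]
  apply setIntegral_eq_of_subset_of_forall_diff_eq_zero measurableSet_closedBall
  · apply closedBall_subset_closedBall'
    rw [dist_zero_right]; linarith
  · intro z hz
    have : 1 < ‖z - y‖ := by simpa [dist_eq_norm] using hz.2
    rw [max_eq_left (by nlinarith)]; simp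

lemma expansion0 {ν : Measure (E 4)} (h : UM ν) {y : E 4} (hy : y ∈ msupp ν) (hy1 : ‖y‖ ≤ 1 / 10)
    (hy0 : 0 < ‖y‖) :
    |∫ z in closedBall 0 1, (2 * (1 - ‖z‖ ^ 2) * (2 * ⟪z, y⟫ - ‖y‖ ^ 2) +
      (2 * ⟪z, y⟫ - ‖y‖ ^ 2) ^ 2) ∂ν| ≤ 1000 * omega3 * ‖y‖ ^ 3 := by
  have := h.lf
  have hw := omega3_pos
  set t := ‖y‖ with ht
  set G : E 4 → ℝ := fun z => 2 * (1 - ‖z‖ ^ 2) * (2 * ⟪z, y⟫ - t ^ 2) +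
      (2 * ⟪z, y⟫ - t ^ 2) ^ 2 with hG
  have hGc : Continuous G := by fun_prop
  set F : E 4 → E 4 → ℝ := fun y z => (max 0 (1 - ‖z - y‖ ^ 2)) ^ 2 with hF
  have hFc : ∀ y, Continuous (F y) := fun y => by fun_prop
  have e1 : ∫ z in closedBall 0 2, F y z ∂ν = ∫ z in closedBall 0 2, F 0 z ∂ν := by
    rw [bump_int h hy (by linarith), bump_int h h.z (by simp)]
  have e2 : ∫ z in closedBall 0 1, G z ∂ν =
      ∫ z in closedBall 0 2, (closedBall 0 1).indicator G z ∂ν := by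
    rw [setIntegral_indicator measurableSet_closedBall]
    congr 2
    rw [inter_eq_right.2]; exact closedBall_subset_closedBall (by norm_num)
  have i1 : IntegrableOn (fun z => F y z - F 0 z) (closedBall 0 2) ν := intOn ν ((hFc y).sub (hFc 0)) 0 2
  have i2 : IntegrableOn ((closedBall 0 1).indicator G) (closedBall 0 2) ν :=
    (intOn ν hGc 0 2).indicator measurableSet_closedBall
  have e3 : ∫ z in closedBall 0 1, G z ∂ν =
      - ∫ z in closedBall 0 2, ((F y z - F 0 z) - (closedBall 0 1).indicator G z) ∂ν := by
    rw [integral_sub i1 i2, integral_sub (intOn ν (hFc y) 0 2) (intOn ν (hFc 0) 0 2), e1, e2]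
    ring
  set sh : Set (E 4) := closedBall 0 (1 + 5 * t) \ closedBall 0 (1 - 6 * t) with hsh
  have msh : MeasurableSet sh := measurableSet_closedBall.diff measurableSet_closedBall
  have hpt : ∀ z ∈ closedBall (0 : E 4) 2, ‖(F y z - F 0 z) - (closedBall 0 1).indicator G z‖ ≤
      sh.indicator (fun _ => 25 * t ^ 2) z := by
    intro z hz
    rw [mem_closedBall, dist_zero_right] at hz
    set p := 1 - ‖z‖ ^ 2 with hp
    set e := 2 * ⟪z, y⟫ - t ^ 2 with he
    have hpe : 1 - ‖z - y‖ ^ 2 = p + e := by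
      rw [norm_sub_sq_real, hp, he, ht]; ring
    have hee : |e| ≤ 5 * t := by
      have h1 := abs_real_inner_le_norm z y
      have h2 : ‖z‖ * ‖y‖ ≤ 2 * t := by rw [ht]; gcongr
      rw [abs_le] at h1 ⊢
      constructor <;> nlinarith
    have he2 : e ^ 2 ≤ 25 * t ^ 2 := by
      have := sq_le_sq' (by linarith [(abs_le.1 hee).1]) (abs_le.1 hee).2
      linarith
    have hmem : |p| ≤ |e| → z ∈ sh := by
      intro hle
      have h3 := abs_le.1 (hle.trans hee)
      have hn := norm_nonneg z
      refine ⟨?_, ?_⟩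
      · rw [mem_closedBall, dist_zero_right]; nlinarith
      · rw [mem_closedBall, dist_zero_right, not_le]; nlinarith
    have hD : |(F y z - F 0 z) - (closedBall 0 1).indicator G z| ≤ e ^ 2 ∧
        ((F y z - F 0 z) - (closedBall 0 1).indicator G z ≠ 0 → |p| ≤ |e|) := by
      by_cases hz1 : ‖z‖ ≤ 1
      · have hp0 : 0 ≤ p := by rw [hp]; nlinarith [norm_nonneg z]
        rw [indicator_of_mem (by simpa using hz1)]
        simp only [hF, hG, sub_zero, hpe]
        rw [← hp, max_eq_right hp0]
        exact pt_bound p e hp0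
      · have hp0 : p < 0 := by rw [hp]; nlinarith [norm_nonneg z]
        rw [indicator_of_notMem (by simpa using hz1)]
        simp only [hF, sub_zero, hpe]
        rw [← hp, max_eq_left hp0.le]
        simpa using pt_bound' p e hp0
    rw [Real.norm_eq_abs]
    by_cases hD0 : (F y z - F 0 z) - (closedBall 0 1).indicator G z = 0
    · rw [hD0, abs_zero]; exact indicator_nonneg (fun _ _ => by positivity) _
    · rw [indicator_of_mem (hmem (hD.2 hD0))]; exact hD.1.trans he2
  have hsub : sh ⊆ closedBall 0 2 := fun z hz => closedBall_subset_closedBall (by linarith) hz.1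
  have hfin : ν (closedBall (0 : E 4) 2) ≠ ⊤ := measure_closedBall_lt_top.ne
  have b1 : ‖∫ z in closedBall 0 2, ((F y z - F 0 z) - (closedBall 0 1).indicator G z) ∂ν‖ ≤
      ∫ z in closedBall 0 2, sh.indicator (fun _ => 25 * t ^ 2) z ∂ν := by
    apply norm_integral_le_of_norm_le
    · exact (integrableOn_const hfin).indicator msh
    · exact (ae_restrict_iff' measurableSet_closedBall).2 (Eventually.of_forall hpt)
  rw [e3, abs_neg, ← Real.norm_eq_abs]
  refine b1.trans ?_
  rw [setIntegral_indicator msh, inter_eq_right.2 hsub, setIntegral_const, smul_eq_mul,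
    hsh, measureReal_sdiff (closedBall_subset_closedBall (by linarith)) measurableSet_closedBall
      measure_closedBall_lt_top.ne,
    h.real h.z (by linarith), h.real h.z (by linarith)]
  have h40 : (1 + 5 * t) ^ 3 - (1 - 6 * t) ^ 3 ≤ 40 * t := by
    have : 0 ≤ t * (7 + 33 * t - 341 * t ^ 2) := by
      apply mul_nonneg hy0.le; nlinarith
    nlinarith
  calc (omega3 * (1 + 5 * t) ^ 3 - omega3 * (1 - 6 * t) ^ 3) * (25 * t ^ 2)
      = (omega3 * 25 * t ^ 2) * ((1 + 5 * t) ^ 3 - (1 - 6 * t) ^ 3) := by ring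
    _ ≤ (omega3 * 25 * t ^ 2) * (40 * t) := by gcongr
    _ = _ := by ring

lemma expansion {ν : Measure (E 4)} (h : UM ν) {y : E 4} (hy : y ∈ msupp ν) (hy1 : ‖y‖ ≤ 1 / 10) :
    |⟪bv ν, y⟫ + qmom ν 1 y y - ‖y‖ ^ 2| ≤ 2000 * ‖y‖ ^ 3 := by
  have := h.lf
  have hw := omega3_pos
  rcases (norm_nonneg y).eq_or_lt' with h0 | h0
  · rw [norm_eq_zero] at h0; subst h0; simp [qmom]
  have h1 := expansion0 h hy hy1 h0
  set t := ‖y‖ with ht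
  have I : ∀ g : E 4 → ℝ, Continuous g → Integrable g (ν.restrict (closedBall 0 1)) :=
    fun g hg => intOn ν hg 0 1
  have e1 : ∫ z in closedBall 0 1, (2 * (1 - ‖z‖ ^ 2) * (2 * ⟪z, y⟫ - t ^ 2) +
      (2 * ⟪z, y⟫ - t ^ 2) ^ 2) ∂ν = 4 * (∫ z in closedBall 0 1, (1 - ‖z‖ ^ 2) * ⟪z, y⟫ ∂ν)
      - 2 * t ^ 2 * (∫ z in closedBall 0 1, (1 - ‖z‖ ^ 2) ∂ν)
      + 4 * (∫ z in closedBall 0 1, ⟪y, z⟫ * ⟪y, z⟫ ∂ν)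
      + ∫ z in closedBall 0 1, (t ^ 4 - 4 * ⟪z, y⟫ * t ^ 2) ∂ν := by
    rw [← integral_const_mul, ← integral_const_mul, ← integral_const_mul,
      ← integral_sub (I _ (by fun_prop)) (I _ (by fun_prop)),
      ← integral_add (I _ (by fun_prop)) (I _ (by fun_prop)),
      ← integral_add (I _ (by fun_prop)) (I _ (by fun_prop))]
    congr 1; ext z
    rw [real_inner_comm y z]; ring
  have e2 : ∫ z in closedBall (0 : E 4) 1, (1 - ‖z‖ ^ 2) ∂ν = 2 / 5 * omega3 := by
    rw [integral_sub (I _ (by fun_prop)) (I _ (by fun_prop)), um_pow h, setIntegral_const,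
      h.real h.z one_pos]
    simp; ring
  have e3 : |∫ z in closedBall 0 1, (t ^ 4 - 4 * ⟪z, y⟫ * t ^ 2) ∂ν| ≤ 5 * t ^ 3 * omega3 := by
    have := norm_setIntegral_le_of_norm_le_const (μ := ν) (s := closedBall (0 : E 4) 1)
      (f := fun z => (t ^ 4 - 4 * ⟪z, y⟫ * t ^ 2)) (C := 5 * t ^ 3) measure_closedBall_lt_top ?_
    · rw [h.real h.z one_pos] at this; simpa using this
    · intro z hz
      rw [mem_closedBall, dist_zero_right] at hz
      have h1 := abs_real_inner_le_norm z y
      have h2 : ‖z‖ * ‖y‖ ≤ t := by rw [ht]; nlinarith [norm_nonneg y]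
      have h3 := abs_le.1 (h1.trans h2)
      have h4 : t ^ 4 ≤ t ^ 3 := by nlinarith [pow_pos h0 3]
      have h5 : ⟪z, y⟫ * t ^ 2 ≤ t ^ 3 := by nlinarith [pow_pos h0 2]
      have h6 : - t ^ 3 ≤ ⟪z, y⟫ * t ^ 2 := by nlinarith [pow_pos h0 2]
      have h7 : 0 < t ^ 4 := by positivity
      rw [Real.norm_eq_abs, abs_le]; constructor <;> linarith
  rw [bv_inner, qmom]
  rw [e1, e2] at h1
  set a := ∫ z in closedBall 0 1, (1 - ‖z‖ ^ 2) * ⟪z, y⟫ ∂ν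
  set b := ∫ z in closedBall 0 1, ⟪y, z⟫ * ⟪y, z⟫ ∂ν
  set c := ∫ z in closedBall 0 1, (t ^ 4 - 4 * ⟪z, y⟫ * t ^ 2) ∂ν
  have e4 : 5 / omega3 * a + 5 / (omega3 * 1 ^ 5) * b - t ^ 2 =
      (5 / 4 / omega3) * (4 * a - 2 * t ^ 2 * (2 / 5 * omega3) + 4 * b + c - c) := by
    field_simp; ring
  rw [e4, abs_mul, abs_of_pos (by positivity)]
  have e5 := (abs_sub (4 * a - 2 * t ^ 2 * (2 / 5 * omega3) + 4 * b + c) c).trans (add_le_add h1 e3)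
  calc 5 / 4 / omega3 * |4 * a - 2 * t ^ 2 * (2 / 5 * omega3) + 4 * b + c - c|
      ≤ 5 / 4 / omega3 * (1000 * omega3 * t ^ 3 + 5 * t ^ 3 * omega3) := by gcongr
    _ = (5 / 4 * 1005) * t ^ 3 := by field_simp; norm_num
    _ ≤ _ := by gcongr; norm_num

/-! operator -/

def ob : OrthonormalBasis (Fin 4) ℝ (E 4) := EuclideanSpace.basisFun (Fin 4) ℝ

def Aop (ν : Measure (E 4)) (R : ℝ) : E 4 →L[ℝ] E 4 :=
  (∑ i, ∑ j, qmom ν R (ob i) (ob j) • (innerSL ℝ (ob i)).smulRight (ob j)) -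
    ContinuousLinearMap.id ℝ (E 4)

lemma qmom_comm (ν : Measure (E 4)) (R : ℝ) (u v : E 4) : qmom ν R u v = qmom ν R v u := by
  simp only [qmom, mul_comm]

lemma qmom_add (ν : Measure (E 4)) [IsLocallyFiniteMeasure ν] (R : ℝ) (u v w : E 4) :
    qmom ν R (u + v) w = qmom ν R u w + qmom ν R v w := by
  simp only [qmom, inner_add_left, add_mul]
  rw [integral_add (intOn ν (by fun_prop) _ _) (intOn ν (by fun_prop) _ _), mul_add]

lemma qmom_smul (ν : Measure (E 4)) (R c : ℝ) (u w : E 4) :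
    qmom ν R (c • u) w = c * qmom ν R u w := by
  simp only [qmom, inner_smul_left, mul_assoc, integral_const_mul]
  simp; ring

def qlin (ν : Measure (E 4)) [IsLocallyFiniteMeasure ν] (R : ℝ) (w : E 4) : E 4 →ₗ[ℝ] ℝ where
  toFun u := qmom ν R u w
  map_add' u v := qmom_add ν R u v w
  map_smul' c u := qmom_smul ν R c u w

lemma qmom_exp (ν : Measure (E 4)) [IsLocallyFiniteMeasure ν] (R : ℝ) (u w : E 4) :
    qmom ν R u w = ∑ i, ⟪ob i, u⟫ * qmom ν R (ob i) w := by
  have h := congrArg (qlin ν R w) (ob.sum_repr' u)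
  rw [map_sum] at h
  simp only [map_smul, smul_eq_mul] at h
  exact h.symm

lemma Aop_inner (ν : Measure (E 4)) [IsLocallyFiniteMeasure ν] (R : ℝ) (u v : E 4) :
    ⟪Aop ν R u, v⟫ = qmom ν R u v - ⟪u, v⟫ := by
  rw [qmom_exp ν R u v]
  simp only [qmom_comm ν R _ v]
  simp only [qmom_exp ν R v]
  simp only [Aop, ContinuousLinearMap.sub_apply, inner_sub_left, ContinuousLinearMap.sum_apply,
    sum_inner, ContinuousLinearMap.smul_apply, ContinuousLinearMap.smulRight_apply,
    inner_smul_left, innerSL_apply_apply, ContinuousLinearMap.id_apply, Finset.mul_sum]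
  congr 1
  refine Finset.sum_congr rfl fun i _ => Finset.sum_congr rfl fun j _ => ?_
  rw [qmom_comm ν R (ob j)]
  simp; ring

lemma Aop_symm (ν : Measure (E 4)) [IsLocallyFiniteMeasure ν] (R : ℝ) (u v : E 4) :
    ⟪Aop ν R u, v⟫ = ⟪u, Aop ν R v⟫ := by
  rw [← real_inner_comm u (Aop ν R v), Aop_inner, Aop_inner, qmom_comm, real_inner_comm u v]

lemma Aop_sc (ν : Measure (E 4)) {r c : ℝ} (hr : 0 < r) (hc : 0 < c) :
    Aop (sc ν 0 r) c = Aop ν (r * c) := by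
  simp only [Aop, qmom_sc ν hr hc]

lemma Aop_tendsto {ι : Type} {l : Filter ι} {m : ι → Measure (E 4)} {ν : Measure (E 4)}
    (hA : AU l m) (hC : Conv l m ν) (hν : UM ν)
    {c : ι → ℝ} {c0 : ℝ} (hc0 : 0 < c0) (hc : Tendsto c l (𝓝 c0)) :
    Tendsto (fun i => Aop (m i) (c i)) l (𝓝 (Aop ν c0)) := by
  have hw := omega3_pos
  refine Tendsto.sub (tendsto_finset_sum _ fun i _ => tendsto_finset_sum _ fun j _ =>
    Tendsto.smul_const ?_ _) tendsto_const_nhds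
  refine Tendsto.mul ?_ (ball_moment hA hC hν (by fun_prop) hc0 hc)
  exact Tendsto.div tendsto_const_nhds ((hc.pow 5).const_mul _) (by positivity)

lemma qtrace (ν : Measure (E 4)) [IsLocallyFiniteMeasure ν] (b : OrthonormalBasis (Fin 4) ℝ (E 4))
    (R : ℝ) : ∑ i, qmom ν R (b i) (b i) = 5 / (omega3 * R ^ 5) * ∫ z in closedBall 0 R, ‖z‖ ^ 2 ∂ν := by
  simp only [qmom]
  rw [← Finset.mul_sum, ← integral_finset_sum _ (fun i _ => intOn ν (by fun_prop) _ _)]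
  congr 2; ext z
  rw [← b.sum_sq_norm_inner_right z]
  simp [sq]

lemma Aop_tr {ν : Measure (E 4)} (h : UM ν) (b : OrthonormalBasis (Fin 4) ℝ (E 4)) :
    ∑ i, ⟪Aop ν 1 (b i), b i⟫ = -1 := by
  have := h.lf
  have hw := omega3_pos
  simp only [Aop_inner, Finset.sum_sub_distrib, qtrace, um_pow h]
  simp; field_simp; norm_num

lemma Aop_tr2 {ν : Measure (E 4)} (h : UM ν) (hq : ∀ x ∈ msupp ν, ⟪Aop ν 1 x, x⟫ = 0)
    (b : OrthonormalBasis (Fin 4) ℝ (E 4)) :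
    ∑ i, ‖Aop ν 1 (b i)‖ ^ 2 = 1 := by
  have := h.lf
  have hw := omega3_pos
  have h1 : ∀ i, ‖Aop ν 1 (b i)‖ ^ 2 = qmom ν 1 (b i) (Aop ν 1 (b i)) - ⟪Aop ν 1 (b i), b i⟫ := by
    intro i
    rw [← real_inner_self_eq_norm_sq, Aop_inner, real_inner_comm]
  have h2 : ∑ i, qmom ν 1 (b i) (Aop ν 1 (b i)) = 0 := by
    simp only [qmom]
    rw [← Finset.mul_sum, ← integral_finset_sum _ (fun i _ => intOn ν (by fun_prop) _ _)]
    have : ∀ᵐ z ∂(ν.restrict (closedBall 0 1)), ∑ i, ⟪b i, z⟫ * ⟪Aop ν 1 (b i), z⟫ = 0 := by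
      filter_upwards [ae_restrict_of_ae (ae_msupp ν)] with z hz
      rw [← hq z hz, Aop_symm]
      conv_rhs => rw [← b.sum_inner_mul_inner z (Aop ν 1 z)]
      refine Finset.sum_congr rfl fun i _ => ?_
      rw [Aop_symm, real_inner_comm z]
    rw [integral_congr_ae this]; simp
  simp only [h1, Finset.sum_sub_distrib, h2, Aop_tr h]; norm_num

lemma leb3 (τ : Measure (E 3)) [IsLocallyFiniteMeasure τ] {r0 : ℝ} (hr0 : 0 < r0)
    (h0 : (0 : E 3) ∈ msupp τ)
    (hu : ∀ x ∈ msupp τ, ∀ r : ℝ, 0 < r → r < r0 → τ (closedBall x r) = volume (closedBall x r)) :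
    τ = volume := by
  have key : ∀ s ⊆ msupp τ, τ s = volume s := by
    intro s hs
    have hev : ∀ x ∈ s, ∀ᶠ r : ℝ in 𝓝[>] 0, τ (closedBall x r) = volume (closedBall x r) := by
      intro x hx
      filter_upwards [Ioo_mem_nhdsGT hr0] with r hr
      exact hu x (hs hx) r hr.1 hr.2
    apply le_antisymm
    · refine (Besicovitch.vitaliFamily τ).measure_le_of_frequently_le volume
        Measure.AbsolutelyContinuous.rfl s fun x hx => ?_
      exact (Besicovitch.tendsto_filterAt τ x).frequently
        ((hev x hx).mono fun r hr => hr.le).frequently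
    · refine (Besicovitch.vitaliFamily volume).measure_le_of_frequently_le τ
        Measure.AbsolutelyContinuous.rfl s fun x hx => ?_
      exact (Besicovitch.tendsto_filterAt volume x).frequently
        ((hev x hx).mono fun r hr => hr.ge).frequently
  have hcl := msupp_closed τ
  have hop : IsOpen (msupp τ) := by
    rw [Metric.isOpen_iff]
    intro x hx
    refine ⟨r0 / 2, by positivity, ?_⟩
    have h1 : volume (closedBall x (r0 / 2) \ msupp τ) = 0 := by
      have h2 := measure_inter_add_diff (μ := volume) (closedBall x (r0 / 2)) hcl.measurableSet
      have h3 : τ (closedBall x (r0 / 2) ∩ msupp τ) = τ (closedBall x (r0 / 2)) :=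
        measure_inter_conull (msupp_null τ)
      rw [← key _ inter_subset_right, h3, hu x hx _ (by positivity) (by linarith)] at h2
      have h5 : volume (closedBall x (r0 / 2)) ≠ ⊤ := measure_closedBall_lt_top.ne
      exact (ENNReal.add_right_inj h5).1 (h2.trans (add_zero _).symm)
    have h2 : IsOpen (ball x (r0 / 2) \ msupp τ) := isOpen_ball.sdiff hcl
    have h3 := h2.measure_eq_zero_iff volume |>.1
      (measure_mono_null (sdiff_subset_sdiff_left ball_subset_closedBall) h1)
    intro y hy
    by_contra hc
    exact (h3 ▸ (⟨hy, hc⟩ : y ∈ ball x (r0 / 2) \ msupp τ) : y ∈ (∅ : Set (E 3)))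
  have huniv : msupp τ = univ := IsClopen.eq_univ ⟨hcl, hop⟩ ⟨0, h0⟩
  ext s _
  exact key s (huniv ▸ subset_univ s)

/-- flat measures through the origin with normal `e` -/
def FlatM (ν : Measure (E 4)) (e : E 4) : Prop :=
  ‖e‖ = 1 ∧ ∃ j : E 3 →ₗᵢ[ℝ] E 4, (∀ u, ⟪e, j u⟫ = 0) ∧ (∀ x, ⟪e, x⟫ = 0 → ∃ u, j u = x) ∧
    ν = Measure.map j volume

lemma exists_isom {e : E 4} (he : ‖e‖ = 1) :
    ∃ j : E 3 →ₗᵢ[ℝ] E 4, (∀ u, ⟪e, j u⟫ = 0) ∧ (∀ x, ⟪e, x⟫ = 0 → ∃ u, j u = x) := by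
  have : Fact (finrank ℝ (E 4) = 3 + 1) := ⟨by simp⟩
  have hne : e ≠ 0 := by rintro rfl; simp at he
  let b := OrthonormalBasis.fromOrthogonalSpanSingleton (𝕜 := ℝ) 3 hne
  refine ⟨(ℝ ∙ e)ᗮ.subtypeₗᵢ.comp b.repr.symm.toLinearIsometry, ?_, ?_⟩
  · intro u
    exact Submodule.mem_orthogonal_singleton_iff_inner_right.1 (b.repr.symm u).2
  · intro x hx
    refine ⟨b.repr ⟨x, Submodule.mem_orthogonal_singleton_iff_inner_right.2 hx⟩, ?_⟩
    simp

lemma lemL (ν : Measure (E 4)) [IsLocallyFiniteMeasure ν] {e : E 4} (he : ‖e‖ = 1) {r0 : ℝ}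
    (hr0 : 0 < r0) (h0 : (0 : E 4) ∈ msupp ν) (hs : ∀ x ∈ msupp ν, ⟪e, x⟫ = 0)
    (hu : ∀ x ∈ msupp ν, ∀ r : ℝ, 0 < r → r < r0 →
      ν (closedBall x r) = ENNReal.ofReal (omega3 * r ^ 3)) : FlatM ν e := by
  obtain ⟨j, hj1, hj2⟩ := exists_isom he
  have hemb : MeasurableEmbedding j := j.isometry.isClosedEmbedding.measurableEmbedding
  have hrange : ν (range j)ᶜ = 0 := by
    refine measure_mono_null ?_ (msupp_null ν)
    intro x hx hx2
    exact hx (hj2 x (hs x hx2))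
  set τ := Measure.comap j ν with hτ
  have hball : ∀ u r, τ (closedBall u r) = ν (closedBall (j u) r) := by
    intro u r
    rw [hτ, hemb.comap_apply, ← j.isometry.preimage_closedBall u r, image_preimage_eq_inter_range]
    exact measure_inter_conull hrange
  have hlf : IsLocallyFiniteMeasure τ := ⟨fun u => ⟨closedBall u 1, closedBall_mem_nhds _ one_pos,
    by rw [hball]; exact measure_closedBall_lt_top⟩⟩
  have hsupp : ∀ u, u ∈ msupp τ ↔ j u ∈ msupp ν := by
    intro u; simp only [msupp, mem_setOf_eq, hball]
  have hτv : τ = volume := by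
    refine leb3 τ hr0 ((hsupp 0).2 (by simpa using h0)) ?_
    intro x hx r hr hr2
    rw [hball, hu _ ((hsupp x).1 hx) r hr hr2, vol_ball3 _ _ hr.le]
  refine ⟨he, j, hj1, hj2, ?_⟩
  rw [← hτv, hτ, hemb.map_comap, Measure.restrict_eq_self_of_ae_mem]
  exact hrange

lemma flat_supp {ν : Measure (E 4)} {e : E 4} (h : FlatM ν e) {x : E 4} (hx : ⟪e, x⟫ = 0) :
    x ∈ msupp ν := by
  obtain ⟨_, j, h1, h2, rfl⟩ := h
  obtain ⟨u, rfl⟩ := h2 x hx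
  intro r hr
  rw [j.isometry.isClosedEmbedding.measurableEmbedding.map_apply, j.isometry.preimage_closedBall]
  exact measure_closedBall_pos _ _ hr

lemma flat_int {j : E 3 →ₗᵢ[ℝ] E 4} (g : E 4 → ℝ) (R : ℝ) :
    ∫ z in closedBall 0 R, g z ∂(Measure.map j volume) = ∫ u in closedBall (0 : E 3) R, g (j u) := by
  have hemb : MeasurableEmbedding j := j.isometry.isClosedEmbedding.measurableEmbedding
  rw [hemb.setIntegral_map]
  congr 2
  have := j.isometry.preimage_closedBall 0 R
  rw [map_zero] at this
  rw [this]

/-! integrals on E3 -/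

lemma e3_rot (f : ℝ → ℝ → ℝ) {v w : E 3} (h : ‖v‖ = ‖w‖) :
    ∫ u in closedBall (0 : E 3) 1, f ‖u‖ ⟪v, u⟫ = ∫ u in closedBall (0 : E 3) 1, f ‖u‖ ⟪w, u⟫ := by
  set ρ := Submodule.reflection (ℝ ∙ (v - w))ᗮ with hρ
  have h1 : ρ v = w := Submodule.reflection_sub h
  have h2 := ρ.measurePreserving.setIntegral_preimage_emb ρ.toHomeomorph.measurableEmbedding
    (fun u => f ‖u‖ ⟪w, u⟫) (closedBall 0 1)
  rw [← h2]
  have h3 : ρ ⁻¹' closedBall 0 1 = closedBall 0 1 := by ext z; simp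
  rw [h3]
  congr 1; ext u
  rw [← h1, ρ.norm_map, ρ.inner_map_map]

lemma e3_I4 (t : OrthonormalBasis (Fin 3) ℝ (E 3)) :
    ∃ I4 I22 : ℝ, (∀ i, ∫ u in closedBall (0 : E 3) 1, ⟪t i, u⟫ ^ 4 = I4) ∧
      (∀ i j, i ≠ j → ∫ u in closedBall (0 : E 3) 1, ⟪t i, u⟫ ^ 2 * ⟪t j, u⟫ ^ 2 = I22) ∧
      I4 = 3 * I22 := by
  set I4 := ∫ u in closedBall (0 : E 3) 1, ⟪t 0, u⟫ ^ 4 with hI4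
  have h4 : ∀ i, ∫ u in closedBall (0 : E 3) 1, ⟪t i, u⟫ ^ 4 = I4 := by
    intro i; exact e3_rot (fun _ s => s ^ 4) (by simp)
  have I : ∀ g : E 3 → ℝ, Continuous g → Integrable g (volume.restrict (closedBall 0 1)) :=
    fun g hg => intOn volume hg 0 1
  refine ⟨I4, I4 / 3, h4, ?_, by ring⟩
  intro i j hij
  have hn : ∀ s : ℝ, s ^ 2 = 1 → ∫ u in closedBall (0 : E 3) 1, ⟪t i + s • t j, u⟫ ^ 4 = 4 * I4 := by
    intro s hs
    have e1 : ∫ u in closedBall (0 : E 3) 1, ⟪t i + s • t j, u⟫ ^ 4 =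
        ∫ u in closedBall (0 : E 3) 1, ⟪√2 • t i, u⟫ ^ 4 := by
      refine e3_rot (fun _ s => s ^ 4) ?_
      rw [← sq_eq_sq₀ (norm_nonneg _) (norm_nonneg _), norm_add_sq_real, norm_smul, norm_smul,
        inner_smul_right, t.inner_eq_zero hij, mul_pow, mul_pow]
      simp [hs]; norm_num
    rw [e1, ← h4 i, ← integral_const_mul]
    congr 1; ext u
    rw [inner_smul_left]
    have : (√2) ^ 4 = 4 := by
      rw [show (4:ℕ) = 2 * 2 by norm_num, pow_mul, Real.sq_sqrt (by norm_num)]; norm_num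
    simp [mul_pow, this]
  have h5 : ∫ u in closedBall (0 : E 3) 1, (⟪t i + (1:ℝ) • t j, u⟫ ^ 4 + ⟪t i + (-1:ℝ) • t j, u⟫ ^ 4)
      = 8 * I4 := by
    rw [integral_add (I _ (by fun_prop)) (I _ (by fun_prop)), hn 1 (by norm_num), hn (-1) (by norm_num)]
    ring
  have h6 : ∫ u in closedBall (0 : E 3) 1, (⟪t i + (1:ℝ) • t j, u⟫ ^ 4 + ⟪t i + (-1:ℝ) • t j, u⟫ ^ 4)
      = 2 * I4 + 2 * I4 + 12 * ∫ u in closedBall (0 : E 3) 1, ⟪t i, u⟫ ^ 2 * ⟪t j, u⟫ ^ 2 := by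
    conv_rhs => enter [1, 1]; rw [← h4 i]
    conv_rhs => enter [1, 2]; rw [← h4 j]
    rw [← integral_const_mul, ← integral_const_mul, ← integral_const_mul,
      ← integral_add (I _ (by fun_prop)) (I _ (by fun_prop)),
      ← integral_add (I _ (by fun_prop)) (I _ (by fun_prop))]
    congr 1; ext u
    simp only [inner_add_left, inner_smul_left]
    simp; ring
  linarith

lemma e3_quartic (t : OrthonormalBasis (Fin 3) ℝ (E 3)) (β : Fin 3 → ℝ) :
    ∫ u in closedBall (0 : E 3) 1, (∑ i, β i * ⟪t i, u⟫ ^ 2) ^ 2 =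
      omega3 / 35 * (2 * ∑ i, β i ^ 2 + (∑ i, β i) ^ 2) := by
  obtain ⟨I4, I22, h1, h2, h3⟩ := e3_I4 t
  have I : ∀ g : E 3 → ℝ, Continuous g → Integrable g (volume.restrict (closedBall 0 1)) :=
    fun g hg => intOn volume hg 0 1
  have key : ∀ β : Fin 3 → ℝ, ∫ u in closedBall (0 : E 3) 1, (∑ i, β i * ⟪t i, u⟫ ^ 2) ^ 2 =
      I22 * (2 * ∑ i, β i ^ 2 + (∑ i, β i) ^ 2) := by
    intro β
    have : ∀ u : E 3, (∑ i, β i * ⟪t i, u⟫ ^ 2) ^ 2 =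
        β 0 ^ 2 * ⟪t 0, u⟫ ^ 4 + β 1 ^ 2 * ⟪t 1, u⟫ ^ 4 + β 2 ^ 2 * ⟪t 2, u⟫ ^ 4 +
        (2 * β 0 * β 1) * (⟪t 0, u⟫ ^ 2 * ⟪t 1, u⟫ ^ 2) + (2 * β 0 * β 2) * (⟪t 0, u⟫ ^ 2 * ⟪t 2, u⟫ ^ 2)
        + (2 * β 1 * β 2) * (⟪t 1, u⟫ ^ 2 * ⟪t 2, u⟫ ^ 2) := by
      intro u; simp only [Fin.sum_univ_three]; ring
    simp only [this]
    rw [integral_add (I _ (by fun_prop)) (I _ (by fun_prop)), integral_add (I _ (by fun_prop)) (I _ (by fun_prop)),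
      integral_add (I _ (by fun_prop)) (I _ (by fun_prop)), integral_add (I _ (by fun_prop)) (I _ (by fun_prop)),
      integral_add (I _ (by fun_prop)) (I _ (by fun_prop))]
    simp only [integral_const_mul, h1]
    rw [h2 0 1 (by decide), h2 0 2 (by decide), h2 1 2 (by decide), h3]
    simp only [Fin.sum_univ_three]; ring
  have hn : ∫ u in closedBall (0 : E 3) 1, (∑ i, (fun _ => (1:ℝ)) i * ⟪t i, u⟫ ^ 2) ^ 2 = 3 * omega3 / 7 := by
    have := e3_pow 4
    rw [show (3 * omega3 / 7 : ℝ) = 3 * omega3 / ((4:ℕ) + 3) by norm_num, ← this]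
    congr 1; ext u
    have h5 := t.sum_sq_norm_inner_right u
    simp only [Real.norm_eq_abs, sq_abs] at h5
    simp only [one_mul, h5]; ring
  rw [key] at hn
  rw [key]
  have : I22 = omega3 / 35 := by
    simp at hn; linarith
  rw [this]

lemma e3_quad (t : OrthonormalBasis (Fin 3) ℝ (E 3)) (β : Fin 3 → ℝ) :
    ∫ u in closedBall (0 : E 3) 1, (1 - ‖u‖ ^ 2) * (∑ i, β i * ⟪t i, u⟫ ^ 2) =
      2 * omega3 / 35 * ∑ i, β i := by
  have I : ∀ g : E 3 → ℝ, Continuous g → Integrable g (volume.restrict (closedBall 0 1)) :=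
    fun g hg => intOn volume hg 0 1
  set J := ∫ u in closedBall (0 : E 3) 1, (1 - ‖u‖ ^ 2) * ⟪t 0, u⟫ ^ 2 with hJ
  have h1 : ∀ i, ∫ u in closedBall (0 : E 3) 1, (1 - ‖u‖ ^ 2) * ⟪t i, u⟫ ^ 2 = J := by
    intro i; exact e3_rot (fun a s => (1 - a ^ 2) * s ^ 2) (by simp)
  have key : ∀ β : Fin 3 → ℝ, ∫ u in closedBall (0 : E 3) 1, (1 - ‖u‖ ^ 2) * (∑ i, β i * ⟪t i, u⟫ ^ 2) =
      J * ∑ i, β i := by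
    intro β
    have : ∀ u : E 3, (1 - ‖u‖ ^ 2) * (∑ i, β i * ⟪t i, u⟫ ^ 2) =
        ∑ i, β i * ((1 - ‖u‖ ^ 2) * ⟪t i, u⟫ ^ 2) := by
      intro u; rw [Finset.mul_sum]; refine Finset.sum_congr rfl fun i _ => by ring
    simp only [this]
    rw [integral_finset_sum _ (fun i _ => I _ (by fun_prop))]
    simp only [integral_const_mul, h1]
    rw [← Finset.sum_mul, mul_comm]
  have hn : ∫ u in closedBall (0 : E 3) 1, (1 - ‖u‖ ^ 2) * (∑ i, (fun _ => (1:ℝ)) i * ⟪t i, u⟫ ^ 2) =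
      6 * omega3 / 35 := by
    have : ∀ u : E 3, (1 - ‖u‖ ^ 2) * (∑ i, (fun _ => (1:ℝ)) i * ⟪t i, u⟫ ^ 2) = ‖u‖ ^ 2 - ‖u‖ ^ 4 := by
      intro u
      have h5 := t.sum_sq_norm_inner_right u
      simp only [Real.norm_eq_abs, sq_abs] at h5
      simp only [one_mul, h5]; ring
    simp only [this]
    rw [integral_sub (I _ (by fun_prop)) (I _ (by fun_prop)), e3_pow, e3_pow]
    push_cast; ring
  rw [key] at hn
  rw [key]
  have : J = 2 * omega3 / 35 := by
    simp at hn; linarith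
  rw [this]

lemma sc_lf' (ν : Measure (E 4)) [IsLocallyFiniteMeasure ν] (x : E 4) (r : ℝ) :
    IsLocallyFiniteMeasure (sc ν x r) := by
  by_cases hr : 0 < r
  · exact sc_lf ν x hr
  · have : sc ν x r = 0 := by
      have h : ENNReal.ofReal (r⁻¹ ^ 3) = 0 := by
        rw [ENNReal.ofReal_eq_zero]
        have : r⁻¹ ≤ 0 := inv_nonpos.2 (not_lt.1 hr)
        exact Odd.pow_nonpos (by decide) this
      rw [sc, h, zero_smul]
    rw [this]; infer_instance

lemma sc_au {ι : Type} {l : Filter ι} {ν : Measure (E 4)} (h : UM ν) {x : E 4} (hx : x ∈ msupp ν)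
    {ρ : ι → ℝ} (hρ : ∀ᶠ i in l, 0 < ρ i) : AU l (fun i => sc ν x (ρ i)) := by
  have := h.lf
  refine ⟨fun i => sc_lf' ν x _, hρ.mono fun i hi => (sc_um h hx hi).z, ?_⟩
  intro R r ε hr hε
  filter_upwards [hρ] with i hi y hy _
  rw [(sc_um h hx hi).real hy hr]; simpa using hε.le

/-- nearest point -/
def nrst (S : Set (E 4)) (x : E 4) : E 4 :=
  open Classical in if h : ∃ y ∈ S, dist y x ≤ infDist x S then h.choose else 0

lemma nrst_spec {S : Set (E 4)} (hS : IsClosed S) (hne : S.Nonempty) (x : E 4) :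
    nrst S x ∈ S ∧ dist (nrst S x) x ≤ infDist x S := by
  have h : ∃ y ∈ S, dist y x ≤ infDist x S := by
    obtain ⟨y, hy, h⟩ := hS.exists_infDist_eq_dist hne x
    exact ⟨y, hy, by rw [h, dist_comm]⟩
  rw [nrst, dif_pos h]
  exact h.choose_spec

lemma nrst_tendsto {ι : Type} {l : Filter ι} {m : ι → Measure (E 4)} {ν : Measure (E 4)}
    [IsLocallyFiniteMeasure ν]
    (hA : AU l m) (hC : Conv l m ν) {x : E 4} (hx : x ∈ msupp ν) :
    Tendsto (fun i => nrst (msupp (m i)) x) l (𝓝 x) := by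
  rw [Metric.tendsto_nhds]
  intro ε hε
  filter_upwards [sup1 hA hC hx hε] with i hi
  obtain ⟨y, hy, hd⟩ := hi
  refine lt_of_le_of_lt (nrst_spec (msupp_closed _) ⟨y, hy⟩ x).2 (lt_of_le_of_lt ?_ hd)
  rw [dist_comm]; exact infDist_le_dist_of_mem hy

lemma nrst_mem {ι : Type} {l : Filter ι} {m : ι → Measure (E 4)}
    (hA : AU l m) (x : E 4) : ∀ᶠ i in l, nrst (msupp (m i)) x ∈ msupp (m i) := by
  filter_upwards [hA.z] with i hi
  exact (nrst_spec (msupp_closed _) ⟨0, hi⟩ x).1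

lemma quad_exp {A : E 4 →L[ℝ] E 4} (hA : ∀ u v, ⟪A u, v⟫ = ⟪u, A v⟫) (x y : E 4) (ρ : ℝ) :
    ⟪A (x + ρ • y), x + ρ • y⟫ = ⟪A x, x⟫ + ρ * (2 * ⟪A x, y⟫ + ρ * ⟪A y, y⟫) := by
  have : ⟪A y, x⟫ = ⟪A x, y⟫ := by rw [hA, real_inner_comm]
  simp only [map_add, map_smul, inner_add_left, inner_add_right, inner_smul_left, inner_smul_right, this]
  simp; ring

lemma lemT {ν : Measure (E 4)} (h : UM ν) {A : E 4 →L[ℝ] E 4} (hA : ∀ u v, ⟪A u, v⟫ = ⟪u, A v⟫)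
    (hq : ∀ x ∈ msupp ν, ⟪A x, x⟫ = 0) {x : E 4} (hx : x ∈ msupp ν) (hv : A x ≠ 0)
    {ι : Type} (l : Ultrafilter ι) {ρ : ι → ℝ} (hρ : Tendsto ρ l (𝓝[>] 0)) :
    ∃ ψ, UM ψ ∧ Conv l (fun i => sc ν x (ρ i)) ψ ∧ FlatM ψ (‖A x‖⁻¹ • A x) := by
  have hpos : ∀ᶠ i in (l : Filter ι), 0 < ρ i := hρ.eventually self_mem_nhdsWithin
  have h0 : Tendsto ρ l (𝓝 0) := hρ.mono_right nhdsWithin_le_nhds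
  have hau := sc_au h hx hpos
  obtain ⟨ψ, hψ, hC⟩ := lim_exists l hau
  have := hψ.lf
  refine ⟨ψ, hψ, hC, ?_⟩
  refine lemL ψ ?_ one_pos hψ.z ?_ (fun x hx r hr _ => hψ.u x hx r hr)
  · rw [norm_smul, norm_inv, norm_norm, inv_mul_cancel₀ (norm_ne_zero_iff.2 hv)]
  · intro w hw
    have t1 := nrst_tendsto hau hC hw
    have t2 : Tendsto (fun i => 2 * ⟪A x, nrst (msupp (sc ν x (ρ i))) w⟫ + ρ i *
        ⟪A (nrst (msupp (sc ν x (ρ i))) w), nrst (msupp (sc ν x (ρ i))) w⟫) l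
        (𝓝 (2 * ⟪A x, w⟫ + 0 * ⟪A w, w⟫)) := by
      refine Tendsto.add (Tendsto.const_mul _ (tendsto_const_nhds.inner t1)) (h0.mul ?_)
      exact Tendsto.inner ((A.continuous.tendsto w).comp t1) t1
    have t3 : ∀ᶠ i in (l : Filter ι), 2 * ⟪A x, nrst (msupp (sc ν x (ρ i))) w⟫ + ρ i *
        ⟪A (nrst (msupp (sc ν x (ρ i))) w), nrst (msupp (sc ν x (ρ i))) w⟫ = 0 := by
      filter_upwards [hpos, nrst_mem hau w] with i hi hm
      have := hq _ ((sc_supp ν x hi _).1 hm)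
      rw [quad_exp hA, hq x hx, zero_add] at this
      exact (mul_eq_zero.1 this).resolve_left hi.ne'
    have t4 := tendsto_nhds_unique (t2.congr' t3) tendsto_const_nhds
    rw [inner_smul_left]
    simp at t4
    simp [t4]

lemma tang {ν : Measure (E 4)} (h : UM ν) {A : E 4 →L[ℝ] E 4} (hA : ∀ u v, ⟪A u, v⟫ = ⟪u, A v⟫)
    (hq : ∀ x ∈ msupp ν, ⟪A x, x⟫ = 0) {x : E 4} (hx : x ∈ msupp ν) (hv : A x ≠ 0)
    {u : E 4} (hu : ⟪A x, u⟫ = 0) :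
    ∃ y : ℝ → E 4, (∀ᶠ ρ in 𝓝[>] 0, x + ρ • y ρ ∈ msupp ν) ∧ Tendsto y (𝓝[>] 0) (𝓝 u) := by
  have hpos : ∀ᶠ i : ℝ in 𝓝[>] 0, 0 < i := self_mem_nhdsWithin
  refine ⟨fun ρ => nrst (msupp (sc ν x ρ)) u, ?_, ?_⟩
  · filter_upwards [hpos, nrst_mem (sc_au (ρ := fun i => i) h hx hpos) u] with i hi hm
    exact (sc_supp ν x hi _).1 hm
  · rw [tendsto_iff_ultrafilter]
    intro l hl
    obtain ⟨ψ, hψ, hC, hF⟩ := lemT h hA hq hx hv l (ρ := fun i => i) hl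
    have := hψ.lf
    refine nrst_tendsto (sc_au (ρ := fun i => i) h hx (hl hpos)) hC (flat_supp hF ?_)
    rw [inner_smul_left, hu, mul_zero]

lemma curve1 {ν : Measure (E 4)} (h : UM ν) {Y : ℝ → E 4} {u : E 4}
    (hY : ∀ᶠ s in 𝓝[>] 0, s • Y s ∈ msupp ν) (hYu : Tendsto Y (𝓝[>] 0) (𝓝 u)) :
    ∀ᶠ s in 𝓝[>] 0, |⟪bv ν, Y s⟫ + s * ⟪Aop ν 1 (Y s), Y s⟫| ≤ 2000 * s ^ 2 * ‖Y s‖ ^ 3 := by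
  have := h.lf
  have hpos : ∀ᶠ i : ℝ in 𝓝[>] 0, 0 < i := self_mem_nhdsWithin
  have h0 : Tendsto (fun s : ℝ => s • Y s) (𝓝[>] 0) (𝓝 ((0:ℝ) • u)) :=
    Tendsto.smul (tendsto_id.mono_left nhdsWithin_le_nhds) hYu
  rw [zero_smul] at h0
  have h1 : ∀ᶠ s in 𝓝[>] 0, ‖s • Y s‖ ≤ 1 / 10 := by
    filter_upwards [h0.eventually (closedBall_mem_nhds 0 (show (0:ℝ) < 1 / 10 by norm_num))] with s hs
    simpa using hs
  filter_upwards [hpos, h1, hY] with s hs h2 h3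
  have h4 := expansion h h3 h2
  rw [Aop_inner]
  have e : ⟪bv ν, s • Y s⟫ + qmom ν 1 (s • Y s) (s • Y s) - ‖s • Y s‖ ^ 2 =
      s * (⟪bv ν, Y s⟫ + s * (qmom ν 1 (Y s) (Y s) - ⟪Y s, Y s⟫)) := by
    rw [inner_smul_right, qmom_smul, qmom_comm, qmom_smul, norm_smul, mul_pow,
      real_inner_self_eq_norm_sq]
    simp; ring
  rw [e, abs_mul, abs_of_pos hs, norm_smul, Real.norm_eq_abs, abs_of_pos hs] at h4
  have : s * |⟪bv ν, Y s⟫ + s * (qmom ν 1 (Y s) (Y s) - ⟪Y s, Y s⟫)| ≤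
      s * (2000 * s ^ 2 * ‖Y s‖ ^ 3) := by linarith
  exact le_of_mul_le_mul_left this hs

lemma curve2 {ν : Measure (E 4)} (h : UM ν) {Y : ℝ → E 4} {u : E 4}
    (hY : ∀ᶠ s in 𝓝[>] 0, s • Y s ∈ msupp ν) (hYu : Tendsto Y (𝓝[>] 0) (𝓝 u)) :
    ⟪bv ν, u⟫ = 0 := by
  have hs : Tendsto (fun s : ℝ => s) (𝓝[>] 0) (𝓝 0) := tendsto_id.mono_left nhdsWithin_le_nhds
  have t1 : Tendsto (fun s => |⟪bv ν, Y s⟫ + s * ⟪Aop ν 1 (Y s), Y s⟫|) (𝓝[>] 0)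
      (𝓝 |⟪bv ν, u⟫ + 0 * ⟪Aop ν 1 u, u⟫|) :=
    ((tendsto_const_nhds.inner hYu).add
      (hs.mul ((((Aop ν 1).continuous.tendsto u).comp hYu).inner hYu))).abs
  have t2 : Tendsto (fun s => 2000 * s ^ 2 * ‖Y s‖ ^ 3) (𝓝[>] 0) (𝓝 (2000 * 0 ^ 2 * ‖u‖ ^ 3)) :=
    ((hs.pow 2).const_mul _).mul (hYu.norm.pow 3)
  have := le_of_tendsto_of_tendsto t1 t2 (curve1 h hY hYu)
  simp at this
  exact this

/-- second order: if along the curve `⟪b,Y s⟫ = s * g s` with `g → g0`, then `g0 + q(u) = 0`. -/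
lemma curve3 {ν : Measure (E 4)} (h : UM ν) {Y : ℝ → E 4} {u : E 4}
    (hY : ∀ᶠ s in 𝓝[>] 0, s • Y s ∈ msupp ν) (hYu : Tendsto Y (𝓝[>] 0) (𝓝 u))
    {g : ℝ → ℝ} {g0 : ℝ} (hg : ∀ᶠ s in 𝓝[>] 0, ⟪bv ν, Y s⟫ = s * g s)
    (hg0 : Tendsto g (𝓝[>] 0) (𝓝 g0)) : g0 + ⟪Aop ν 1 u, u⟫ = 0 := by
  have hpos : ∀ᶠ i : ℝ in 𝓝[>] 0, 0 < i := self_mem_nhdsWithin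
  have hs : Tendsto (fun s : ℝ => s) (𝓝[>] 0) (𝓝 0) := tendsto_id.mono_left nhdsWithin_le_nhds
  have t1 : Tendsto (fun s => |g s + ⟪Aop ν 1 (Y s), Y s⟫|) (𝓝[>] 0)
      (𝓝 |g0 + ⟪Aop ν 1 u, u⟫|) :=
    (hg0.add ((((Aop ν 1).continuous.tendsto u).comp hYu).inner hYu)).abs
  have t2 : Tendsto (fun s => 2000 * s * ‖Y s‖ ^ 3) (𝓝[>] 0) (𝓝 (2000 * 0 * ‖u‖ ^ 3)) :=
    (hs.const_mul _).mul (hYu.norm.pow 3)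
  have := le_of_tendsto_of_tendsto t1 t2 (by
    filter_upwards [curve1 h hY hYu, hg, hpos] with s h1 h2 h3
    rw [h2, ← mul_add, abs_mul, abs_of_pos h3] at h1
    have : s * |g s + ⟪Aop ν 1 (Y s), Y s⟫| ≤ s * (2000 * s * ‖Y s‖ ^ 3) := by linarith
    exact le_of_mul_le_mul_left this h3)
  simp at this
  exact this

lemma decomp {n : E 4} (hn : ‖n‖ = 1) {j : E 3 →ₗᵢ[ℝ] E 4} (h1 : ∀ u, ⟪n, j u⟫ = 0)
    (h2 : ∀ x, ⟪n, x⟫ = 0 → ∃ u, j u = x) (t : OrthonormalBasis (Fin 3) ℝ (E 3)) (z : E 4) :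
    ∑ i, ⟪j (t i), z⟫ ^ 2 + ⟪n, z⟫ ^ 2 = ‖z‖ ^ 2 := by
  have hnn : ⟪n, n⟫ = 1 := by rw [real_inner_self_eq_norm_sq, hn]; norm_num
  obtain ⟨u, hu⟩ := h2 (z - ⟪n, z⟫ • n) (by
    rw [inner_sub_right, inner_smul_right, hnn]; ring)
  have hz : z = j u + ⟪n, z⟫ • n := by rw [hu]; abel
  have h1' : ∀ u, ⟪j u, n⟫ = 0 := fun u => by rw [real_inner_comm]; exact h1 u
  have hi : ∀ i, ⟪j (t i), z⟫ = ⟪t i, u⟫ := by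
    intro i
    rw [hz, inner_add_right, inner_smul_right, j.inner_map_map, h1']; simp
  have h5 := t.sum_sq_norm_inner_right u
  simp only [Real.norm_eq_abs, sq_abs] at h5
  simp only [hi, h5]
  conv_rhs => rw [hz, norm_add_sq_real, inner_smul_right, h1', norm_smul, hn,
    j.norm_map]
  simp

lemma U_id {ν : Measure (E 4)} (h : UM ν) {A : E 4 →L[ℝ] E 4} (hA : ∀ u v, ⟪A u, v⟫ = ⟪u, A v⟫)
    (hq : ∀ x ∈ msupp ν, ⟪A x, x⟫ = 0) {x : E 4} (hx : x ∈ msupp ν) (hv : A x ≠ 0)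
    {j : E 3 →ₗᵢ[ℝ] E 4} (h1 : ∀ u, ⟪A x, j u⟫ = 0)
    (h2 : ∀ z, ⟪A x, z⟫ = 0 → ∃ u, j u = z) (t : OrthonormalBasis (Fin 3) ℝ (E 3))
    {R : ℝ} (hR : 0 < R) :
    ∫ z in closedBall 0 1, ⟪A z, z⟫ ^ 2 ∂(sc ν x R) =
      (∑ i, ⟪A (j (t i)), j (t i)⟫) * ∫ z in closedBall 0 1, (1 - ‖z‖ ^ 2) * ⟪A z, z⟫ ∂(sc ν x R) := by
  have hw := omega3_pos
  set κ := sc ν x R with hκ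
  have hU : UM κ := sc_um h hx hR
  have := hU.lf
  set v := A x with hvd
  have hv2 : 0 < ‖v‖ ^ 2 := by have := norm_pos_iff.2 hv; positivity
  have hsup : ∀ z ∈ msupp κ, ⟪v, z⟫ = - (R / 2) * ⟪A z, z⟫ := by
    intro z hz
    have := hq _ ((sc_supp ν x hR z).1 hz)
    rw [quad_exp hA, hq x hx, zero_add] at this
    have := (mul_eq_zero.1 this).resolve_left hR.ne'
    linarith
  -- curves
  have hcurve : ∀ u, ⟪v, u⟫ = 0 → ∃ Y : ℝ → E 4, (∀ᶠ s in 𝓝[>] 0, s • Y s ∈ msupp κ) ∧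
      Tendsto Y (𝓝[>] 0) (𝓝 u) := by
    intro u hu
    obtain ⟨y, hy1, hy2⟩ := tang h hA hq hx hv hu
    have ht : Tendsto (fun s : ℝ => R * s) (𝓝[>] 0) (𝓝[>] 0) := by
      apply tendsto_nhdsWithin_of_tendsto_nhds_of_eventually_within
      · have : Tendsto (fun s : ℝ => R * s) (𝓝 0) (𝓝 (R * 0)) := by
          exact Continuous.tendsto (by fun_prop) 0
        rw [mul_zero] at this
        exact this.mono_left nhdsWithin_le_nhds
      · filter_upwards [self_mem_nhdsWithin] with s hs
        exact mul_pos hR hs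
    refine ⟨fun s => y (R * s), ?_, hy2.comp ht⟩
    filter_upwards [ht.eventually hy1] with s hs
    rw [hκ, sc_supp ν x hR, smul_smul]; exact hs
  have hb0 : ∀ u, ⟪v, u⟫ = 0 → ⟪bv κ, u⟫ = 0 := by
    intro u hu
    obtain ⟨Y, hY1, hY2⟩ := hcurve u hu
    exact curve2 hU hY1 hY2
  set β := ⟪bv κ, v⟫ / ‖v‖ ^ 2 with hβ
  have hb : ∀ z, ⟪bv κ, z⟫ = β * ⟪v, z⟫ := by
    intro z
    have := hb0 (z - (⟪v, z⟫ / ‖v‖ ^ 2) • v) (by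
      rw [inner_sub_right, inner_smul_right, real_inner_self_eq_norm_sq]; field_simp; ring)
    rw [inner_sub_right, inner_smul_right] at this
    rw [hβ]; field_simp at this ⊢; linarith
  have hB : ∀ u, ⟪v, u⟫ = 0 → ⟪Aop κ 1 u, u⟫ = β * (R / 2) * ⟪A u, u⟫ := by
    intro u hu
    obtain ⟨Y, hY1, hY2⟩ := hcurve u hu
    have hpos : ∀ᶠ i : ℝ in 𝓝[>] 0, 0 < i := self_mem_nhdsWithin
    have := curve3 hU hY1 hY2 (g := fun s => - (β * (R / 2) * ⟪A (Y s), Y s⟫))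
      (g0 := - (β * (R / 2) * ⟪A u, u⟫)) (by
        filter_upwards [hY1, hpos] with s hs hs0
        have h3 := hsup _ hs
        simp only [inner_smul_right, map_smul, inner_smul_left] at h3
        simp at h3
        have h4 : s * ⟪v, Y s⟫ = s * (- (R / 2) * (s * ⟪A (Y s), Y s⟫)) := by rw [h3]; ring
        have h5 := mul_left_cancel₀ hs0.ne' h4
        rw [hb, h5]; ring) (by
        exact ((((A.continuous.tendsto u).comp hY2).inner hY2).const_mul _).neg)
    linarith
  set n := ‖v‖⁻¹ • v with hn
  have hnn : ‖n‖ = 1 := by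
    rw [hn, norm_smul, norm_inv, norm_norm, inv_mul_cancel₀ (norm_ne_zero_iff.2 hv)]
  have hnz : ∀ z, ⟪n, z⟫ = ‖v‖⁻¹ * ⟪v, z⟫ := fun z => by rw [hn, inner_smul_left]; simp
  have htr : ∑ i, qmom κ 1 (j (t i)) (j (t i)) + qmom κ 1 n n = 3 := by
    have e := um_pow hU 2
    simp only [qmom]
    rw [← Finset.mul_sum, ← mul_add, ← integral_finset_sum _ (fun i _ => intOn κ (by fun_prop) _ _),
      ← integral_add (intOn κ (by fun_prop) _ _) (intOn κ (by fun_prop) _ _)]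
    have : ∀ z : E 4, ∑ i, ⟪j (t i), z⟫ * ⟪j (t i), z⟫ + ⟪n, z⟫ * ⟪n, z⟫ = ‖z‖ ^ 2 := by
      intro z
      rw [← decomp hnn (j := j) (fun u => by rw [hnz, h1, mul_zero]) (fun z hz => h2 z (by
        rw [hnz] at hz
        exact (mul_eq_zero.1 hz).resolve_left (inv_ne_zero (norm_ne_zero_iff.2 hv)))) t z]
      simp only [sq]
    simp only [this, e]
    field_simp; norm_num
  have hsum : ∑ i, qmom κ 1 (j (t i)) (j (t i)) = 3 + β * (R / 2) * ∑ i, ⟪A (j (t i)), j (t i)⟫ := by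
    have : ∀ i, qmom κ 1 (j (t i)) (j (t i)) = 1 + β * (R / 2) * ⟪A (j (t i)), j (t i)⟫ := by
      intro i
      have e := hB _ (h1 (t i))
      rw [Aop_inner, j.inner_map_map, real_inner_self_eq_norm_sq, t.norm_eq_one] at e
      linarith
    simp only [this, Finset.sum_add_distrib, Finset.mul_sum]
    simp
  have hae : ∀ᵐ z ∂(κ.restrict (closedBall 0 1)), z ∈ msupp κ := ae_restrict_of_ae (ae_msupp κ)
  have hqn : qmom κ 1 n n * ‖v‖ ^ 2 = 5 / omega3 * (R ^ 2 / 4) * ∫ z in closedBall 0 1, ⟪A z, z⟫ ^ 2 ∂κ := by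
    rw [qmom]
    have : ∫ z in closedBall 0 1, ⟪n, z⟫ * ⟪n, z⟫ ∂κ =
        ∫ z in closedBall 0 1, ((R ^ 2 / 4) * (‖v‖ ^ 2)⁻¹) * ⟪A z, z⟫ ^ 2 ∂κ := by
      apply integral_congr_ae
      filter_upwards [hae] with z hz
      rw [hnz, hsup z hz]; field_simp; ring
    rw [this, integral_const_mul]
    field_simp
  have hbb : β * ‖v‖ ^ 2 = - (5 / omega3) * (R / 2) * ∫ z in closedBall 0 1, (1 - ‖z‖ ^ 2) * ⟪A z, z⟫ ∂κ := by
    rw [hβ, div_mul_cancel₀ _ hv2.ne', bv_inner]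
    have : ∫ z in closedBall 0 1, (1 - ‖z‖ ^ 2) * ⟪z, v⟫ ∂κ =
        ∫ z in closedBall 0 1, (- (R / 2)) * ((1 - ‖z‖ ^ 2) * ⟪A z, z⟫) ∂κ := by
      apply integral_congr_ae
      filter_upwards [hae] with z hz
      rw [real_inner_comm, hsup z hz]; ring
    rw [this, integral_const_mul]; ring
  set I1 := ∫ z in closedBall 0 1, ⟪A z, z⟫ ^ 2 ∂κ
  set I2 := ∫ z in closedBall 0 1, (1 - ‖z‖ ^ 2) * ⟪A z, z⟫ ∂κ
  set H := ∑ i, ⟪A (j (t i)), j (t i)⟫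
  have hfin : qmom κ 1 n n * ‖v‖ ^ 2 = - (R / 2) * H * (β * ‖v‖ ^ 2) := by
    have : qmom κ 1 n n = - (β * (R / 2) * H) := by linarith
    rw [this]; ring
  rw [hqn, hbb] at hfin
  have : 5 / omega3 * (R ^ 2 / 4) * I1 = 5 / omega3 * (R ^ 2 / 4) * (H * I2) := by
    rw [hfin]; ring
  exact mul_left_cancel₀ (by positivity) this

lemma alg3' {b1 b2 p0 p1 p2 : ℝ} (hp : p0 ≠ 0) (h1 : b1 * p1 = 0) (h2 : b2 * p2 = 0)
    (hb : 2 * (b1 ^ 2 + b2 ^ 2) = (b1 + b2) ^ 2) (w0 w1 w2 : ℝ)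
    (hw : p0 * w0 + p1 * w1 + p2 * w2 = 0) :
    b1 * w1 ^ 2 + b2 * w2 ^ 2 = b1 * (w0 ^ 2 + w1 ^ 2 + w2 ^ 2) := by
  have h12 : b2 = b1 := by
    have : (b2 - b1) ^ 2 = 0 := by linarith
    have := pow_eq_zero_iff (two_ne_zero) |>.1 this
    linarith
  subst h12
  by_cases hb0 : b2 = 0
  · rw [hb0]; ring
  · have e1 := (mul_eq_zero.1 h1).resolve_left hb0
    have e2 := (mul_eq_zero.1 h2).resolve_left hb0
    rw [e1, e2] at hw
    have : w0 = 0 := by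
      have : p0 * w0 = 0 := by linarith
      exact (mul_eq_zero.1 this).resolve_left hp
    rw [this]; ring

lemma alg3 {β p : Fin 3 → ℝ} (h0 : ∀ i, β i * p i = 0) (hp : ∃ i, p i ≠ 0)
    (hβ : 2 * ∑ i, β i ^ 2 = (∑ i, β i) ^ 2) :
    ∃ c, ∀ w : Fin 3 → ℝ, ∑ i, p i * w i = 0 → ∑ i, β i * w i ^ 2 = c * ∑ i, w i ^ 2 := by
  simp only [Fin.sum_univ_three] at *
  have h00 := h0 0
  have h01 := h0 1
  have h02 := h0 2
  obtain ⟨i, hi⟩ := hp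
  have hbi := (mul_eq_zero.1 (h0 i)).resolve_right hi
  fin_cases i
  · simp only [Fin.zero_eta] at hi hbi
    refine ⟨β 1, fun w hw => ?_⟩
    have := alg3' hi h01 h02 (by rw [hbi] at hβ; linarith) (w 0) (w 1) (w 2) (by linarith)
    rw [hbi]; linarith
  · simp only [Fin.mk_one] at hi hbi
    refine ⟨β 0, fun w hw => ?_⟩
    have := alg3' hi h00 h02 (by rw [hbi] at hβ; linarith) (w 1) (w 0) (w 2) (by linarith)
    rw [hbi]; linarith
  · simp only [Fin.reduceFinMk] at hi hbi
    refine ⟨β 0, fun w hw => ?_⟩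
    have := alg3' hi h00 h01 (by rw [hbi] at hβ; linarith) (w 2) (w 0) (w 1) (by linarith)
    rw [hbi]; linarith

lemma lemU {ν : Measure (E 4)} (h : UM ν) {A : E 4 →L[ℝ] E 4} (hA : ∀ u v, ⟪A u, v⟫ = ⟪u, A v⟫)
    (hq : ∀ x ∈ msupp ν, ⟪A x, x⟫ = 0) {x : E 4} (hx : x ∈ msupp ν) (hv : A x ≠ 0) :
    ∃ c : ℝ, ∀ u, ⟪x, u⟫ = 0 → ⟪A x, u⟫ = 0 → ⟪A u, u⟫ = c * ‖u‖ ^ 2 := by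
  have hw := omega3_pos
  let l : Ultrafilter ℝ := Ultrafilter.of (𝓝[>] 0)
  have hl : (l : Filter ℝ) ≤ 𝓝[>] 0 := Ultrafilter.of_le _
  obtain ⟨ψ, hψ, hC, hF⟩ := lemT h hA hq hx hv l (ρ := fun i => i) hl
  have hpos : ∀ᶠ i : ℝ in 𝓝[>] 0, 0 < i := self_mem_nhdsWithin
  have hau := sc_au (ρ := fun i => i) h hx (hl hpos)
  obtain ⟨hn, j, hj1, hj2, hj3⟩ := hF
  have hvn : ‖A x‖ ≠ 0 := norm_ne_zero_iff.2 hv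
  have h1 : ∀ u, ⟪A x, j u⟫ = 0 := by
    intro u
    have := hj1 u
    rw [inner_smul_left] at this
    exact (mul_eq_zero.1 this).resolve_left (by simpa using hv)
  have h2 : ∀ z, ⟪A x, z⟫ = 0 → ∃ u, j u = z := by
    intro z hz
    exact hj2 z (by rw [inner_smul_left, hz, mul_zero])
  let T : E 3 →ₗ[ℝ] E 3 := (LinearMap.adjoint j.toLinearMap) ∘ₗ (A : E 4 →ₗ[ℝ] E 4) ∘ₗ j.toLinearMap
  have hTi : ∀ u w, ⟪T u, w⟫ = ⟪A (j u), j w⟫ := by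
    intro u w
    simp only [T, LinearMap.comp_apply, LinearMap.adjoint_inner_left]; rfl
  have hTs : T.IsSymmetric := by
    intro u w
    rw [hTi, hA, real_inner_comm, ← hTi, real_inner_comm]
  have h3 : finrank ℝ (E 3) = 3 := by simp
  set t := hTs.eigenvectorBasis h3 with ht
  set β := hTs.eigenvalues h3 with hβ
  have hT : ∀ i, T (t i) = β i • t i := fun i => by
    rw [ht, hβ]; exact hTs.apply_eigenvectorBasis h3 i
  have hTt : ∀ i u, ⟪t i, T u⟫ = β i * ⟪t i, u⟫ := by
    intro i u
    rw [← hTs, hT, inner_smul_left]; simp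
  have hqj : ∀ u, ⟪A (j u), j u⟫ = ∑ i, β i * ⟪t i, u⟫ ^ 2 := by
    intro u
    rw [← hTi, ← t.sum_inner_mul_inner]
    refine Finset.sum_congr rfl fun i _ => ?_
    rw [real_inner_comm, hTt]; ring
  have hH : ∑ i, ⟪A (j (t i)), j (t i)⟫ = ∑ i, β i := by
    refine Finset.sum_congr rfl fun i _ => ?_
    rw [← hTi, hT, inner_smul_left, real_inner_self_eq_norm_sq, t.norm_eq_one]; simp
  have hid : ∀ᶠ R in (l : Filter ℝ), ∫ z in closedBall 0 1, ⟪A z, z⟫ ^ 2 ∂(sc ν x R) =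
      (∑ i, β i) * ∫ z in closedBall 0 1, (1 - ‖z‖ ^ 2) * ⟪A z, z⟫ ∂(sc ν x R) := by
    filter_upwards [hl hpos] with R hR
    rw [← hH]; exact U_id h hA hq hx hv h1 h2 t hR
  have c1 := ball_moment hau hC hψ (g := fun z => ⟪A z, z⟫ ^ 2) (by fun_prop) one_pos
    (tendsto_const_nhds (x := (1:ℝ)))
  have c2 := (ball_moment hau hC hψ (g := fun z => (1 - ‖z‖ ^ 2) * ⟪A z, z⟫) (by fun_prop) one_pos
    (tendsto_const_nhds (x := (1:ℝ)))).const_mul (∑ i, β i)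
  have heq := tendsto_nhds_unique (c1.congr' hid) c2
  rw [hj3, flat_int, flat_int] at heq
  simp only [hqj, j.norm_map] at heq
  rw [e3_quartic, e3_quad] at heq
  have hβ2 : 2 * ∑ i, β i ^ 2 = (∑ i, β i) ^ 2 := by
    have : omega3 / 35 * (2 * ∑ i, β i ^ 2) = omega3 / 35 * (∑ i, β i) ^ 2 := by linarith
    exact mul_left_cancel₀ (by positivity) this
  obtain ⟨c0, hc0⟩ := h2 x (hq x hx)
  have hTc : T c0 = 0 := by
    rw [← inner_self_eq_zero (𝕜 := ℝ), hTi, hc0, h1]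
  have hc0ne : c0 ≠ 0 := by
    rintro rfl
    rw [map_zero] at hc0
    rw [← hc0] at hv; simp at hv
  obtain ⟨c, hc⟩ := alg3 (β := β) (p := fun i => ⟪t i, c0⟫) (fun i => by
    rw [← hTt, hTc, inner_zero_right]) (by
    by_contra hcon
    push Not at hcon
    apply hc0ne
    rw [← t.sum_repr' c0]; simp [hcon]) hβ2
  refine ⟨c, fun u hu1 hu2 => ?_⟩
  obtain ⟨w, rfl⟩ := h2 u hu2
  rw [hqj, hc (fun i => ⟪t i, w⟫), j.norm_map]
  · have h5 := t.sum_sq_norm_inner_right w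
    simp only [Real.norm_eq_abs, sq_abs] at h5
    rw [h5]
  · rw [← hc0, j.inner_map_map, ← t.sum_inner_mul_inner] at hu1
    rw [← hu1]
    refine Finset.sum_congr rfl fun i _ => by rw [real_inner_comm]

lemma algCd {a0 a1 a2 a3 x0 x1 x2 x3 c : ℝ} (h01 : a1 < a0) (h12 : a2 < a1) (h23 : a3 < a2)
    (hx0 : x0 ≠ 0) (hx1 : x1 ≠ 0) (hx2 : x2 ≠ 0) (hx3 : x3 ≠ 0)
    (hU : ∀ y0 y1 y2 y3 : ℝ, x0 * y0 + x1 * y1 + x2 * y2 + x3 * y3 = 0 →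
      a0 * x0 * y0 + a1 * x1 * y1 + a2 * x2 * y2 + a3 * x3 * y3 = 0 →
      (a0 - c) * y0 ^ 2 + (a1 - c) * y1 ^ 2 + (a2 - c) * y2 ^ 2 + (a3 - c) * y3 ^ 2 = 0) :
    False := by
  have pol : ∀ y0 y1 y2 y3 z0 z1 z2 z3 : ℝ, x0 * y0 + x1 * y1 + x2 * y2 + x3 * y3 = 0 →
      a0 * x0 * y0 + a1 * x1 * y1 + a2 * x2 * y2 + a3 * x3 * y3 = 0 →
      x0 * z0 + x1 * z1 + x2 * z2 + x3 * z3 = 0 →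
      a0 * x0 * z0 + a1 * x1 * z1 + a2 * x2 * z2 + a3 * x3 * z3 = 0 →
      (a0 - c) * (y0 * z0) + (a1 - c) * (y1 * z1) + (a2 - c) * (y2 * z2)
        + (a3 - c) * (y3 * z3) = 0 := by
    intro y0 y1 y2 y3 z0 z1 z2 z3 e1 e2 e3 e4
    have f1 := hU _ _ _ _ e1 e2
    have f2 := hU _ _ _ _ e3 e4
    have f3 := hU (y0 + z0) (y1 + z1) (y2 + z2) (y3 + z3) (by linarith) (by linarith)
    linarith
  have s1 := pol 0 ((a2 - a3) * x2 * x3) ((a3 - a1) * x1 * x3) ((a1 - a2) * x1 * x2)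
    ((a1 - a2) * x1 * x2) ((a2 - a0) * x0 * x2) ((a0 - a1) * x0 * x1) 0
    (by ring) (by ring) (by ring) (by ring)
  have s2 := pol 0 ((a2 - a3) * x2 * x3) ((a3 - a1) * x1 * x3) ((a1 - a2) * x1 * x2)
    ((a2 - a3) * x2 * x3) 0 ((a3 - a0) * x0 * x3) ((a0 - a2) * x0 * x2)
    (by ring) (by ring) (by ring) (by ring)
  have t1 : (x0 * x3) * ((a1 - c) * ((a2 - a3) * (a0 - a2) * x2 ^ 2) +
      (a2 - c) * ((a1 - a3) * (a0 - a1) * x1 ^ 2)) = 0 := by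
    rw [← neg_eq_zero, ← s1]; ring
  have t2 : (x0 * x1) * ((a2 - c) * ((a1 - a3) * (a0 - a3) * x3 ^ 2) +
      (a3 - c) * ((a1 - a2) * (a0 - a2) * x2 ^ 2)) = 0 := by
    rw [← s2]; ring
  clear s1 s2 pol hU
  have t1 := (mul_eq_zero.1 t1).resolve_left (mul_ne_zero hx0 hx3)
  have t2 := (mul_eq_zero.1 t2).resolve_left (mul_ne_zero hx0 hx1)
  have d1 : 0 < a0 - a1 := by linarith
  have d2 : 0 < a1 - a2 := by linarith
  have d3 : 0 < a2 - a3 := by linarith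
  have d4 : 0 < a0 - a2 := by linarith
  have d5 : 0 < a1 - a3 := by linarith
  have d6 : 0 < a0 - a3 := by linarith
  have A1 : 0 < (a2 - a3) * (a0 - a2) * x2 ^ 2 := by positivity
  have A2 : 0 < (a1 - a3) * (a0 - a1) * x1 ^ 2 := by positivity
  have A3 : 0 < (a1 - a3) * (a0 - a3) * x3 ^ 2 := by positivity
  have A4 : 0 < (a1 - a2) * (a0 - a2) * x2 ^ 2 := by positivity
  rcases le_or_gt (a2 - c) 0 with h | h
  · have h' : a3 - c < 0 := by linarith
    have u1 := mul_neg_of_neg_of_pos h' A4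
    have u2 := mul_nonpos_of_nonpos_of_nonneg h A3.le
    linarith
  · have h' : 0 < a1 - c := by linarith
    have u1 := mul_pos h' A1
    have u2 := mul_pos h A2
    linarith

lemma algC {a0 a1 a2 a3 x0 x1 x2 x3 c : ℝ} (h01 : a1 ≤ a0) (h12 : a2 ≤ a1) (h23 : a3 ≤ a2)
    (hx0 : x0 ≠ 0) (hx1 : x1 ≠ 0) (hx2 : x2 ≠ 0) (hx3 : x3 ≠ 0)
    (hq : a0 * x0 ^ 2 + a1 * x1 ^ 2 + a2 * x2 ^ 2 + a3 * x3 ^ 2 = 0)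
    (htr : a0 + a1 + a2 + a3 = -1) (htr2 : a0 ^ 2 + a1 ^ 2 + a2 ^ 2 + a3 ^ 2 = 1)
    (hU : ∀ y0 y1 y2 y3 : ℝ, x0 * y0 + x1 * y1 + x2 * y2 + x3 * y3 = 0 →
      a0 * x0 * y0 + a1 * x1 * y1 + a2 * x2 * y2 + a3 * x3 * y3 = 0 →
      (a0 - c) * y0 ^ 2 + (a1 - c) * y1 ^ 2 + (a2 - c) * y2 ^ 2 + (a3 - c) * y3 ^ 2 = 0) :
    a0 ^ 2 = 1 / 4 ∧ a1 ^ 2 = 1 / 4 ∧ a2 ^ 2 = 1 / 4 ∧ a3 ^ 2 = 1 / 4 := by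
  have p0 : 0 < x0 ^ 2 := by positivity
  have p1 : 0 < x1 ^ 2 := by positivity
  have p2 : 0 < x2 ^ 2 := by positivity
  have p3 : 0 < x3 ^ 2 := by positivity
  have triple : ∀ a b : ℝ, 3 * a + b = -1 → 3 * a ^ 2 + b ^ 2 = 1 → a ≠ 0 →
      a ^ 2 = 1 / 4 ∧ b ^ 2 = 1 / 4 := by
    intro a b h1 h2 h3
    have hb : b = -1 - 3 * a := by linarith
    subst hb
    have : a * (a + 1 / 2) = 0 := by nlinarith
    have ha : a = -1 / 2 := by
      have := (mul_eq_zero.1 this).resolve_left h3; linarith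
    subst ha; norm_num
  have c01 : a0 = a1 → c = a0 := by
    intro h
    have := hU x1 (-x0) 0 0 (by ring) (by rw [h]; ring)
    rw [← h] at this
    have h2 : (a0 - c) * (x0 ^ 2 + x1 ^ 2) = 0 := by linarith
    have := (mul_eq_zero.1 h2).resolve_right (by positivity)
    linarith
  have c12 : a1 = a2 → c = a1 := by
    intro h
    have := hU 0 x2 (-x1) 0 (by ring) (by rw [h]; ring)
    rw [← h] at this
    have h2 : (a1 - c) * (x1 ^ 2 + x2 ^ 2) = 0 := by linarith
    have := (mul_eq_zero.1 h2).resolve_right (by positivity)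
    linarith
  have c23 : a2 = a3 → c = a2 := by
    intro h
    have := hU 0 0 x3 (-x2) (by ring) (by rw [h]; ring)
    rw [← h] at this
    have h2 : (a2 - c) * (x2 ^ 2 + x3 ^ 2) = 0 := by linarith
    have := (mul_eq_zero.1 h2).resolve_right (by positivity)
    linarith
  have y123 := hU 0 ((a2 - a3) * x2 * x3) ((a3 - a1) * x1 * x3) ((a1 - a2) * x1 * x2)
    (by ring) (by ring)
  have y012 := hU ((a1 - a2) * x1 * x2) ((a2 - a0) * x0 * x2) ((a0 - a1) * x0 * x1) 0
    (by ring) (by ring)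
  rcases h01.eq_or_lt with e01 | l01 <;> rcases h12.eq_or_lt with e12 | l12 <;>
    rcases h23.eq_or_lt with e23 | l23
  · exfalso
    subst e01; subst e12; subst e23; nlinarith
  · subst e01; subst e12
    have h0 : a2 ≠ 0 := by
      rintro rfl
      nlinarith
    obtain ⟨r1, r2⟩ := triple a2 a3 (by linarith) (by linarith) h0
    exact ⟨r1, r1, r1, r2⟩
  · exfalso
    have := c01 e01.symm; have := c23 e23.symm; linarith
  · exfalso
    have := c01 e01.symm
    subst this
    subst e01
    have h1 : 0 < ((a3 - a1) * x1 * x3) ^ 2 := by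
      have : a3 - a1 < 0 := by linarith
      have := this.ne
      positivity
    nlinarith [sq_nonneg ((a1 - a2) * x1 * x2), mul_pos (sub_pos.2 l12) h1,
      mul_nonneg (sub_nonneg.2 (h23.trans h12)) (sq_nonneg ((a1 - a2) * x1 * x2))]
  · subst e12; subst e23
    have h0 : a3 ≠ 0 := by
      rintro rfl
      nlinarith
    obtain ⟨r1, r2⟩ := triple a3 a0 (by linarith) (by linarith) h0
    exact ⟨r2, r1, r1, r1⟩
  · exfalso
    have := c12 e12.symm
    subst this
    subst e12
    have y013 := hU ((a2 - a3) * x1 * x3) ((a3 - a0) * x0 * x3) 0 ((a0 - a2) * x0 * x1)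
      (by ring) (by ring)
    have hne : (a0 - a2) * (a2 - a3) * x1 ^ 2 ≠ 0 := by
      have := sub_pos.2 l01
      have := sub_pos.2 l23
      positivity
    have h1 : (a0 - a2) * (a2 - a3) * x1 ^ 2 * ((a2 - a3) * x3 ^ 2 - (a0 - a2) * x0 ^ 2) = 0 := by
      linear_combination y013
    have h2 := (mul_eq_zero.1 h1).resolve_left hne
    have h3 : a2 * (x0 ^ 2 + x1 ^ 2 + x2 ^ 2 + x3 ^ 2) = 0 := by linear_combination hq + h2
    have h4 : a2 = 0 := (mul_eq_zero.1 h3).resolve_right (by positivity)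
    subst h4
    have : a0 * a3 = 0 := by nlinarith
    rcases mul_eq_zero.1 this with h | h <;> linarith
  · exfalso
    have := c23 e23.symm
    subst this
    subst e23
    have h1 : 0 < ((a3 - a0) * x0 * x2) ^ 2 := by
      have : a3 - a0 < 0 := by linarith
      have := this.ne
      positivity
    nlinarith [mul_pos (sub_pos.2 l12) h1,
      mul_nonneg (sub_nonneg.2 (h12.trans h01)) (sq_nonneg ((a1 - a3) * x1 * x2))]
  · exact (algCd l01 l12 l23 hx0 hx1 hx2 hx3 hU).elim

lemma generic {ν : Measure (E 4)} (h : UM ν) {A : E 4 →L[ℝ] E 4} (hA : ∀ u v, ⟪A u, v⟫ = ⟪u, A v⟫)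
    (hq : ∀ x ∈ msupp ν, ⟪A x, x⟫ = 0) {x : E 4} (hx : x ∈ msupp ν) (hv : A x ≠ 0)
    (b : OrthonormalBasis (Fin 4) ℝ (E 4)) (a : Fin 4 → ℝ) (hb : ∀ i, A (b i) = a i • b i) :
    ∃ x ∈ msupp ν, A x ≠ 0 ∧ ∀ i, ⟪b i, x⟫ ≠ 0 := by
  have key : ∀ s : Finset (Fin 4), ∃ x ∈ msupp ν, A x ≠ 0 ∧ ∀ i ∈ s, ⟪b i, x⟫ ≠ 0 := by
    intro s
    induction s using Finset.induction_on with
    | empty => exact ⟨x, hx, hv, by simp⟩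
    | insert k s hk ih =>
      obtain ⟨x, hx, hv, hs⟩ := ih
      by_cases hk0 : ⟪b k, x⟫ = 0
      · have hu : ⟪A x, b k⟫ = 0 := by
          rw [hA, hb, inner_smul_right, real_inner_comm, hk0, mul_zero]
        obtain ⟨y, hy1, hy2⟩ := tang h hA hq hx hv hu
        have hpos : ∀ᶠ i : ℝ in 𝓝[>] 0, 0 < i := self_mem_nhdsWithin
        have hz : Tendsto (fun ρ : ℝ => x + ρ • y ρ) (𝓝[>] 0) (𝓝 (x + (0:ℝ) • b k)) :=
          tendsto_const_nhds.add ((tendsto_id.mono_left nhdsWithin_le_nhds).smul hy2)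
        rw [zero_smul, add_zero] at hz
        have e1 : ∀ᶠ ρ in 𝓝[>] (0:ℝ), A (x + ρ • y ρ) ≠ 0 :=
          ((A.continuous.tendsto x).comp hz).eventually_ne hv
        have e2 : ∀ᶠ ρ in 𝓝[>] (0:ℝ), ∀ i ∈ s, ⟪b i, x + ρ • y ρ⟫ ≠ 0 := by
          rw [Filter.eventually_all_finset]
          intro i hi
          exact (tendsto_const_nhds.inner hz).eventually_ne (hs i hi)
        have e3 : ∀ᶠ ρ in 𝓝[>] (0:ℝ), ⟪b k, y ρ⟫ ≠ 0 := by
          refine (tendsto_const_nhds.inner hy2).eventually_ne ?_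
          rw [real_inner_self_eq_norm_sq, b.norm_eq_one]; norm_num
        obtain ⟨ρ, h1, h2, h3, h4, h5⟩ := (hpos.and (hy1.and (e1.and (e2.and e3)))).exists
        refine ⟨x + ρ • y ρ, h2, h3, ?_⟩
        intro i hi
        rcases Finset.mem_insert.1 hi with rfl | hi
        · rw [inner_add_right, hk0, zero_add, inner_smul_right]
          exact mul_ne_zero h1.ne' h5
        · exact h4 i hi
      · refine ⟨x, hx, hv, ?_⟩
        intro i hi
        rcases Finset.mem_insert.1 hi with rfl | hi
        · exact hk0
        · exact hs i hi
  obtain ⟨x, h1, h2, h3⟩ := key Finset.univ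
  exact ⟨x, h1, h2, fun i => h3 i (Finset.mem_univ i)⟩

lemma eig {A : E 4 →L[ℝ] E 4} (hA : ∀ u v, ⟪A u, v⟫ = ⟪u, A v⟫) :
    ∃ (b : OrthonormalBasis (Fin 4) ℝ (E 4)) (a : Fin 4 → ℝ), Antitone a ∧
      ∀ i, A (b i) = a i • b i := by
  have hs : (A : E 4 →ₗ[ℝ] E 4).IsSymmetric := hA
  have h4 : finrank ℝ (E 4) = 4 := by simp
  exact ⟨hs.eigenvectorBasis h4, hs.eigenvalues h4, hs.eigenvalues_antitone h4,
    fun i => hs.apply_eigenvectorBasis h4 i⟩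

lemma lemC {ν : Measure (E 4)} (h : UM ν) {A : E 4 →L[ℝ] E 4} (hA : ∀ u v, ⟪A u, v⟫ = ⟪u, A v⟫)
    (htr : ∀ b : OrthonormalBasis (Fin 4) ℝ (E 4), ∑ i, ⟪A (b i), b i⟫ = -1)
    (htr2 : ∀ b : OrthonormalBasis (Fin 4) ℝ (E 4), ∑ i, ‖A (b i)‖ ^ 2 = 1)
    (hq : ∀ x ∈ msupp ν, ⟪A x, x⟫ = 0) :
    (∀ x ∈ msupp ν, A x = 0) ∨ ∀ x, A (A x) = (1 / 4 : ℝ) • x := by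
  by_contra hcon
  push Not at hcon
  obtain ⟨⟨x', hx', hv'⟩, hcon⟩ := hcon
  obtain ⟨b, a, ha, hb⟩ := eig hA
  obtain ⟨x, hx, hv, hne⟩ := generic h hA hq hx' hv' b a hb
  obtain ⟨c, hc⟩ := lemU h hA hq hx hv
  have hbu : ∀ i u, ⟪b i, A u⟫ = a i * ⟪b i, u⟫ := by
    intro i u
    rw [← hA, hb, inner_smul_left]; simp
  have hqq : ∀ u, ⟪A u, u⟫ = ∑ i, a i * ⟪b i, u⟫ ^ 2 := by
    intro u
    rw [← b.sum_inner_mul_inner]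
    refine Finset.sum_congr rfl fun i _ => ?_
    rw [real_inner_comm, hbu]; ring
  have t1 := htr b
  have t2 := htr2 b
  simp only [hb, inner_smul_left, norm_smul, b.norm_eq_one, real_inner_self_eq_norm_sq] at t1 t2
  simp only [Fin.sum_univ_four] at t1 t2
  simp at t1 t2
  have hqx := hq x hx
  rw [hqq] at hqx
  simp only [Fin.sum_univ_four] at hqx
  obtain ⟨r0, r1, r2, r3⟩ := algC (c := c) (ha (show (0 : Fin 4) ≤ 1 by decide))
    (ha (show (1 : Fin 4) ≤ 2 by decide)) (ha (show (2 : Fin 4) ≤ 3 by decide))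
    (hne 0) (hne 1) (hne 2) (hne 3) hqx t1 t2 (by
      intro y0 y1 y2 y3 h1 h2
      let y : Fin 4 → ℝ := ![y0, y1, y2, y3]
      let u : E 4 := ∑ i, y i • b i
      have hu : ∀ i, ⟪b i, u⟫ = y i := fun i => b.orthonormal.inner_right_fintype y i
      have h3 := hc u (by
        rw [← b.sum_inner_mul_inner]
        simp only [hu, Fin.sum_univ_four, real_inner_comm (b _) x]
        exact h1) (by
        rw [← b.sum_inner_mul_inner]
        simp only [hu, Fin.sum_univ_four, real_inner_comm (A x)]
        simp only [real_inner_comm (b _) (A x), hbu]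
        exact h2)
      have hn := b.sum_sq_norm_inner_right u
      simp only [Real.norm_eq_abs, sq_abs] at hn
      rw [hqq, ← hn] at h3
      simp only [hu, Fin.sum_univ_four] at h3
      simp only [y, Matrix.cons_val] at h3
      linarith)
  obtain ⟨z, hz⟩ := hcon
  apply hz
  apply b.repr.injective
  ext i
  simp only [b.repr_apply_apply, hbu, inner_smul_right]
  have : a i ^ 2 = 1 / 4 := by fin_cases i <;> assumption
  rw [← this]; ring

/-- `S` is contained in no hyperplane through `0`. -/
def Spn (S : Set (E 4)) : Prop := ∀ e : E 4, ‖e‖ = 1 → ∃ w ∈ S, ⟪e, w⟫ ≠ 0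

lemma Spn.zero {S : Set (E 4)} (h : Spn S) {v : E 4} (hv : ∀ w ∈ S, ⟪v, w⟫ = 0) : v = 0 := by
  by_contra hne
  have hn : ‖v‖ ≠ 0 := norm_ne_zero_iff.2 hne
  obtain ⟨w, hw, h1⟩ := h (‖v‖⁻¹ • v) (by rw [norm_smul, norm_inv, norm_norm, inv_mul_cancel₀ hn])
  apply h1
  rw [inner_smul_left, hv w hw, mul_zero]

lemma Spn.op {S : Set (E 4)} (h : Spn S) {A : E 4 →L[ℝ] E 4} (hA : ∀ u v, ⟪A u, v⟫ = ⟪u, A v⟫)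
    (hv : ∀ w ∈ S, A w = 0) (u : E 4) : A u = 0 := by
  apply h.zero
  intro w hw
  rw [hA, hv w hw, inner_zero_right]

lemma blow {κ : Measure (E 4)} (h : UM κ) {ι : Type} {l : Filter ι} [l.NeBot] {s : ι → ℝ}
    (hs : Tendsto s l (𝓝[>] 0)) {Y : ι → E 4} {w : E 4} (hY : Tendsto Y l (𝓝 w))
    (hm : ∀ᶠ i in l, s i • Y i ∈ msupp κ) :
    ⟪bv κ, w⟫ = 0 ∧ (bv κ = 0 → ⟪Aop κ 1 w, w⟫ = 0) := by
  have := h.lf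
  have hpos : ∀ᶠ i in l, 0 < s i := hs.eventually self_mem_nhdsWithin
  have hs0 : Tendsto s l (𝓝 0) := hs.mono_right nhdsWithin_le_nhds
  have h0 : Tendsto (fun i => s i • Y i) l (𝓝 ((0:ℝ) • w)) := hs0.smul hY
  rw [zero_smul] at h0
  have h1 : ∀ᶠ i in l, ‖s i • Y i‖ ≤ 1 / 10 := by
    have := h0.norm
    rw [norm_zero] at this
    filter_upwards [this.eventually (gt_mem_nhds (show (0:ℝ) < 1 / 10 by norm_num))] with i hi
    exact hi.le
  have key : ∀ᶠ i in l, |⟪bv κ, Y i⟫ + s i * ⟪Aop κ 1 (Y i), Y i⟫| ≤ 2000 * s i ^ 2 * ‖Y i‖ ^ 3 := by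
    filter_upwards [hpos, hm, h1] with i p1 p2 p3
    have e := expansion h p2 p3
    have e2 : ⟪bv κ, s i • Y i⟫ + qmom κ 1 (s i • Y i) (s i • Y i) - ‖s i • Y i‖ ^ 2 =
        s i * (⟪bv κ, Y i⟫ + s i * ⟪Aop κ 1 (Y i), Y i⟫) := by
      rw [add_sub_assoc, ← real_inner_self_eq_norm_sq, ← Aop_inner, map_smul, inner_smul_right,
        inner_smul_right, inner_smul_left]
      simp; ring
    rw [e2, abs_mul, abs_of_pos p1, norm_smul, Real.norm_eq_abs, abs_of_pos p1] at e
    have : s i * |⟪bv κ, Y i⟫ + s i * ⟪Aop κ 1 (Y i), Y i⟫| ≤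
        s i * (2000 * s i ^ 2 * ‖Y i‖ ^ 3) := by
      refine e.trans (le_of_eq (by ring))
    exact le_of_mul_le_mul_left this p1
  have tA : Tendsto (fun i => ⟪Aop κ 1 (Y i), Y i⟫) l (𝓝 ⟪Aop κ 1 w, w⟫) :=
    (((Aop κ 1).continuous.tendsto w).comp hY).inner hY
  constructor
  · have t1 := ((tendsto_const_nhds (x := bv κ)).inner hY (𝕜 := ℝ)).add (hs0.mul tA)
    have t2 : Tendsto (fun i => 2000 * s i ^ 2 * ‖Y i‖ ^ 3) l (𝓝 (2000 * 0 ^ 2 * ‖w‖ ^ 3)) :=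
      ((hs0.pow 2).const_mul _).mul (hY.norm.pow 3)
    have := le_of_tendsto_of_tendsto t1.abs t2 key
    simp at this
    exact this
  · intro hb
    have t2 : Tendsto (fun i => 2000 * s i * ‖Y i‖ ^ 3) l (𝓝 (2000 * 0 * ‖w‖ ^ 3)) :=
      (hs0.const_mul _).mul (hY.norm.pow 3)
    have := le_of_tendsto_of_tendsto tA.abs t2 (by
      filter_upwards [key, hpos] with i k p
      rw [hb, inner_zero_left, zero_add, abs_mul, abs_of_pos p] at k
      refine le_of_mul_le_mul_left (k.trans (le_of_eq ?_)) p
      ring)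
    simp at this
    exact this

lemma par {ψ : Measure (E 4)} (h : UM ψ) {A A' : E 4 →L[ℝ] E 4}
    (hA : ∀ u v, ⟪A u, v⟫ = ⟪u, A v⟫) (hA' : ∀ u v, ⟪A' u, v⟫ = ⟪u, A' v⟫)
    (hq : ∀ x ∈ msupp ψ, ⟪A x, x⟫ = 0) (hq' : ∀ x ∈ msupp ψ, ⟪A' x, x⟫ = 0)
    {x : E 4} (hx : x ∈ msupp ψ) (hv : A x ≠ 0) : ∃ c : ℝ, A' x = c • A x := by
  have key : ∀ u, ⟪A x, u⟫ = 0 → ⟪A' x, u⟫ = 0 := by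
    intro u hu
    obtain ⟨y, hy1, hy2⟩ := tang h hA hq hx hv hu
    have hpos : ∀ᶠ i : ℝ in 𝓝[>] 0, 0 < i := self_mem_nhdsWithin
    have hs : Tendsto (fun s : ℝ => s) (𝓝[>] 0) (𝓝 0) := tendsto_id.mono_left nhdsWithin_le_nhds
    have t1 : Tendsto (fun ρ => 2 * ⟪A' x, y ρ⟫ + ρ * ⟪A' (y ρ), y ρ⟫) (𝓝[>] 0)
        (𝓝 (2 * ⟪A' x, u⟫ + 0 * ⟪A' u, u⟫)) :=
      ((tendsto_const_nhds.inner hy2).const_mul 2).add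
        (hs.mul (((A'.continuous.tendsto u).comp hy2).inner hy2))
    have t2 : Tendsto (fun ρ => 2 * ⟪A' x, y ρ⟫ + ρ * ⟪A' (y ρ), y ρ⟫) (𝓝[>] 0) (𝓝 0) := by
      refine tendsto_const_nhds.congr' ?_
      filter_upwards [hpos, hy1] with ρ p1 p2
      have := hq' _ p2
      rw [quad_exp hA', hq' x hx, zero_add] at this
      exact ((mul_eq_zero.1 this).resolve_left p1.ne').symm
    have := tendsto_nhds_unique t1 t2
    linarith
  have hn : ‖A x‖ ^ 2 ≠ 0 := by have := norm_ne_zero_iff.2 hv; positivity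
  set c := ⟪A x, A' x⟫ / ‖A x‖ ^ 2 with hc
  refine ⟨c, ?_⟩
  have h0 : ⟪A x, A' x - c • A x⟫ = 0 := by
    rw [inner_sub_right, inner_smul_right, real_inner_self_eq_norm_sq, hc]; field_simp; simp
  have h1 := key _ h0
  have h2 : ⟪A' x - c • A x, A' x - c • A x⟫ = 0 := by
    rw [inner_sub_left, inner_smul_left, h0, h1]; simp
  exact sub_eq_zero.1 (inner_self_eq_zero.1 h2)

lemma uniqA {ψ : Measure (E 4)} (h : UM ψ) (hsp : Spn (msupp ψ)) {A A' : E 4 →L[ℝ] E 4}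
    (hA : ∀ u v, ⟪A u, v⟫ = ⟪u, A v⟫) (hA' : ∀ u v, ⟪A' u, v⟫ = ⟪u, A' v⟫)
    (hq : ∀ x ∈ msupp ψ, ⟪A x, x⟫ = 0) (hq' : ∀ x ∈ msupp ψ, ⟪A' x, x⟫ = 0)
    (hA2 : ∀ x, A (A x) = (1 / 4 : ℝ) • x) : ∃ c : ℝ, ∀ x, A' x = c • A x := by
  have inj : ∀ x, x ≠ 0 → A x ≠ 0 := by
    intro x hx h0
    have := hA2 x
    rw [h0, map_zero] at this
    exact hx ((smul_eq_zero.1 this.symm).resolve_left (by norm_num))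
  obtain ⟨x, hx, hx1⟩ := hsp (ob 0) (ob.norm_eq_one 0)
  have hx0 : x ≠ 0 := by rintro rfl; simp at hx1
  obtain ⟨c, hc⟩ := par h hA hA' hq hq' hx (inj x hx0)
  refine ⟨c, ?_⟩
  let B : E 4 →L[ℝ] E 4 := A' - c • A
  have hB : ∀ u, B u = A' u - c • A u := fun u => rfl
  have hBs : ∀ u v, ⟪B u, v⟫ = ⟪u, B v⟫ := by
    intro u v
    simp only [hB, inner_sub_left, inner_sub_right, inner_smul_left, inner_smul_right, hA, hA']
    simp
  have b1 : ∀ z ∈ msupp ψ, ⟪A x, z⟫ ≠ 0 → B z = 0 := by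
    intro z hz hne
    have hz0 : z ≠ 0 := by rintro rfl; simp at hne
    obtain ⟨d, hd⟩ := par h hA hA' hq hq' hz (inj z hz0)
    have e1 : ⟪A' x, z⟫ = ⟪x, A' z⟫ := hA' x z
    rw [hc, hd, inner_smul_left, inner_smul_right, ← hA] at e1
    have : c = d := mul_right_cancel₀ hne (by simpa using e1)
    rw [hB, hd, this, sub_self]
  have b2 : ∀ z ∈ msupp ψ, B z = 0 := by
    intro z hz
    by_cases hne : ⟪A x, z⟫ = 0
    swap
    · exact b1 z hz hne
    by_cases hz0 : z = 0
    · rw [hz0, map_zero]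
    have hAz := inj z hz0
    have hn : ‖A z‖ ^ 2 ≠ 0 := by have := norm_ne_zero_iff.2 hAz; positivity
    set t := ⟪A z, A x⟫ / ‖A z‖ ^ 2 with ht
    set u := A x - t • A z with hu
    have h0 : ⟪A z, u⟫ = 0 := by
      rw [hu, inner_sub_right, inner_smul_right, real_inner_self_eq_norm_sq, ht]; field_simp; simp
    by_cases hxu : ⟪A x, u⟫ = 0
    · have h2 : ⟪u, u⟫ = 0 := by
        nth_rewrite 1 [hu]
        rw [inner_sub_left, inner_smul_left, h0, hxu]; simp
      have h3 : A x = t • A z := sub_eq_zero.1 (inner_self_eq_zero.1 h2)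
      have h4 : x = t • z := by
        have := congrArg A h3
        rw [map_smul, hA2, hA2, smul_comm] at this
        exact smul_right_injective _ (show (1/4:ℝ) ≠ 0 by norm_num) this
      have ht0 : t ≠ 0 := by rintro h; rw [h, zero_smul] at h4; exact hx0 h4
      have h5 : B x = 0 := by rw [hB, hc, sub_self]
      rw [h4, map_smul] at h5
      exact (smul_eq_zero.1 h5).resolve_left ht0
    · obtain ⟨y, hy1, hy2⟩ := tang h hA hq hz hAz h0
      have hpos : ∀ᶠ i : ℝ in 𝓝[>] 0, 0 < i := self_mem_nhdsWithin
      have hzt : Tendsto (fun ρ : ℝ => z + ρ • y ρ) (𝓝[>] 0) (𝓝 (z + (0:ℝ) • u)) :=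
        tendsto_const_nhds.add ((tendsto_id.mono_left nhdsWithin_le_nhds).smul hy2)
      rw [zero_smul, add_zero] at hzt
      have e3 : ∀ᶠ ρ in 𝓝[>] (0:ℝ), ⟪A x, y ρ⟫ ≠ 0 :=
        (tendsto_const_nhds.inner hy2).eventually_ne hxu
      refine tendsto_nhds_unique ((B.continuous.tendsto z).comp hzt)
        (tendsto_const_nhds.congr' ?_)
      filter_upwards [hpos, hy1, e3] with ρ p1 p2 p3
      refine (b1 _ p2 ?_).symm
      rw [inner_add_right, hne, zero_add, inner_smul_right]
      exact mul_ne_zero p1.ne' p3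
  intro u
  exact sub_eq_zero.1 (hsp.op hBs b2 u)

lemma lem3 {ν ψ : Measure (E 4)} (h : UM ν) (hψ : UM ψ) (l : Ultrafilter ℝ)
    (hl : (l : Filter ℝ) ≤ 𝓝[>] 0) (hC : Conv l (fun ρ => sc ν 0 ρ) ψ) (hsp : Spn (msupp ψ)) :
    ∀ x, Aop ν 1 (Aop ν 1 x) = (1 / 4 : ℝ) • x := by
  have := h.lf
  have := hψ.lf
  have hpos : ∀ᶠ i : ℝ in (l : Filter ℝ), 0 < i := hl self_mem_nhdsWithin
  have hau := sc_au (ρ := fun i => i) h h.z hpos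
  have main : ∀ R : ℝ, 0 < R → ∀ w ∈ msupp ψ, ⟪Aop ν R w, w⟫ = 0 := by
    intro R hR
    have hs : Tendsto (fun ρ : ℝ => ρ / R) l (𝓝[>] 0) := by
      refine tendsto_nhdsWithin_iff.2 ⟨?_, ?_⟩
      · have : Tendsto (fun ρ : ℝ => ρ / R) (𝓝 0) (𝓝 (0 / R)) := tendsto_id.div_const R
        rw [zero_div] at this
        exact this.mono_left (hl.trans nhdsWithin_le_nhds)
      · filter_upwards [hpos] with ρ hρ
        exact div_pos hρ hR
    have hb : ∀ w ∈ msupp ψ, ⟪bv (sc ν 0 R), w⟫ = 0 ∧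
        (bv (sc ν 0 R) = 0 → ⟪Aop (sc ν 0 R) 1 w, w⟫ = 0) := by
      intro w hw
      refine blow (sc_um h h.z hR) hs (nrst_tendsto hau hC hw) ?_
      filter_upwards [hpos, nrst_mem hau w] with ρ hρ hm
      rw [sc_supp ν 0 hR]
      rw [sc_supp ν 0 hρ] at hm
      convert hm using 2
      rw [smul_smul, mul_div_cancel₀ _ hR.ne']
    have hb0 := hsp.zero fun w hw => (hb w hw).1
    intro w hw
    have := (hb w hw).2 hb0
    rwa [Aop_sc ν hR one_pos, mul_one] at this
  have hq : ∀ w ∈ msupp ψ, ⟪Aop ψ 1 w, w⟫ = 0 := by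
    intro w hw
    have t := Aop_tendsto hau hC hψ one_pos (tendsto_const_nhds (x := (1:ℝ)))
    have t2 : Tendsto (fun i => ⟪Aop (sc ν 0 i) 1 w, w⟫) l (𝓝 ⟪Aop ψ 1 w, w⟫) :=
      (((ContinuousLinearMap.apply ℝ (E 4) w).continuous.tendsto _).comp t).inner tendsto_const_nhds
    refine tendsto_nhds_unique t2 (tendsto_const_nhds.congr' ?_)
    filter_upwards [hpos] with ρ hρ
    rw [Aop_sc ν hρ one_pos, mul_one, main ρ hρ w hw]
  have hA2 : ∀ x, Aop ψ 1 (Aop ψ 1 x) = (1 / 4 : ℝ) • x := by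
    refine (lemC hψ (Aop_symm ψ 1) (Aop_tr hψ) (Aop_tr2 hψ hq) hq).resolve_left fun h0 => ?_
    have := Aop_tr hψ ob
    simp [hsp.op (Aop_symm ψ 1) h0] at this
  obtain ⟨c, hc⟩ := uniqA hψ hsp (Aop_symm ψ 1) (Aop_symm ν 1) hq (main 1 one_pos) hA2
  have hc1 : c = 1 := by
    have t1 := Aop_tr h ob
    have t2 := Aop_tr hψ ob
    simp only [hc, inner_smul_left, ← Finset.mul_sum, t2] at t1
    simp at t1
    linarith
  intro x
  rw [hc, hc, hc1, one_smul, one_smul, hA2]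

def fA (A : E 4 →L[ℝ] E 4) : ℝ := ∑ i, ‖A (A (ob i)) - (1 / 4 : ℝ) • ob i‖ ^ 2

lemma fA_cont : Continuous fA := by
  unfold fA
  refine continuous_finset_sum _ fun i _ => ?_
  have h1 : Continuous fun A : E 4 →L[ℝ] E 4 => A (A (ob i)) :=
    continuous_id.clm_apply (continuous_id.clm_apply continuous_const)
  exact ((h1.sub continuous_const).norm).pow 2

lemma fA_kp {A : E 4 →L[ℝ] E 4} (h : ∀ x, A (A x) = (1 / 4 : ℝ) • x) : fA A = 0 := by
  simp [fA, h]

lemma flat_in {ν : Measure (E 4)} {e : E 4} (h : FlatM ν e) {x : E 4} (hx : x ∈ msupp ν) :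
    ⟪e, x⟫ = 0 := by
  obtain ⟨he, j, h1, h2, rfl⟩ := h
  have hc : IsClosed {x : E 4 | ⟪e, x⟫ = 0} := isClosed_eq (by fun_prop) continuous_const
  refine msupp_sub hc ?_ hx
  rw [Measure.map_apply j.continuous.measurable hc.measurableSet.compl]
  have : (j ⁻¹' {x : E 4 | ⟪e, x⟫ = 0}ᶜ) = ∅ := by
    ext u; simp [h1]
  rw [this]; simp

lemma flat_A {ν : Measure (E 4)} (h : UM ν) {e : E 4} (hF : FlatM ν e) (x : E 4) :
    Aop ν 1 x = -(⟪e, x⟫ • e) := by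
  have := h.lf
  have he := hF.1
  have hee : ⟪e, e⟫ = 1 := by rw [real_inner_self_eq_norm_sq, he]; norm_num
  have hAe : Aop ν 1 e = -e := by
    apply ext_inner_right ℝ
    intro v
    have hz : ∀ᵐ z ∂(ν.restrict (closedBall 0 1)), ⟪e, z⟫ * ⟪v, z⟫ = 0 := by
      filter_upwards [ae_restrict_of_ae (ae_msupp ν)] with z hz
      rw [flat_in hF hz, zero_mul]
    rw [Aop_inner, qmom, integral_congr_ae hz]; simp
  have hb : ∀ u, ⟪e, u⟫ = 0 → ⟪bv ν, u⟫ = 0 := by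
    intro u hu
    refine curve2 h (Y := fun _ => u) (Eventually.of_forall fun s => ?_) tendsto_const_nhds
    exact flat_supp hF (by rw [inner_smul_right, hu, mul_zero])
  have hA : ∀ u, ⟪e, u⟫ = 0 → ⟪Aop ν 1 u, u⟫ = 0 := by
    intro u hu
    have := curve3 h (Y := fun _ => u) (u := u) (g := fun _ => 0) (g0 := 0)
      (Eventually.of_forall fun s => ?_) tendsto_const_nhds
      (Eventually.of_forall fun s => by rw [hb u hu, mul_zero]) tendsto_const_nhds
    · linarith
    · exact flat_supp hF (by rw [inner_smul_right, hu, mul_zero])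
  have hA0 : ∀ u, ⟪e, u⟫ = 0 → Aop ν 1 u = 0 := by
    intro u hu
    apply ext_inner_right ℝ
    intro v
    rw [inner_zero_left]
    set w := v - ⟪e, v⟫ • e with hw
    have hw0 : ⟪e, w⟫ = 0 := by rw [hw, inner_sub_right, inner_smul_right, hee]; ring
    have hv : v = w + ⟪e, v⟫ • e := by rw [hw]; abel
    have h1 : ⟪Aop ν 1 u, e⟫ = 0 := by
      rw [Aop_symm, hAe, inner_neg_right, real_inner_comm, hu, neg_zero]
    have h2 : ⟪Aop ν 1 u, w⟫ = 0 := by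
      have := hA (u + (1:ℝ) • w) (by rw [inner_add_right, inner_smul_right, hu, hw0]; simp)
      rw [quad_exp (Aop_symm ν 1), hA u hu, hA w hw0] at this
      linarith
    rw [hv, inner_add_right, inner_smul_right, h1, h2]; simp
  have hx : x = (x - ⟪e, x⟫ • e) + ⟪e, x⟫ • e := by abel
  have h0 := hA0 (x - ⟪e, x⟫ • e) (by rw [inner_sub_right, inner_smul_right, hee]; ring)
  conv_lhs => rw [hx]
  rw [map_add, h0, zero_add, map_smul, hAe, smul_neg]

lemma fA_flat {ν : Measure (E 4)} (h : UM ν) {e : E 4} (hF : FlatM ν e) :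
    fA (Aop ν 1) = 3 / 4 := by
  have he := hF.1
  have hee : ⟪e, e⟫ = 1 := by rw [real_inner_self_eq_norm_sq, he]; norm_num
  have h1 : ∀ i, ‖Aop ν 1 (Aop ν 1 (ob i)) - (1 / 4 : ℝ) • ob i‖ ^ 2 =
      (1 / 2) * ‖⟪e, ob i⟫‖ ^ 2 + 1 / 16 := by
    intro i
    rw [flat_A h hF (ob i), map_neg, map_smul, flat_A h hF e, hee, one_smul, smul_neg, neg_neg,
      norm_sub_sq_real, inner_smul_left, inner_smul_right, norm_smul, norm_smul, he,
      ob.norm_eq_one]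
    simp; ring
  unfold fA
  simp only [h1, Finset.sum_add_distrib, ← Finset.mul_sum]
  have := ob.sum_sq_norm_inner_left e
  rw [this, he]; norm_num

lemma exists_e {ν : Measure (E 4)} (h : ¬ Spn (msupp ν)) :
    ∃ e : E 4, ‖e‖ = 1 ∧ ∀ x ∈ msupp ν, ⟪e, x⟫ = 0 := by
  unfold Spn at h; push Not at h; exact h

lemma flat_of_nspn {ν : Measure (E 4)} (hν : UM ν) (h : ¬ Spn (msupp ν)) : ∃ e, FlatM ν e := by
  have := hν.lf
  obtain ⟨e, he, h1⟩ := exists_e h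
  exact ⟨e, lemL ν he one_pos hν.z h1 (fun x hx r hr _ => hν.u x hx r hr)⟩

/-- two-plane exclusion -/
lemma two_planes {ν : Measure (E 4)} (hν : UM ν) {e : E 4} (he : ‖e‖ = 1) {β : ℝ} (hβ : β ≠ 0)
    (hs : ∀ y ∈ msupp ν, ⟪e, y⟫ = 0 ∨ ⟪e, y⟫ = β) : ∀ y ∈ msupp ν, ⟪e, y⟫ = 0 := by
  have := hν.lf
  have hb : 0 < |β| := abs_pos.2 hβ
  have hc : IsClosed {x : E 4 | ⟪e, x⟫ = 0} := isClosed_eq (by fun_prop) continuous_const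
  set H := {x : E 4 | ⟪e, x⟫ = 0} with hH
  set ν0 := ν.restrict H with hν0
  have hle : ν0 ≤ ν := Measure.restrict_le_self
  have : IsLocallyFiniteMeasure ν0 := by rw [hν0]; infer_instance
  have close : ∀ x y : E 4, |⟪e, y⟫ - ⟪e, x⟫| ≤ dist y x := by
    intro x y
    rw [← inner_sub_right, dist_eq_norm]
    have := abs_real_inner_le_norm e (y - x)
    rwa [he, one_mul] at this
  have ball_eq : ∀ x, ⟪e, x⟫ = 0 → ∀ r, r < |β| → ν0 (closedBall x r) = ν (closedBall x r) := by
    intro x hx r hr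
    rw [hν0, Measure.restrict_apply measurableSet_closedBall]
    apply measure_congr
    filter_upwards [ae_msupp ν] with y hy
    apply propext
    constructor
    · exact fun h => h.1
    · intro h
      refine ⟨h, ?_⟩
      rcases hs y hy with h0 | h0
      · exact h0
      · exfalso
        have h1 := close x y
        rw [hx, h0, sub_zero] at h1
        have : dist y x ≤ r := h
        linarith
  have sub1 : ∀ x ∈ msupp ν0, x ∈ msupp ν := fun x hx r hr => (hx r hr).trans_le (hle _)
  have sub2 : ∀ x ∈ msupp ν0, ⟪e, x⟫ = 0 := by
    intro x hx
    refine msupp_sub hc ?_ hx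
    rw [hν0, Measure.restrict_apply hc.measurableSet.compl]
    simp
  have hF : FlatM ν0 e := by
    refine lemL ν0 he hb ?_ sub2 ?_
    · intro r hr
      have hm : 0 < min r (|β| / 2) := by positivity
      refine lt_of_lt_of_le ?_ (measure_mono (closedBall_subset_closedBall (min_le_left r (|β|/2))))
      rw [ball_eq 0 (by simp) _ (by have := min_le_right r (|β|/2); linarith)]
      exact hν.z _ hm
    · intro x hx r hr hr2
      rw [ball_eq x (sub2 x hx) r hr2, hν.u x (sub1 x hx) r hr]
  intro x hx
  by_contra hne
  have hxb : ⟪e, x⟫ = β := (hs x hx).resolve_left hne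
  set R := ‖x‖ + |β| with hR
  have hR0 : 0 < R := by positivity
  have e1 : ν0 (closedBall 0 R) = ν (closedBall 0 R) := by
    rw [hν.u 0 hν.z R hR0]
    obtain ⟨-, j, h1, h2, h3⟩ := hF
    rw [h3, Measure.map_apply j.continuous.measurable measurableSet_closedBall]
    have : (j ⁻¹' closedBall 0 R) = closedBall 0 R := by
      ext u; simp
    rw [this, vol_ball3 _ _ hR0.le]
  have e2 : ν0 (closedBall 0 R) + ν (closedBall x (|β| / 2)) ≤ ν (closedBall 0 R) := by
    rw [hν0, Measure.restrict_apply measurableSet_closedBall, ← measure_union ?_ measurableSet_closedBall]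
    · apply measure_mono
      apply union_subset inter_subset_left
      apply closedBall_subset_closedBall'
      rw [dist_zero_right]; linarith
    · rw [Set.disjoint_left]
      rintro y ⟨-, hy⟩ hy2
      have h1 := close x y
      have h3 : ⟪e, y⟫ = 0 := hy
      rw [h3, hxb, zero_sub, abs_neg] at h1
      have : dist y x ≤ |β| / 2 := hy2
      linarith
  rw [e1] at e2
  have hfin : ν (closedBall 0 R) ≠ ⊤ := measure_closedBall_lt_top.ne
  have hp := hx (|β| / 2) (by positivity)
  have := ENNReal.lt_add_right hfin hp.ne'
  exact absurd e2 (not_le.2 this)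

lemma lin_lim {ι : Type} {l : Filter ι} {β : ι → E 4} {S : Set (E 4)} (hS : Spn S)
    (h : ∀ y ∈ S, ∃ c, Tendsto (fun i => ⟪β i, y⟫) l (𝓝 c)) : ∃ b, Tendsto β l (𝓝 b) := by
  let V : Submodule ℝ (E 4) :=
    { carrier := {y | ∃ c, Tendsto (fun i => ⟪β i, y⟫) l (𝓝 c)}
      add_mem' := by
        rintro x y ⟨c, hc⟩ ⟨d, hd⟩
        exact ⟨c + d, (hc.add hd).congr fun i => (inner_add_right _ _ _).symm⟩
      zero_mem' := ⟨0, by simpa using tendsto_const_nhds⟩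
      smul_mem' := by
        rintro t x ⟨c, hc⟩
        exact ⟨t * c, (hc.const_mul t).congr fun i => (inner_smul_right _ _ _).symm⟩ }
  have hV : V = ⊤ := by
    rw [← Submodule.orthogonal_eq_bot_iff, Submodule.eq_bot_iff]
    intro v hv
    apply hS.zero
    intro w hw
    rw [real_inner_comm]
    exact (Submodule.mem_orthogonal V v).1 hv w (h w hw)
  have hall : ∀ i, ∃ c, Tendsto (fun k => ⟪β k, ob i⟫) l (𝓝 c) := by
    intro i
    have : ob i ∈ V := by rw [hV]; trivial
    exact this
  choose c hc using hall
  refine ⟨∑ i, c i • ob i, ?_⟩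
  have : Tendsto (fun k => ∑ i, ⟪β k, ob i⟫ • ob i) l (𝓝 (∑ i, c i • ob i)) :=
    tendsto_finset_sum _ fun i _ => (hc i).smul_const _
  refine this.congr fun k => ?_
  conv_rhs => rw [← ob.sum_repr' (β k)]
  refine Finset.sum_congr rfl fun i _ => ?_
  rw [real_inner_comm]

lemma lem4 {ν : Measure (E 4)} (h : UM ν) (hf : ∀ R : ℝ, 2 ≤ R → 1 / 2 ≤ fA (Aop ν R)) :
    ∃ e, FlatM ν e := by
  have := h.lf
  apply flat_of_nspn h
  intro hsp
  let l : Ultrafilter ℝ := Ultrafilter.of atTop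
  have hl : (l : Filter ℝ) ≤ atTop := Ultrafilter.of_le _
  have hpos : ∀ᶠ i : ℝ in (l : Filter ℝ), 0 < i := hl (eventually_gt_atTop 0)
  have hinv : Tendsto (fun R : ℝ => R⁻¹) l (𝓝 0) := tendsto_inv_atTop_zero.mono_left hl
  have hau := sc_au (ρ := fun i => i) h h.z hpos
  obtain ⟨ψ, hψ, hC⟩ := lim_exists l hau
  have := hψ.lf
  have tA := Aop_tendsto hau hC hψ one_pos (tendsto_const_nhds (x := (1:ℝ)))
  have tAq : ∀ w, Tendsto (fun i => ⟪Aop (sc ν 0 i) 1 w, w⟫) l (𝓝 ⟪Aop ψ 1 w, w⟫) := fun w =>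
    (((ContinuousLinearMap.apply ℝ (E 4) w).continuous.tendsto _).comp tA).inner tendsto_const_nhds
  set A := Aop ψ 1 with hAdef
  have hAs : ∀ u v, ⟪A u, v⟫ = ⟪u, A v⟫ := Aop_symm ψ 1
  -- convergence of first moments
  have t1 : ∀ y ∈ msupp ν, Tendsto (fun R : ℝ => ⟪R • bv (sc ν 0 R), y⟫) l (𝓝 (-⟪A y, y⟫)) := by
    intro y hy
    have hd : Tendsto (fun R : ℝ => ⟪R • bv (sc ν 0 R), y⟫ + ⟪Aop (sc ν 0 R) 1 y, y⟫) l (𝓝 0) := by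
      have tb : Tendsto (fun R : ℝ => 2000 * ‖y‖ ^ 3 * R⁻¹) l (𝓝 0) := by
        simpa using hinv.const_mul (2000 * ‖y‖ ^ 3)
      refine squeeze_zero_norm' ?_ tb
      have hsm : ∀ᶠ R : ℝ in l, ‖R⁻¹ • y‖ ≤ 1 / 10 := by
        have : Tendsto (fun R : ℝ => ‖R⁻¹ • y‖) l (𝓝 ‖(0:ℝ) • y‖) := (hinv.smul_const y).norm
        rw [zero_smul, norm_zero] at this
        filter_upwards [this.eventually (gt_mem_nhds (show (0:ℝ) < 1 / 10 by norm_num))] with i hi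
        exact hi.le
      filter_upwards [hpos, hsm] with R hR hs
      have hum := sc_um h h.z hR
      have := hum.lf
      have hmem : R⁻¹ • y ∈ msupp (sc ν 0 R) := by
        rw [sc_supp ν 0 hR, smul_smul, mul_inv_cancel₀ hR.ne', one_smul, zero_add]; exact hy
      have e := expansion hum hmem hs
      rw [add_sub_assoc, ← real_inner_self_eq_norm_sq, ← Aop_inner, map_smul, inner_smul_right,
        inner_smul_right, inner_smul_left, norm_smul, norm_inv, Real.norm_eq_abs, abs_of_pos hR] at e
      simp only [conj_trivial] at e
      rw [Real.norm_eq_abs, inner_smul_left]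
      simp only [conj_trivial]
      have e2 : R⁻¹ * ⟪bv (sc ν 0 R), y⟫ + R⁻¹ * (R⁻¹ * ⟪Aop (sc ν 0 R) 1 y, y⟫) =
          R⁻¹ ^ 2 * (R * ⟪bv (sc ν 0 R), y⟫ + ⟪Aop (sc ν 0 R) 1 y, y⟫) := by
        field_simp
      have hp2 : 0 < R⁻¹ ^ 2 := by positivity
      rw [e2, abs_mul, abs_of_pos hp2] at e
      refine le_of_mul_le_mul_left (e.trans (le_of_eq ?_)) hp2
      ring
    have := hd.sub (tAq y)
    simpa using this
  obtain ⟨b, hb⟩ := lin_lim hsp fun y hy => ⟨_, t1 y hy⟩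
  have hbq : ∀ y ∈ msupp ν, ⟪b, y⟫ = -⟪A y, y⟫ := fun y hy =>
    tendsto_nhds_unique (hb.inner tendsto_const_nhds) (t1 y hy)
  have hq : ∀ w ∈ msupp ψ, ⟪A w, w⟫ = 0 := by
    intro w hw
    have ty := nrst_tendsto hau hC hw
    have ta : Tendsto (fun R : ℝ => ⟪A (nrst (msupp (sc ν 0 R)) w), nrst (msupp (sc ν 0 R)) w⟫) l
        (𝓝 ⟪A w, w⟫) := ((A.continuous.tendsto w).comp ty).inner ty
    have tb : Tendsto (fun R : ℝ => -(R⁻¹ * ⟪b, nrst (msupp (sc ν 0 R)) w⟫)) l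
        (𝓝 (-(0 * ⟪b, w⟫))) := (hinv.mul (tendsto_const_nhds.inner ty)).neg
    rw [zero_mul, neg_zero] at tb
    refine tendsto_nhds_unique ta (tb.congr' ?_)
    filter_upwards [hpos, nrst_mem hau w] with R hR hm
    rw [sc_supp ν 0 hR, zero_add] at hm
    have := hbq _ hm
    rw [map_smul, inner_smul_left, inner_smul_right, inner_smul_right] at this
    simp only [conj_trivial] at this
    have h3 : ⟪b, nrst (msupp (sc ν 0 R)) w⟫ =
      -(R * ⟪A (nrst (msupp (sc ν 0 R)) w), nrst (msupp (sc ν 0 R)) w⟫) :=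
      mul_left_cancel₀ hR.ne' (by rw [this]; ring)
    rw [h3]; field_simp
  have hA0 : ∀ x ∈ msupp ψ, A x = 0 := by
    refine (lemC hψ hAs (Aop_tr hψ) (Aop_tr2 hψ hq) hq).resolve_right fun hk => ?_
    have h1 : Tendsto (fun R => fA (Aop (sc ν 0 R) 1)) l (𝓝 (fA A)) :=
      (fA_cont.tendsto A).comp tA
    have h2 : 1 / 2 ≤ fA A := by
      refine ge_of_tendsto h1 ?_
      filter_upwards [hpos, hl (eventually_ge_atTop 2)] with R hR h2R
      rw [Aop_sc ν hR one_pos, mul_one]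
      exact hf R h2R
    rw [fA_kp hk] at h2
    norm_num at h2
  have hns : ¬ Spn (msupp ψ) := by
    intro hs
    have := Aop_tr hψ ob
    rw [← hAdef] at this
    simp [hs.op hAs hA0] at this
  obtain ⟨e, hF⟩ := flat_of_nspn hψ hns
  have he := hF.1
  have hee : ⟪e, e⟫ = 1 := by rw [real_inner_self_eq_norm_sq, he]; norm_num
  have hbq2 : ∀ y ∈ msupp ν, ⟪b, y⟫ = ⟪e, y⟫ ^ 2 := by
    intro y hy
    rw [hbq y hy, hAdef, flat_A hψ hF, inner_neg_left, inner_smul_left]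
    simp [sq]
  have hge : ∀ w, ⟪e, w⟫ = 0 → 0 ≤ ⟪b, w⟫ := by
    intro w hw
    have ty := nrst_tendsto hau hC (flat_supp hF hw)
    refine ge_of_tendsto ((tendsto_const_nhds (x := b)).inner ty (𝕜 := ℝ)) ?_
    filter_upwards [hpos, nrst_mem hau w] with R hR hm
    rw [sc_supp ν 0 hR, zero_add] at hm
    have := hbq2 _ hm
    rw [inner_smul_right] at this
    have h2 : 0 ≤ R * ⟪b, nrst (msupp (sc ν 0 R)) w⟫ := by rw [this]; positivity
    exact nonneg_of_mul_nonneg_right h2 hR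
  have hz : ∀ w, ⟪e, w⟫ = 0 → ⟪b, w⟫ = 0 := by
    intro w hw
    have h1 := hge w hw
    have h2 := hge (-w) (by rw [inner_neg_right, hw, neg_zero])
    rw [inner_neg_right] at h2
    linarith
  have hbe : ∀ y, ⟪b, y⟫ = ⟪b, e⟫ * ⟪e, y⟫ := by
    intro y
    have := hz (y - ⟪e, y⟫ • e) (by rw [inner_sub_right, inner_smul_right, hee]; ring)
    rw [inner_sub_right, inner_smul_right] at this
    linarith
  have hdich : ∀ y ∈ msupp ν, ⟪e, y⟫ = 0 ∨ ⟪e, y⟫ = ⟪b, e⟫ := by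
    intro y hy
    have h1 := hbq2 y hy
    rw [hbe y] at h1
    have : ⟪e, y⟫ * (⟪e, y⟫ - ⟪b, e⟫) = 0 := by linarith
    rcases mul_eq_zero.1 this with h | h
    · exact Or.inl h
    · exact Or.inr (by linarith)
  obtain ⟨w, hw, hw1⟩ := hsp e he
  apply hw1
  by_cases hβ : ⟪b, e⟫ = 0
  · rcases hdich w hw with h | h
    · exact h
    · rw [h, hβ]
  · exact two_planes h he hβ hdich w hw

structure Hyp (μ : Measure (E 4)) : Prop where
  lf : IsLocallyFiniteMeasure μ
  z : (0 : E 4) ∈ msupp μ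
  u : ∃ α C₀ : ℝ, 0 < α ∧ ∀ x ∈ msupp μ ∩ closedBall (0 : E 4) 1, ∀ r : ℝ, 0 < r → r ≤ 1 →
      |(μ (closedBall x r)).toReal / (omega3 * r ^ 3) - 1| ≤ C₀ * r ^ α

lemma mu_au {μ : Measure (E 4)} (h : Hyp μ) {ι : Type} {l : Filter ι} {ρ : ι → ℝ}
    (hρ : Tendsto ρ l (𝓝[>] 0)) : AU l (fun i => sc μ 0 (ρ i)) := by
  have := h.lf
  have hw := omega3_pos
  have hpos : ∀ᶠ i in l, 0 < ρ i := hρ.eventually self_mem_nhdsWithin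
  have h0 : Tendsto ρ l (𝓝 0) := hρ.mono_right nhdsWithin_le_nhds
  refine ⟨fun i => sc_lf' μ 0 _, ?_, ?_⟩
  · filter_upwards [hpos] with i hi
    rw [sc_supp μ 0 hi]; simpa using h.z
  · intro R r ε hr hε
    obtain ⟨α, C, hα, hu⟩ := h.u
    have t1 : Tendsto (fun i => ρ i * r) l (𝓝 0) := by simpa using h0.mul_const r
    have t2 : Tendsto (fun i => ρ i * R) l (𝓝 0) := by simpa using h0.mul_const R
    have t3 : Tendsto (fun i => omega3 * r ^ 3 * (C * (ρ i * r) ^ α)) l (𝓝 0) := by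
      have h1 : Tendsto (fun i => (ρ i * r) ^ α) l (𝓝 ((0:ℝ) ^ α)) :=
        t1.rpow_const (Or.inr hα.le)
      rw [Real.zero_rpow hα.ne'] at h1
      simpa using (h1.const_mul C).const_mul (omega3 * r ^ 3)
    filter_upwards [hpos, t1.eventually (ge_mem_nhds one_pos), t2.eventually (ge_mem_nhds one_pos),
      t3.eventually (ge_mem_nhds hε)] with i p0 p1 p2 p3 x hx hxR
    rw [sc_supp μ 0 p0, zero_add] at hx
    have e := hu (ρ i • x) ⟨hx, by
      rw [mem_closedBall_zero_iff, norm_smul, Real.norm_eq_abs, abs_of_pos p0]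
      exact (mul_le_mul_of_nonneg_left hxR p0.le).trans p2⟩ (ρ i * r) (by positivity) p1
    have e2 : (sc μ 0 (ρ i)).real (closedBall x r) - omega3 * r ^ 3 =
        omega3 * r ^ 3 * ((μ (closedBall (ρ i • x) (ρ i * r))).toReal / (omega3 * (ρ i * r) ^ 3) - 1) := by
      rw [Measure.real, sc_apply μ 0 p0, ENNReal.toReal_mul, ENNReal.toReal_ofReal (by positivity),
        zero_add]
      field_simp
    rw [e2, abs_mul, abs_of_pos (by positivity : 0 < omega3 * r ^ 3)]
    exact (mul_le_mul_of_nonneg_left e (by positivity)).trans p3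

lemma F_tendsto {μ ν : Measure (E 4)} (h : Hyp μ) (hν : UM ν) {ι : Type} {l : Filter ι} {ρ : ι → ℝ}
    (hρ : Tendsto ρ l (𝓝[>] 0)) (hC : Conv l (fun i => sc μ 0 (ρ i)) ν)
    {c : ι → ℝ} {c0 : ℝ} (hc0 : 0 < c0) (hc : Tendsto c l (𝓝 c0)) :
    Tendsto (fun i => Aop μ (ρ i * c i)) l (𝓝 (Aop ν c0)) := by
  refine (Aop_tendsto (mu_au h hρ) hC hν hc0 hc).congr' ?_
  have hpos : ∀ᶠ i in l, 0 < ρ i := hρ.eventually self_mem_nhdsWithin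
  filter_upwards [hpos, hc.eventually (lt_mem_nhds hc0)] with i h1 h2
  rw [Aop_sc μ h1 h2]

lemma small_flat {ν : Measure (E 4)} (h : UM ν)
    (hn : ¬ ∀ x, Aop ν 1 (Aop ν 1 x) = (1 / 4 : ℝ) • x) :
    ∃ ρ0 : ℝ, 0 < ρ0 ∧ ∀ t, 0 < t → t ≤ ρ0 → 1 / 2 < fA (Aop ν t) := by
  have := h.lf
  have ht : Tendsto (fun t => fA (Aop ν t)) (𝓝[>] 0) (𝓝 (3 / 4)) := by
    rw [tendsto_iff_ultrafilter]
    intro l hl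
    have hpos : ∀ᶠ i : ℝ in (l : Filter ℝ), 0 < i := hl self_mem_nhdsWithin
    have hau := sc_au (ρ := fun i => i) h h.z hpos
    obtain ⟨ψ, hψ, hC⟩ := lim_exists l hau
    have hns : ¬ Spn (msupp ψ) := fun hs => hn (lem3 h hψ l hl hC hs)
    obtain ⟨e, hF⟩ := flat_of_nspn hψ hns
    rw [← fA_flat hψ hF]
    have tA := Aop_tendsto hau hC hψ one_pos (tendsto_const_nhds (x := (1:ℝ)))
    refine ((fA_cont.tendsto _).comp tA).congr' ?_
    filter_upwards [hpos] with t ht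
    simp only [Function.comp]
    rw [Aop_sc ν ht one_pos, mul_one]
  have := ht.eventually (lt_mem_nhds (show (1:ℝ) / 2 < 3 / 4 by norm_num))
  obtain ⟨ρ0, h1, h2⟩ := mem_nhdsGT_iff_exists_Ioc_subset.1 this
  exact ⟨ρ0, h1, fun t ht ht2 => h2 ⟨ht, ht2⟩⟩

lemma pt_lim (l : Ultrafilter ℝ) {y : ℝ → E 4} {R : ℝ} (h : ∀ᶠ i in (l : Filter ℝ), ‖y i‖ ≤ R) :
    ∃ w, ‖w‖ ≤ R ∧ Tendsto y l (𝓝 w) := by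
  obtain ⟨w, h1, h2⟩ := (isCompact_closedBall (0 : E 4) R).ultrafilter_le_nhds' (l.map y) (by
    rw [Ultrafilter.mem_map]
    filter_upwards [h] with i hi
    simpa using hi)
  exact ⟨w, by simpa using h1, h2⟩

lemma theta_flat {μ ν : Measure (E 4)} (h : Hyp μ) (hν : UM ν) (l : Ultrafilter ℝ)
    (hl : (l : Filter ℝ) ≤ 𝓝[>] 0) (hC : Conv l (fun i => sc μ 0 i) ν) {e : E 4} (hF : FlatM ν e) :
    Tendsto (fun r => thetaP 3 (msupp μ) 0 r) l (𝓝 0) := by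
  have := h.lf
  have := hν.lf
  have he := hF.1
  have hee : ⟪e, e⟫ = 1 := by rw [real_inner_self_eq_norm_sq, he]; norm_num
  have hpos : ∀ᶠ i : ℝ in (l : Filter ℝ), 0 < i := hl self_mem_nhdsWithin
  have hau : AU l (fun i => sc μ 0 i) := mu_au (ρ := fun i => i) h hl
  set S := msupp μ with hS
  let V : Submodule ℝ (E 4) := (ℝ ∙ e)ᗮ
  have hV : ∀ x, x ∈ V ↔ ⟪e, x⟫ = 0 := fun x => Submodule.mem_orthogonal_singleton_iff_inner_right
  let L : AffineSubspace ℝ (E 4) := V.toAffineSubspace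
  have hLm : ∀ x, x ∈ (L : Set (E 4)) ↔ ⟪e, x⟫ = 0 := fun x => hV x
  have hL0 : (0 : E 4) ∈ L := (hLm 0).2 (by simp)
  have hLd : finrank ℝ L.direction = 3 := by
    have h1 : L.direction = V := Submodule.toAffineSubspace_direction V
    rw [h1]
    have hne : e ≠ 0 := by rintro rfl; simp at he
    have : Fact (finrank ℝ (E 4) = 3 + 1) := ⟨by simp⟩
    exact Submodule.finrank_orthogonal_span_singleton hne
  have setD_nn : ∀ A B : Set (E 4), 0 ≤ setD A B := fun A B =>
    Real.iSup_nonneg fun a => Real.iSup_nonneg fun _ => infDist_nonneg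
  have D_nn : ∀ (r : ℝ) (B : Set (E 4)), 0 < r → 0 ≤ Dxr 0 r S B := fun r B hr =>
    le_max_of_le_left (mul_nonneg (by positivity) (setD_nn _ _))
  have key1 : ∀ ε : ℝ, 0 < ε → ∀ᶠ r in (l : Filter ℝ), ∀ a ∈ S ∩ closedBall 0 r,
      infDist a ((L : Set (E 4)) ∩ closedBall 0 r) ≤ r * ε := by
    intro ε hε
    have bad : ∀ᶠ r in (l : Filter ℝ), ∀ a ∈ S ∩ closedBall 0 r, |⟪e, a⟫| ≤ r * ε := by
      by_contra hcon
      rw [Ultrafilter.eventually_not.symm] at hcon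
      have hc2 : ∀ r : ℝ, ∃ a : E 4, (¬ ∀ a ∈ S ∩ closedBall 0 r, |⟪e, a⟫| ≤ r * ε) →
          a ∈ S ∩ closedBall 0 r ∧ r * ε < |⟪e, a⟫| := by
        intro r
        by_cases hh : ∀ a ∈ S ∩ closedBall 0 r, |⟪e, a⟫| ≤ r * ε
        · exact ⟨0, fun h => absurd hh h⟩
        · push Not at hh
          obtain ⟨a, h1, h2⟩ := hh
          exact ⟨a, fun _ => ⟨h1, h2⟩⟩
      choose a ha using hc2
      have hn : ∀ᶠ r in (l : Filter ℝ), ‖r⁻¹ • a r‖ ≤ 1 := by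
        filter_upwards [hpos, hcon] with r hr hb
        have h1 := (ha r hb).1.2
        rw [mem_closedBall_zero_iff] at h1
        rw [norm_smul, norm_inv, Real.norm_eq_abs, abs_of_pos hr, inv_mul_le_iff₀ hr]
        linarith
      obtain ⟨w, -, hw⟩ := pt_lim l hn
      have hwm : w ∈ msupp ν := by
        refine sup2 hau hC ?_ hw
        filter_upwards [hpos, hcon] with r hr hb
        rw [sc_supp μ 0 hr, smul_smul, mul_inv_cancel₀ hr.ne', one_smul, zero_add]
        exact (ha r hb).1.1
      have hge : ε ≤ |⟪e, w⟫| := by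
        refine ge_of_tendsto ((tendsto_const_nhds (x := e)).inner hw (𝕜 := ℝ)).abs ?_
        filter_upwards [hpos, hcon] with r hr hb
        rw [inner_smul_right, abs_mul, abs_inv, abs_of_pos hr, le_inv_mul_iff₀ hr]
        exact (ha r hb).2.le
      rw [flat_in hF hwm, abs_zero] at hge
      linarith
    filter_upwards [bad] with r hr a ha
    refine le_trans (infDist_le_dist_of_mem (y := a - ⟪e, a⟫ • e) ⟨?_, ?_⟩) ?_
    · rw [hLm, inner_sub_right, inner_smul_right, hee]; ring
    · rw [mem_closedBall_zero_iff]
      have h1 := ha.2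
      rw [mem_closedBall_zero_iff] at h1
      refine le_trans ?_ h1
      apply (sq_le_sq₀ (norm_nonneg _) (norm_nonneg _)).1
      rw [norm_sub_sq_real, inner_smul_right, norm_smul, he, mul_one, Real.norm_eq_abs, sq_abs,
        real_inner_comm a e]
      nlinarith [sq_nonneg ⟪e, a⟫]
    · rw [dist_eq_norm, sub_sub_cancel, norm_smul, he, mul_one]
      exact hr a ha
  have key2 : ∀ ε : ℝ, 0 < ε → ε < 1 → ∀ᶠ r in (l : Filter ℝ), ∀ a ∈ (L : Set (E 4)) ∩ closedBall 0 r,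
      infDist a (S ∩ closedBall 0 r) ≤ r * ε := by
    intro ε hε hε1
    by_contra hcon
    rw [Ultrafilter.eventually_not.symm] at hcon
    have hc2 : ∀ r : ℝ, ∃ a : E 4, (¬ ∀ a ∈ (L : Set (E 4)) ∩ closedBall 0 r,
        infDist a (S ∩ closedBall 0 r) ≤ r * ε) →
        a ∈ (L : Set (E 4)) ∩ closedBall 0 r ∧ r * ε < infDist a (S ∩ closedBall 0 r) := by
      intro r
      by_cases hh : ∀ a ∈ (L : Set (E 4)) ∩ closedBall 0 r, infDist a (S ∩ closedBall 0 r) ≤ r * ε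
      · exact ⟨0, fun h => absurd hh h⟩
      · push Not at hh
        obtain ⟨a, h1, h2⟩ := hh
        exact ⟨a, fun _ => ⟨h1, h2⟩⟩
    choose a ha using hc2
    have hn : ∀ᶠ r in (l : Filter ℝ), ‖r⁻¹ • a r‖ ≤ 1 := by
      filter_upwards [hpos, hcon] with r hr hb
      have h1 := (ha r hb).1.2
      rw [mem_closedBall_zero_iff] at h1
      rw [norm_smul, norm_inv, Real.norm_eq_abs, abs_of_pos hr, inv_mul_le_iff₀ hr]
      linarith
    obtain ⟨w, hw1, hw⟩ := pt_lim l hn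
    have hwe : ⟪e, w⟫ = 0 := by
      refine tendsto_nhds_unique ((tendsto_const_nhds (x := e)).inner hw (𝕜 := ℝ))
        (tendsto_const_nhds.congr' ?_)
      filter_upwards [hcon] with r hb
      rw [inner_smul_right, (hLm _).1 (ha r hb).1.1, mul_zero]
    set w' := (1 - ε / 4) • w with hw'
    have hm' : w' ∈ msupp ν := flat_supp hF (by rw [hw', inner_smul_right, hwe, mul_zero])
    have hd1 : ‖w'‖ ≤ 1 - ε / 4 := by
      rw [hw', norm_smul, Real.norm_eq_abs, abs_of_pos (by linarith)]
      nlinarith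
    have hd2 : dist w w' ≤ ε / 4 := by
      have : w - w' = (ε / 4) • w := by rw [hw', sub_smul, one_smul]; abel
      rw [dist_eq_norm, this, norm_smul, Real.norm_eq_abs, abs_of_pos (by linarith)]
      nlinarith
    have hε4 : 0 < ε / 4 := by linarith
    have hF' : ∀ᶠ r in (l : Filter ℝ), False := by
      filter_upwards [hpos, hcon, sup1 hau hC hm' hε4, Metric.tendsto_nhds.1 hw _ hε4]
        with r hr hb ⟨y, hy, hyd⟩ hv
      rw [sc_supp μ 0 hr, zero_add] at hy
      have h1 := (ha r hb).2
      have h2 : infDist (a r) (S ∩ closedBall 0 r) ≤ dist (a r) (r • y) := by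
        refine infDist_le_dist_of_mem ⟨hy, ?_⟩
        rw [mem_closedBall_zero_iff, norm_smul, Real.norm_eq_abs, abs_of_pos hr]
        have : ‖y‖ ≤ ‖w'‖ + dist y w' := by
          rw [dist_eq_norm]; exact norm_le_norm_add_norm_sub' y w'
        nlinarith
      have h3 : dist (a r) (r • y) = r * dist (r⁻¹ • a r) y := by
        have : a r = r • (r⁻¹ • a r) := by rw [smul_smul, mul_inv_cancel₀ hr.ne', one_smul]
        conv_lhs => rw [this]
        rw [dist_smul₀, Real.norm_eq_abs, abs_of_pos hr]
      have h4 : dist (r⁻¹ • a r) y ≤ dist (r⁻¹ • a r) w + dist w w' + dist w' y :=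
        dist_triangle4 _ _ _ _
      rw [dist_comm w' y] at h4
      have h5 : dist (r⁻¹ • a r) y ≤ ε := by linarith
      have h6 := mul_le_mul_of_nonneg_left h5 hr.le
      linarith
    exact hF'.exists.elim fun _ h => h
  rw [Metric.tendsto_nhds]
  intro ε hε
  have hm : 0 < min (ε / 2) (1 / 2) := by positivity
  have hm1 : min (ε / 2) (1 / 2) < 1 := lt_of_le_of_lt (min_le_right _ _) (by norm_num)
  have hm2 : min (ε / 2) (1 / 2) < ε := lt_of_le_of_lt (min_le_left _ _) (by linarith)
  filter_upwards [hpos, key1 _ hm, key2 _ hm hm1] with r hr k1 k2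
  have hth : 0 ≤ thetaP 3 S 0 r := Real.iInf_nonneg fun L => D_nn r _ hr
  rw [Real.dist_eq, sub_zero, abs_of_nonneg hth]
  refine lt_of_le_of_lt ?_ hm2
  have hle : thetaP 3 S 0 r ≤ Dxr 0 r S (L : Set (E 4)) :=
    ciInf_le (f := fun L : {L : AffineSubspace ℝ (E 4) // (0 : E 4) ∈ L ∧
      Module.finrank ℝ L.direction = 3} => Dxr 0 r S (L.1 : Set (E 4)))
      ⟨0, by rintro _ ⟨L, rfl⟩; exact D_nn r _ hr⟩ ⟨L, hL0, hLd⟩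
  refine hle.trans ?_
  have gen : ∀ A B : Set (E 4), (∀ a ∈ A, infDist a B ≤ r * min (ε / 2) (1 / 2)) →
      1 / r * setD A B ≤ min (ε / 2) (1 / 2) := by
    intro A B hAB
    have : setD A B ≤ r * min (ε / 2) (1 / 2) :=
      Real.iSup_le (fun a => Real.iSup_le (fun ha => hAB a ha) (by positivity)) (by positivity)
    rw [one_div, inv_mul_le_iff₀ hr]
    exact this
  exact max_le (gen _ _ k1) (gen _ _ k2)

lemma freq_small {μ : Measure (E 4)} (h : Hyp μ)
    (hnf : ¬ Tendsto (fun r : ℝ => thetaP 3 (msupp μ) 0 r) (𝓝[>] 0) (𝓝 0)) :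
    ∀ t0 : ℝ, 0 < t0 → ∃ t, 0 < t ∧ t < t0 ∧ fA (Aop μ t) ≤ 1 / 2 := by
  intro t0 ht0
  by_contra hcon
  push Not at hcon
  apply hnf
  rw [tendsto_iff_ultrafilter]
  intro l hl
  have hpos : ∀ᶠ i : ℝ in (l : Filter ℝ), 0 < i := hl self_mem_nhdsWithin
  have hl0 : Tendsto (fun i : ℝ => i) l (𝓝 0) := hl.trans nhdsWithin_le_nhds
  obtain ⟨ν, hν, hC⟩ := lim_exists l (mu_au (ρ := fun i => i) h hl)
  obtain ⟨e, hF⟩ := lem4 hν (by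
    intro R hR
    have hR0 : 0 < R := by linarith
    have t1 := (fA_cont.tendsto _).comp
      (F_tendsto (ρ := fun i => i) h hν hl hC hR0 (tendsto_const_nhds (x := R)))
    refine ge_of_tendsto t1 ?_
    have t2 : Tendsto (fun i : ℝ => i * R) l (𝓝 0) := by simpa using hl0.mul_const R
    filter_upwards [hpos, t2.eventually (gt_mem_nhds ht0)] with i p1 p2
    exact (hcon _ (mul_pos p1 hR0) p2).le)
  exact theta_flat h hν l hl hC hF

lemma main_claim {μ ν : Measure (E 4)} (h : Hyp μ)
    (hfr : ∀ t0 : ℝ, 0 < t0 → ∃ t, 0 < t ∧ t < t0 ∧ fA (Aop μ t) ≤ 1 / 2)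
    (hν : UM ν) (l : Ultrafilter ℝ)
    (hl : (l : Filter ℝ) ≤ 𝓝[>] 0) (hC : Conv l (fun i => sc μ 0 i) ν) :
    ∀ x, Aop ν 1 (Aop ν 1 x) = (1 / 4 : ℝ) • x := by
  by_contra hn
  obtain ⟨ρ0, hρ0, hsm⟩ := small_flat hν hn
  have hpos : ∀ᶠ i : ℝ in (l : Filter ℝ), 0 < i := hl self_mem_nhdsWithin
  have hl0 : Tendsto (fun i : ℝ => i) l (𝓝 0) := hl.trans nhdsWithin_le_nhds
  have hlz : ∀ ε : ℝ, 0 < ε → ε ≤ 1 → ∀ᶠ r : ℝ in (l : Filter ℝ), ∀ c ∈ Icc ε 1,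
      1 / 2 < fA (Aop μ (r * (ρ0 * c))) := by
    intro ε hε hε1
    by_contra hcon
    rw [Ultrafilter.eventually_not.symm] at hcon
    have hc2 : ∀ r : ℝ, ∃ c : ℝ, c ∈ Icc ε 1 ∧ ((¬ ∀ c ∈ Icc ε 1, 1 / 2 < fA (Aop μ (r * (ρ0 * c)))) →
        fA (Aop μ (r * (ρ0 * c))) ≤ 1 / 2) := by
      intro r
      by_cases hh : ∀ c ∈ Icc ε 1, 1 / 2 < fA (Aop μ (r * (ρ0 * c)))
      · exact ⟨1, ⟨hε1, le_rfl⟩, fun h => absurd hh h⟩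
      · have hh' := hh
        push Not at hh'
        obtain ⟨c, h1, h2⟩ := hh'
        exact ⟨c, h1, fun _ => h2⟩
    choose c hc hc' using hc2
    obtain ⟨c0, hc0⟩ := ultra_lim l c 1 (Eventually.of_forall fun r => by
      rw [abs_of_pos (hε.trans_le (hc r).1)]; exact (hc r).2)
    have hge : ε ≤ c0 := ge_of_tendsto hc0 (Eventually.of_forall fun r => (hc r).1)
    have hle : c0 ≤ 1 := le_of_tendsto hc0 (Eventually.of_forall fun r => (hc r).2)
    have hc00 : 0 < c0 := hε.trans_le hge
    have t1 := (fA_cont.tendsto _).comp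
      (F_tendsto (ρ := fun i => i) h hν hl hC (mul_pos hρ0 hc00) (hc0.const_mul ρ0))
    have h1 : fA (Aop ν (ρ0 * c0)) ≤ 1 / 2 := by
      refine le_of_tendsto t1 ?_
      filter_upwards [hcon] with r hr
      exact hc' r hr
    have h2 := hsm (ρ0 * c0) (mul_pos hρ0 hc00) (by nlinarith)
    linarith
  have hch : ∀ r : ℝ, ∃ ρ : ℝ, 0 < r → (0 < ρ ∧ ρ < r * ρ0 ∧ fA (Aop μ ρ) ≤ 1 / 2 ∧
      ∀ t, 0 < t → t < r * ρ0 → fA (Aop μ t) ≤ 1 / 2 → t < 2 * ρ) := by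
    intro r
    by_cases hr : 0 < r
    · set Z : Set ℝ := {t | 0 < t ∧ t < r * ρ0 ∧ fA (Aop μ t) ≤ 1 / 2} with hZ
      obtain ⟨t, ht⟩ := hfr (r * ρ0) (mul_pos hr hρ0)
      have hne : Z.Nonempty := ⟨t, ht⟩
      have hbd : BddAbove Z := ⟨r * ρ0, fun s hs => hs.2.1.le⟩
      have hsp : 0 < sSup Z := ht.1.trans_le (le_csSup hbd ht)
      obtain ⟨ρ, hρ, hρ2⟩ := exists_lt_of_lt_csSup hne (show sSup Z / 2 < sSup Z by linarith)
      refine ⟨ρ, fun _ => ⟨hρ.1, hρ.2.1, hρ.2.2, fun s h1 h2 h3 => ?_⟩⟩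
      have : s ≤ sSup Z := le_csSup hbd ⟨h1, h2, h3⟩
      linarith
    · exact ⟨0, fun h => absurd h hr⟩
  choose ρ hρ using hch
  have hsmall : ∀ ε : ℝ, 0 < ε → ε ≤ 1 → ∀ᶠ r : ℝ in (l : Filter ℝ), ρ r < r * (ρ0 * ε) := by
    intro ε hε hε1
    filter_upwards [hpos, hlz ε hε hε1] with r hr hz
    obtain ⟨h1, h2, h3, -⟩ := hρ r hr
    by_contra hcon
    push Not at hcon
    have hrr : 0 < r * ρ0 := mul_pos hr hρ0
    have := hz (ρ r / (r * ρ0)) ⟨by rw [le_div_iff₀ hrr]; linarith, by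
      rw [div_le_one hrr]; exact h2.le⟩
    rw [show r * (ρ0 * (ρ r / (r * ρ0))) = ρ r by field_simp] at this
    linarith
  have hρt : Tendsto ρ l (𝓝[>] 0) := by
    rw [tendsto_nhdsWithin_iff]
    refine ⟨?_, ?_⟩
    · have t2 : Tendsto (fun i : ℝ => i * ρ0) l (𝓝 0) := by simpa using hl0.mul_const ρ0
      refine tendsto_of_tendsto_of_tendsto_of_le_of_le' tendsto_const_nhds t2 ?_ ?_
      · filter_upwards [hpos] with r hr using (hρ r hr).1.le
      · filter_upwards [hpos] with r hr using (hρ r hr).2.1.le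
    · filter_upwards [hpos] with r hr using (hρ r hr).1
  obtain ⟨ψ, hψ, hCψ⟩ := lim_exists l (mu_au h hρt)
  have hle : fA (Aop ψ 1) ≤ 1 / 2 := by
    refine le_of_tendsto ((fA_cont.tendsto _).comp
      (F_tendsto h hψ hρt hCψ one_pos (tendsto_const_nhds (x := (1:ℝ))))) ?_
    filter_upwards [hpos] with r hr
    simp only [Function.comp, mul_one]
    exact (hρ r hr).2.2.1
  obtain ⟨e, hF⟩ := lem4 hψ (by
    intro R hR
    have hR0 : 0 < R := by linarith
    refine ge_of_tendsto ((fA_cont.tendsto _).comp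
      (F_tendsto h hψ hρt hCψ hR0 (tendsto_const_nhds (x := R)))) ?_
    filter_upwards [hpos, hsmall (1 / R) (by positivity) (by
      rw [div_le_one hR0]; linarith)] with r hr hs
    obtain ⟨h1, h2, h3, h4⟩ := hρ r hr
    by_contra hcon
    push Not at hcon
    have h5 : ρ r * R < r * ρ0 := by
      have := mul_lt_mul_of_pos_right hs hR0
      rwa [show r * (ρ0 * (1 / R)) * R = r * ρ0 by field_simp] at this
    have := h4 (ρ r * R) (by positivity) h5 hcon.le
    nlinarith)
  have := fA_flat hψ hF
  linarith

lemma sq_lim {μ : Measure (E 4)} (h : Hyp μ)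
    (hfr : ∀ t0 : ℝ, 0 < t0 → ∃ t, 0 < t ∧ t < t0 ∧ fA (Aop μ t) ≤ 1 / 2) :
    Tendsto (fun r => ‖(Aop μ r).comp (Aop μ r) - (1 / 4 : ℝ) • ContinuousLinearMap.id ℝ (E 4)‖)
      (𝓝[>] 0) (𝓝 0) ∧
    Tendsto (fun r => ∑ i, ⟪Aop μ r (ob i), ob i⟫) (𝓝[>] 0) (𝓝 (-1)) := by
  have key : ∀ l : Ultrafilter ℝ, (l : Filter ℝ) ≤ 𝓝[>] 0 → ∃ ν, UM ν ∧
      (∀ x, Aop ν 1 (Aop ν 1 x) = (1 / 4 : ℝ) • x) ∧ Tendsto (fun r => Aop μ r) l (𝓝 (Aop ν 1)) := by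
    intro l hl
    obtain ⟨ν, hν, hC⟩ := lim_exists l (mu_au (ρ := fun i => i) h hl)
    refine ⟨ν, hν, main_claim h hfr hν l hl hC, ?_⟩
    simpa using F_tendsto (ρ := fun i => i) h hν hl hC one_pos (tendsto_const_nhds (x := (1:ℝ)))
  constructor
  · rw [tendsto_iff_ultrafilter]
    intro l hl
    obtain ⟨ν, hν, h2, ht⟩ := key l hl
    have hc : Continuous fun A : E 4 →L[ℝ] E 4 =>
        ‖A.comp A - (1 / 4 : ℝ) • ContinuousLinearMap.id ℝ (E 4)‖ := by
      have : Continuous fun A : E 4 →L[ℝ] E 4 => A.comp A := continuous_id.clm_comp continuous_id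
      fun_prop
    have := (hc.tendsto _).comp ht
    have e : (Aop ν 1).comp (Aop ν 1) - (1 / 4 : ℝ) • ContinuousLinearMap.id ℝ (E 4) = 0 := by
      apply ContinuousLinearMap.ext
      intro x
      simp [h2 x]
    simp only [e, norm_zero] at this
    exact this
  · rw [tendsto_iff_ultrafilter]
    intro l hl
    obtain ⟨ν, hν, h2, ht⟩ := key l hl
    have hc : Continuous fun A : E 4 →L[ℝ] E 4 => ∑ i, ⟪A (ob i), ob i⟫ := by
      refine continuous_finset_sum _ fun i _ => ?_
      exact (continuous_id.clm_apply continuous_const).inner continuous_const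
    have := (hc.tendsto _).comp ht
    rw [Aop_tr hν] at this
    exact this

lemma near {a η : ℝ} (h : |a ^ 2 - 1 / 4| < η) :
    |a - 1 / 2| < 2 * η ∨ |a + 1 / 2| < 2 * η := by
  rw [abs_lt] at h
  rcases le_total 0 a with h0 | h0
  · left
    rw [abs_lt]; constructor <;> by_contra hc <;> push Not at hc <;> nlinarith
  · right
    rw [abs_lt]; constructor <;> by_contra hc <;> push Not at hc <;> nlinarith

lemma signs {a : Fin 4 → ℝ} (ha : Antitone a) {η : ℝ} (hη : η ≤ 1 / 32)
    (h : ∀ i, |a i ^ 2 - 1 / 4| < η) (hs : |∑ i, a i + 1| < η) :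
    |a 0 - 1 / 2| < 2 * η ∧ |a 1 + 1 / 2| < 2 * η ∧ |a 2 + 1 / 2| < 2 * η ∧
      |a 3 + 1 / 2| < 2 * η := by
  have h01 : a 1 ≤ a 0 := ha (by decide)
  have h12 : a 2 ≤ a 1 := ha (by decide)
  have h23 : a 3 ≤ a 2 := ha (by decide)
  rw [Fin.sum_univ_four, abs_lt] at hs
  have n0 := near (h 0)
  have n1 := near (h 1)
  have n2 := near (h 2)
  have n3 := near (h 3)
  simp only [abs_lt] at *
  rcases n0 with n0 | n0 <;> rcases n1 with n1 | n1 <;> rcases n2 with n2 | n2 <;>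
    rcases n3 with n3 | n3 <;> first
      | exact ⟨n0, n1, n2, n3⟩
      | (exfalso; linarith [n0.1, n0.2, n1.1, n1.2, n2.1, n2.2, n3.1, n3.2, hs.1, hs.2])

/-- Lemma 4.5 / `diagonalbasis`: at small scales the second moment of a
Hölder asymptotically uniform measure on `ℝ⁴` at a nonflat point is diagonalizable in an
orthonormal basis with eigenvalues close to `(1/2, 1/2, 1/2, 3/2)`. -/
theorem second_moment_diagonalization (μ : Measure (E 4))
    (hRadon : IsLocallyFiniteMeasure μ) (S : Set (E 4)) (hS : S = msupp μ)
    (h0 : (0 : E 4) ∈ S)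
    (hnf : ¬ Tendsto (fun r : ℝ => thetaP 3 S 0 r) (nhdsWithin 0 (Set.Ioi 0)) (nhds 0))
    (α C₀ : ℝ) (hα : 0 < α)
    (hreg : ∀ x ∈ S ∩ closedBall (0 : E 4) 1, ∀ r : ℝ, 0 < r → r ≤ 1 →
      |(μ (closedBall x r)).toReal / (omega3 * r ^ 3) - 1| ≤ C₀ * r ^ α)
    (δ : ℝ) (hδ : 0 < δ) :
    ∃ r₀ : ℝ, 0 < r₀ ∧ ∀ r : ℝ, 0 < r → r ≤ r₀ →
      ∃ (b : OrthonormalBasis (Fin 4) ℝ (E 4)) (lam : Fin 4 → ℝ),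
        (∀ z : E 4, Qmom μ r z = ∑ i : Fin 4, lam i * ⟪b i, z⟫ ^ 2) ∧
        (∀ i : Fin 4, i ≠ 3 → |lam i - 1 / 2| < δ) ∧
        |lam 3 - 3 / 2| < δ := by
  subst hS
  have hH : Hyp μ := ⟨hRadon, h0, α, C₀, hα, hreg⟩
  obtain ⟨l1, l2⟩ := sq_lim hH (freq_small hH hnf)
  set η : ℝ := min (δ / 2) (1 / 32) with hη
  have hη0 : 0 < η := by positivity
  have hη1 : η ≤ 1 / 32 := min_le_right _ _
  have hη2 : 2 * η ≤ δ := by have : η ≤ δ / 2 := min_le_left _ _; linarith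
  have ev := (l1.eventually (gt_mem_nhds hη0)).and
    (l2.eventually (Metric.ball_mem_nhds (-1 : ℝ) hη0))
  obtain ⟨r₀, hr0, hr⟩ := mem_nhdsGT_iff_exists_Ioc_subset.1 ev
  refine ⟨r₀, hr0, fun r hrp hrl => ?_⟩
  obtain ⟨g1, g2⟩ := hr ⟨hrp, hrl⟩
  obtain ⟨b, a, hanti, hab⟩ := eig (Aop_symm μ r)
  have hq : ∀ i, |a i ^ 2 - 1 / 4| < η := by
    intro i
    refine lt_of_le_of_lt ?_ g1
    have := ((Aop μ r).comp (Aop μ r) - (1 / 4 : ℝ) • ContinuousLinearMap.id ℝ (E 4)).le_opNorm (b i)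
    rw [b.norm_eq_one, mul_one] at this
    refine le_trans (le_of_eq ?_) this
    have e : ((Aop μ r).comp (Aop μ r) - (1 / 4 : ℝ) • ContinuousLinearMap.id ℝ (E 4)) (b i) =
        (a i ^ 2 - 1 / 4) • b i := by
      simp only [ContinuousLinearMap.sub_apply, ContinuousLinearMap.comp_apply, hab, map_smul,
        ContinuousLinearMap.smul_apply, ContinuousLinearMap.id_apply, smul_smul, sub_smul, sq]
    rw [e, norm_smul, b.norm_eq_one, mul_one, Real.norm_eq_abs]
  have htr : ∑ i, a i = ∑ i, ⟪Aop μ r (ob i), ob i⟫ := by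
    have e1 : ∀ b' : OrthonormalBasis (Fin 4) ℝ (E 4), ∑ i, ⟪Aop μ r (b' i), b' i⟫ =
        5 / (omega3 * r ^ 5) * (∫ z in closedBall 0 r, ‖z‖ ^ 2 ∂μ) - 4 := by
      intro b'
      simp only [Aop_inner, Finset.sum_sub_distrib, qtrace, real_inner_self_eq_norm_sq,
        b'.norm_eq_one]
      norm_num
    rw [e1 ob, ← e1 b]
    refine Finset.sum_congr rfl fun i _ => ?_
    rw [hab, inner_smul_left, real_inner_self_eq_norm_sq, b.norm_eq_one]
    simp
  have hs : |∑ i, a i + 1| < η := by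
    rw [htr]
    simpa [Real.dist_eq] using g2
  obtain ⟨s0, s1, s2, s3⟩ := signs hanti hη1 hq hs
  refine ⟨b.reindex (Equiv.swap 0 3), fun i => 1 + a (Equiv.swap 0 3 i), ?_, ?_, ?_⟩
  · intro z
    have e1 : Qmom μ r z = ⟪Aop μ r z, z⟫ + ⟪z, z⟫ := by
      rw [Aop_inner]
      simp only [Qmom, qmom, sq]
      ring
    simp only [OrthonormalBasis.reindex_apply, Equiv.symm_swap]
    rw [Equiv.sum_comp (Equiv.swap (0 : Fin 4) 3) (fun i => (1 + a i) * ⟪b i, z⟫ ^ 2), e1,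
      ← b.sum_inner_mul_inner, ← b.sum_inner_mul_inner z z, ← Finset.sum_add_distrib]
    refine Finset.sum_congr rfl fun i _ => ?_
    rw [Aop_symm, hab, inner_smul_right, real_inner_comm z (b i)]
    ring
  · intro i hi
    have hh : ∀ x : ℝ, |x + 1 / 2| < 2 * η → |1 + x - 1 / 2| < δ := by
      intro x hx
      rw [show 1 + x - 1 / 2 = x + 1 / 2 by ring]; linarith
    fin_cases i
    · exact hh _ (by simpa using s3)
    · exact hh _ (by simpa [Equiv.swap_apply_def] using s1)
    · exact hh _ (by simpa [Equiv.swap_apply_def] using s2)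
    · exact absurd rfl hi
  · simp only [Equiv.swap_apply_right]
    rw [show 1 + a 0 - 3 / 2 = a 0 - 1 / 2 by ring]; linarith

end
end

section
/- There is an absolute constant C with the following property. Let (x₁,x₂,x₃,x₄) be orthonormal coordinates on ℝ⁴ and let P(x) = Σ_{i=1}^{4} ηᵢ xᵢ² be a quadratic polynomial with |ηᵢ + 1/2| < 1/8 for i = 1,2,3 and |η₄ − 1/2| < 1/8. If Σ ⊆ ℝ⁴ satisfies |P(x)| ≤ ε for all x ∈ Σ ∩ B(0,1) (with Σ ∩ B(0,1) ≠ ∅), then d^{0,1}(Σ, P⁻¹(0)) ≤ C·√ε. -/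
open Metric Set MeasureTheory Filter Module
open scoped RealInnerProductSpace Topology Pointwise ENNReal

noncomputable section

theorem le_of_sq_aux {a b : ℝ} (h : a ^ 2 ≤ b ^ 2) (hb : 0 ≤ b) : a ≤ b :=
  by nlinarith

theorem scal_aux (U N T h ε : ℝ) (hU : 0 ≤ U) (hN : 3 / 8 * U ≤ N) (hT : 0 ≤ T) (hh : 3 / 8 ≤ h)
    (he : |h * T - N| ≤ ε) :
    ∃ c d : ℝ, 0 ≤ c ∧ c ≤ 1 ∧ 0 ≤ d ∧ d ≤ 1 ∧ h * d ^ 2 * T = c ^ 2 * N ∧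
      (1 - c) ^ 2 * U + (1 - d) ^ 2 * T ≤ 4 * ε := by
  obtain ⟨he1, he2⟩ := abs_le.mp he
  have hN0 : 0 ≤ N := by linarith
  have hhT : 0 ≤ h * T := by positivity
  have he0 : 0 ≤ ε := (abs_nonneg _).trans he
  rcases le_or_gt N (h * T) with hc | hc
  · rcases hT.eq_or_lt with hT0 | hT0
    · refine ⟨1, 0, by norm_num, le_rfl, le_rfl, by norm_num, ?_, ?_⟩
      · subst hT0; simp at hc ⊢; linarith
      · subst hT0; simp; exact he0
    · have hpos : 0 < h * T := by positivity
      have hs : Real.sqrt (N / (h * T)) ^ 2 = N / (h * T) := Real.sq_sqrt (by positivity)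
      have hd0 : 0 ≤ Real.sqrt (N / (h * T)) := Real.sqrt_nonneg _
      have hd1 : Real.sqrt (N / (h * T)) ≤ 1 := by
        rw [Real.sqrt_le_one]; exact (div_le_one hpos).mpr hc
      generalize Real.sqrt (N / (h * T)) = d at *
      have hk : d ^ 2 * (h * T) = N := by rw [hs]; field_simp
      refine ⟨1, d, by norm_num, le_rfl, hd0, hd1, by linarith, ?_⟩
      have h1 : (1 - d) ^ 2 * T ≤ (1 - d ^ 2) * T := by
        apply mul_le_mul_of_nonneg_right _ hT; nlinarith
      have h2 : 0 ≤ (1 - d ^ 2) * T := by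
        apply mul_nonneg _ hT; nlinarith
      nlinarith
  · have hpos : 0 < N := by linarith
    have hs : Real.sqrt (h * T / N) ^ 2 = h * T / N := Real.sq_sqrt (by positivity)
    have hd0 : 0 ≤ Real.sqrt (h * T / N) := Real.sqrt_nonneg _
    have hd1 : Real.sqrt (h * T / N) ≤ 1 := by
      rw [Real.sqrt_le_one]; exact (div_le_one hpos).mpr hc.le
    generalize Real.sqrt (h * T / N) = d at *
    have hk : d ^ 2 * N = h * T := by rw [hs]; field_simp
    refine ⟨d, 1, hd0, hd1, by norm_num, le_rfl, by linarith, ?_⟩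
    have h1 : (1 - d) ^ 2 * U ≤ (1 - d ^ 2) * U := by
      apply mul_le_mul_of_nonneg_right _ hU; nlinarith
    have h2 : (1 - d ^ 2) * (3 / 8 * U) ≤ (1 - d ^ 2) * N := by
      apply mul_le_mul_of_nonneg_left hN; nlinarith
    nlinarith

/-- Lemma 4.6 / `Polynomial`: if a quadratic polynomial of the stated form
is small on a set in the unit ball, then the set is close to the zero set of the polynomial. -/
theorem small_polynomial_values_near_zero_set :
    ∃ C : ℝ, 0 < C ∧
      ∀ (b : OrthonormalBasis (Fin 4) ℝ (E 4)) (η : Fin 4 → ℝ),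
        (∀ i : Fin 4, i ≠ 3 → |η i + 1 / 2| < 1 / 8) → |η 3 - 1 / 2| < 1 / 8 →
        ∀ (S : Set (E 4)) (ε : ℝ), (S ∩ closedBall (0 : E 4) 1).Nonempty →
          (∀ x ∈ S ∩ closedBall (0 : E 4) 1, |∑ i : Fin 4, η i * ⟪b i, x⟫ ^ 2| ≤ ε) →
          dxr (0 : E 4) 1 S {x : E 4 | ∑ i : Fin 4, η i * ⟪b i, x⟫ ^ 2 = 0}
            ≤ C * Real.sqrt ε := by
  refine ⟨2, by norm_num, ?_⟩
  intro b η hη h3 S ε _ hS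
  have hC : 0 ≤ 2 * Real.sqrt ε := by positivity
  unfold dxr setD
  rw [div_one, one_mul]
  refine Real.iSup_le (fun x => Real.iSup_le (fun hx => ?_) hC) hC
  have hP := hS x hx
  have hxn : ‖x‖ ≤ 1 := by simpa using hx.2
  have e0 := abs_lt.mp (hη 0 (by decide))
  have e1 := abs_lt.mp (hη 1 (by decide))
  have e2 := abs_lt.mp (hη 2 (by decide))
  have e3 := abs_lt.mp h3
  have hnorm : ∀ z : E 4, ‖z‖ ^ 2 = ⟪b 0, z⟫ ^ 2 + ⟪b 1, z⟫ ^ 2 + ⟪b 2, z⟫ ^ 2 + ⟪b 3, z⟫ ^ 2 := by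
    intro z
    rw [← b.sum_sq_norm_inner_right z, Fin.sum_univ_four]
    simp only [Real.norm_eq_abs, sq_abs]
  rw [Fin.sum_univ_four] at hP
  have q0 := sq_nonneg ⟪b 0, x⟫
  have q1 := sq_nonneg ⟪b 1, x⟫
  have q2 := sq_nonneg ⟪b 2, x⟫
  have q3 := sq_nonneg ⟪b 3, x⟫
  obtain ⟨c, d, hc0, hc1, hd0, hd1, hz, hdist⟩ :=
    scal_aux (⟪b 0, x⟫ ^ 2 + ⟪b 1, x⟫ ^ 2 + ⟪b 2, x⟫ ^ 2)
      (-(η 0 * ⟪b 0, x⟫ ^ 2 + η 1 * ⟪b 1, x⟫ ^ 2 + η 2 * ⟪b 2, x⟫ ^ 2))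
      (⟪b 3, x⟫ ^ 2) (η 3) ε (by positivity) (by nlinarith) (by positivity) (by linarith)
      (by convert hP using 2; ring)
  obtain ⟨y, hy⟩ : ∃ y : E 4, ∀ i, ⟪b i, y⟫ = (![c, c, c, d] i) * ⟪b i, x⟫ := by
    refine ⟨b.repr.symm (WithLp.toLp 2 fun i => (![c, c, c, d] i) * ⟪b i, x⟫), fun i => ?_⟩
    rw [← b.repr_apply_apply]
    simp
  have y0 : ⟪b 0, y⟫ = c * ⟪b 0, x⟫ := hy 0
  have y1 : ⟪b 1, y⟫ = c * ⟪b 1, x⟫ := hy 1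
  have y2 : ⟪b 2, y⟫ = c * ⟪b 2, x⟫ := hy 2
  have y3 : ⟪b 3, y⟫ = d * ⟪b 3, x⟫ := hy 3
  have hymem : y ∈ {x : E 4 | ∑ i : Fin 4, η i * ⟪b i, x⟫ ^ 2 = 0} ∩ closedBall (0 : E 4) 1 := by
    constructor
    · simp only [mem_setOf_eq, Fin.sum_univ_four, y0, y1, y2, y3]
      linear_combination hz
    · rw [mem_closedBall, dist_zero_right]
      refine le_trans ?_ hxn
      refine le_of_sq_aux ?_ (norm_nonneg _)
      rw [hnorm y, hnorm x, y0, y1, y2, y3]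
      have hcc : c ^ 2 ≤ 1 := by nlinarith
      have hdd : d ^ 2 ≤ 1 := by nlinarith
      simp only [mul_pow]
      nlinarith
  refine (Metric.infDist_le_dist_of_mem hymem).trans ?_
  have hε : 0 ≤ ε := (abs_nonneg _).trans hP
  rw [dist_eq_norm]
  refine le_of_sq_aux ?_ hC
  rw [hnorm, mul_pow, Real.sq_sqrt hε]
  simp only [inner_sub_right, y0, y1, y2, y3]
  nlinarith [hdist]
end
end
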